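/- Let K be a number field with ring of integers 𝓞_K and let f ∈ 𝓞_K[x] be a polynomial of degree 2. Suppose there is no linear polynomial σ(x) = ax + b with a, b ∈ K and a ≠ 0 such that f(σ(x)) = a·(x² − 2) + b as polynomials over K (i.e., σ^{−1} ∘ f ∘ σ is not the Chebyshev polynomial x² − 2 for any linear σ over K). Then for every ε > 0 there are infinitely many nonzero prime ideals 𝔭 of 𝓞_K with the leading coefficient of f not in 𝔭 and #Per(f_𝔭) ≤ ε·(N(𝔭) + 1); that is, the liminf over primes 𝔭 of #Per(f_𝔭)/(N(𝔭)+1) is 0. -/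

import Mathlib

open NumberField Polynomial

/-- The number of periodic points of the self-map of `R ⧸ I` induced by a polynomial
`f ∈ R[x]` (reduce the coefficients of `f` modulo `I` and iterate evaluation). -/
noncomputable def perCount {R : Type*} [CommRing R] (f : Polynomial R) (I : Ideal R) : ℕ :=
  Set.ncard {z : R ⧸ I | ∃ m : ℕ, 0 < m ∧
    (fun w => (f.map (Ideal.Quotient.mk I)).eval w)^[m] z = z}

namespace QLC
universe u

/-- The standard algebra structure on Laurent series. -/
noncomputable instance hsAlg {k : Type u} [Field k] : Algebra k (HahnSeries ℤ k) :=
  HahnSeries.instAlgebra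

/-! ### Order of vanishing of Laurent series -/

/-- `x` vanishes to order at least `n`. -/
def Vge {k : Type u} [Field k] (n : ℤ) (x : HahnSeries ℤ k) : Prop := (n : WithTop ℤ) ≤ x.orderTop

section V
variable {k : Type u} [Field k]

theorem vge_iff {n : ℤ} {x : HahnSeries ℤ k} : Vge n x ↔ ∀ j < n, x.coeff j = 0 := by
  unfold Vge
  rw [HahnSeries.le_orderTop_iff_forall]
  simp

theorem Vge.mono {m n : ℤ} {x : HahnSeries ℤ k} (h : Vge n x) (hmn : m ≤ n) : Vge m x :=
  le_trans (WithTop.coe_le_coe.2 hmn) h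

theorem vge_zero (n : ℤ) : Vge n (0 : HahnSeries ℤ k) := by simp [Vge]

theorem Vge.add {n : ℤ} {x y : HahnSeries ℤ k} (hx : Vge n x) (hy : Vge n y) : Vge n (x + y) :=
  le_trans (le_min hx hy) HahnSeries.min_orderTop_le_orderTop_add

theorem Vge.neg {n : ℤ} {x : HahnSeries ℤ k} (hx : Vge n x) : Vge n (-x) := by
  rw [vge_iff] at *
  intro j hj
  simp [hx j hj]

theorem Vge.sub {n : ℤ} {x y : HahnSeries ℤ k} (hx : Vge n x) (hy : Vge n y) : Vge n (x - y) := by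
  rw [sub_eq_add_neg]; exact hx.add hy.neg

theorem Vge.mul {m n : ℤ} {x y : HahnSeries ℤ k} (hx : Vge m x) (hy : Vge n y) :
    Vge (m + n) (x * y) := by
  unfold Vge at *
  rw [HahnSeries.orderTop_mul, WithTop.coe_add]
  exact add_le_add hx hy

theorem Vge.sum {ι : Type*} {s : Finset ι} {n : ℤ} {x : ι → HahnSeries ℤ k}
    (h : ∀ i ∈ s, Vge n (x i)) : Vge n (∑ i ∈ s, x i) := by
  classical
  induction s using Finset.induction_on with
  | empty => simpa using vge_zero n
  | insert a s ha ih =>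
    rw [Finset.sum_insert ha]
    exact (h a (Finset.mem_insert_self _ _)).add (ih fun i hi => h i (Finset.mem_insert_of_mem hi))

theorem vge_one : Vge 0 (1 : HahnSeries ℤ k) := by
  simp [Vge]

theorem Vge.pow {n : ℤ} {x : HahnSeries ℤ k} (h : Vge n x) (j : ℕ) : Vge (j * n) (x ^ j) := by
  induction j with
  | zero => simpa using vge_one
  | succ j ih =>
    rw [pow_succ]
    exact (ih.mul h).mono (by push_cast; linarith)

theorem Vge.prod {ι : Type*} {s : Finset ι} {n : ℤ} {x : ι → HahnSeries ℤ k}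
    (h : ∀ i ∈ s, Vge n (x i)) : Vge (s.card * n) (∏ i ∈ s, x i) := by
  classical
  induction s using Finset.induction_on with
  | empty => simpa using vge_one
  | insert a s ha ih =>
    rw [Finset.prod_insert ha, Finset.card_insert_of_notMem ha]
    exact ((h a (Finset.mem_insert_self _ _)).mul
      (ih fun i hi => h i (Finset.mem_insert_of_mem hi))).mono (by push_cast; linarith)

theorem vge_algebraMap (a : k) : Vge 0 (algebraMap k (HahnSeries ℤ k) a) := by
  rw [vge_iff]
  intro j hj
  rw [HahnSeries.algebraMap_apply]
  simp [HahnSeries.coeff_single_of_ne hj.ne]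

theorem Vge.smul {n : ℤ} {x : HahnSeries ℤ k} (h : Vge n x) (a : k) : Vge n (a • x) := by
  rw [vge_iff] at *
  intro j hj
  simp [h j hj]

theorem not_vge_of_orderTop {n t : ℤ} {x : HahnSeries ℤ k} (h : x.orderTop = t) (ht : t < n) :
    ¬ Vge n x := by
  unfold Vge
  rw [h, WithTop.coe_le_coe]
  omega

theorem exists_orderTop {x : HahnSeries ℤ k} (h : x ≠ 0) : ∃ t : ℤ, x.orderTop = t := by
  have := HahnSeries.orderTop_ne_top.2 h
  exact ⟨_, (WithTop.coe_untop _ this).symm⟩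

theorem orderTop_pow_int {t : ℤ} {x : HahnSeries ℤ k} (h : x.orderTop = t) (j : ℕ) :
    (x ^ j).orderTop = ((j * t : ℤ) : WithTop ℤ) := by
  induction j with
  | zero => simp
  | succ j ih =>
    rw [pow_succ, HahnSeries.orderTop_mul, ih, h, ← WithTop.coe_add]
    congr 1
    push_cast; ring

/-- If the orders of the terms are distinct, the sum is nonzero as soon as one term is. -/
theorem sum_ne_zero_of_orderTop {ι : Type*} {s : Finset ι} {x : ι → HahnSeries ℤ k}
    (hinj : ∀ i ∈ s, ∀ j ∈ s, x i ≠ 0 → x j ≠ 0 → (x i).orderTop = (x j).orderTop → i = j)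
    {i₀ : ι} (hi₀ : i₀ ∈ s) (h0 : x i₀ ≠ 0) : ∑ i ∈ s, x i ≠ 0 := by
  classical
  obtain ⟨i, hi, hmin⟩ := Finset.exists_min_image s (fun i => (x i).orderTop) ⟨i₀, hi₀⟩
  have hi0 : x i ≠ 0 := by
    intro h
    have := hmin i₀ hi₀
    rw [h, HahnSeries.orderTop_zero, top_le_iff, HahnSeries.orderTop_eq_top] at this
    exact h0 this
  obtain ⟨t, ht⟩ := exists_orderTop hi0
  intro hsum
  have hc : (∑ i ∈ s, x i).coeff t = 0 := by rw [hsum]; simp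
  rw [HahnSeries.coeff_sum, Finset.sum_eq_single_of_mem i hi] at hc
  · exact HahnSeries.coeff_orderTop_ne ht hc
  · intro j hj hji
    by_contra hne
    have hle := HahnSeries.orderTop_le_of_coeff_ne_zero hne
    have hj0 : x j ≠ 0 := by rintro h; simp [h] at hne
    have := hmin j hj
    simp only [ht] at this
    exact hji (hinj j hj i hi hj0 hi0 (by rw [ht]; exact le_antisymm hle this))

/-- orders of a polynomial in an element with a pole -/
theorem orderTop_aeval {e : ℕ} (he : 0 < e) {Y : HahnSeries ℤ k} (hY : Y.orderTop = ((-e : ℤ) : WithTop ℤ))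
    {P : k[X]} (hP : P ≠ 0) :
    (aeval Y P).orderTop = ((-(e * P.natDegree : ℕ) : ℤ) : WithTop ℤ) := by
  have hlead : P.coeff P.natDegree ≠ 0 := leadingCoeff_ne_zero.2 hP
  have hCo : ∀ a : k, a ≠ 0 → (algebraMap k (HahnSeries ℤ k) a).orderTop = ((0 : ℤ) : WithTop ℤ) := by
    intro a ha
    rw [HahnSeries.algebraMap_apply]
    simpa using HahnSeries.orderTop_single (Γ := ℤ) (a := 0) (r := a) ha
  rw [aeval_eq_sum_range, Finset.sum_range_succ]
  set A := ∑ i ∈ Finset.range P.natDegree, P.coeff i • Y ^ i with hA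
  have hl : (P.coeff P.natDegree • Y ^ P.natDegree).orderTop
      = ((-(e * P.natDegree : ℕ) : ℤ) : WithTop ℤ) := by
    rw [Algebra.smul_def, HahnSeries.orderTop_mul, hCo _ hlead, orderTop_pow_int hY, ← WithTop.coe_add]
    congr 1
    push_cast; ring
  have hAv : Vge (-(e * P.natDegree : ℕ) + 1) A := by
    refine Vge.sum fun i hi => ?_
    rw [Finset.mem_range] at hi
    refine Vge.smul (Vge.mono (n := i * (-e)) (Vge.pow hY.ge i) ?_) _
    have : e * (i + 1) ≤ e * P.natDegree := Nat.mul_le_mul_left _ hi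
    push_cast
    have : (e : ℤ) * (i + 1) ≤ e * P.natDegree := by exact_mod_cast this
    have he' : (1 : ℤ) ≤ e := by exact_mod_cast he
    nlinarith
  apply HahnSeries.orderTop_eq_of_le
  · rw [HahnSeries.mem_support, HahnSeries.coeff_add, vge_iff.1 hAv _ (by linarith), zero_add]
    exact HahnSeries.coeff_orderTop_ne hl
  · intro j hj
    by_contra hlt
    push Not at hlt
    apply hj
    rw [HahnSeries.coeff_add, vge_iff.1 hAv _ (by linarith), zero_add]
    apply HahnSeries.coeff_eq_zero_of_lt_orderTop
    rw [hl]; exact WithTop.coe_lt_coe.2 hlt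

end V
end QLC

namespace QLC
universe u

/-- Frobenius element at the rational point `t`. -/
def FrobAt (k : Type u) {B G : Type u} [Field k] [CommRing B] [Algebra k B] [Group G]
    [MulSemiringAction G B] (y : B) (t : k) (g : G) : Prop :=
  ∃ Q : Ideal B, Q.IsPrime ∧ y - algebraMap k B t ∈ Q ∧ ∀ x : B, g • x - x ^ (Nat.card k) ∈ Q

/-- The data needed to run Stepanov's method. -/
structure StepData (k B G : Type u) [Field k] [CommRing B] [Algebra k B] [Group G] [Fintype G]
    [MulSemiringAction G B] (e Cb : ℕ) where
  y : B
  Del : k[X]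
  D : Derivation k B B
  i : B →ₐ[k] HahnSeries ℤ k
  i_inj : Function.Injective i
  smul_k : ∀ (g : G) (a : k), g • algebraMap k B a = algebraMap k B a
  smul_y : ∀ g : G, g • y = y
  inv : ∀ x : B, (∀ g : G, g • x = x) → ∃ P : k[X], aeval y P = x
  bas : G → B
  bas_indep : ∀ P : G → k[X], ∑ j, aeval y (P j) * bas j = 0 → P = 0
  D_smul : ∀ (g : G) (x : B), D (g • x) = g • D x
  D_y : D y = aeval y Del
  e_pos : 0 < e
  ord_y : (i y).orderTop = ((-e : ℤ) : WithTop ℤ)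
  ord_bas : ∀ (g j : G), Vge (-Cb) (i (g • bas j))
  ord_D : ∀ (n : ℤ) (x : B), Vge n (i x) → Vge (n - Cb) (i (D x))
  reps : Finset G
  reps_card : reps.card * e = Fintype.card G
  reps_spec : ∀ h : G, ∃ h₀ ∈ reps, ∀ (n : ℤ) (x : B), Vge n (i (h₀ • x)) → Vge n (i (h • x))

theorem vge_prod' {k : Type u} [Field k] {ι : Type*} {s : Finset ι} {n : ι → ℤ}
    {x : ι → HahnSeries ℤ k}
    (h : ∀ i ∈ s, Vge (n i) (x i)) : Vge (∑ i ∈ s, n i) (∏ i ∈ s, x i) := by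
  classical
  induction s using Finset.induction_on with
  | empty => simpa using vge_one
  | insert a s ha ih =>
    rw [Finset.prod_insert ha, Finset.sum_insert ha]
    exact ((h a (Finset.mem_insert_self _ _)).mul
      (ih fun i hi => h i (Finset.mem_insert_of_mem hi)))

/-! ### Filtration attached to a derivation and an ideal -/
section Filt
variable {A : Type u} [CommRing A] (D : A → A) (Q : Ideal A)

/-- The first `M` derivatives of `x` lie in `Q`. -/
def Filt : ℕ → A → Prop
  | 0, _ => True
  | M + 1, x => x ∈ Q ∧ Filt M (D x)

variable {D Q}

theorem filt_of_forall {M : ℕ} {x : A} (h : ∀ m < M, D^[m] x ∈ Q) : Filt D Q M x := by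
  induction M generalizing x with
  | zero => trivial
  | succ M ih =>
    refine ⟨h 0 (by omega), ih fun m hm => ?_⟩
    have := h (m + 1) (by omega)
    rwa [Function.iterate_succ_apply] at this

theorem Filt.mono {M N : ℕ} {x : A} (h : Filt D Q M x) (hN : N ≤ M) : Filt D Q N x := by
  induction N generalizing M x with
  | zero => trivial
  | succ N ih =>
    obtain ⟨M, rfl⟩ : ∃ M', M = M' + 1 := ⟨M - 1, by omega⟩
    exact ⟨h.1, ih h.2 (by omega)⟩

theorem Filt.add (hadd : ∀ x y, D (x + y) = D x + D y) {M : ℕ} {x y : A}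
    (hx : Filt D Q M x) (hy : Filt D Q M y) : Filt D Q M (x + y) := by
  induction M generalizing x y with
  | zero => trivial
  | succ M ih => exact ⟨Q.add_mem hx.1 hy.1, by rw [hadd]; exact ih hx.2 hy.2⟩

theorem Filt.mul (hadd : ∀ x y, D (x + y) = D x + D y)
    (hmul : ∀ x y, D (x * y) = x * D y + y * D x) {M N : ℕ} {x y : A}
    (hx : Filt D Q M x) (hy : Filt D Q N y) : Filt D Q (M + N) (x * y) := by
  obtain ⟨L, hL⟩ : ∃ L, L = M + N := ⟨_, rfl⟩
  induction L generalizing M N x y with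
  | zero => rw [← hL]; trivial
  | succ L ih =>
    rw [← hL]
    refine ⟨?_, ?_⟩
    · rcases Nat.eq_zero_or_pos M with h | h
      · obtain ⟨N, rfl⟩ : ∃ N', N = N' + 1 := ⟨N - 1, by omega⟩
        exact Q.mul_mem_left _ hy.1
      · obtain ⟨M, rfl⟩ : ∃ N', M = N' + 1 := ⟨M - 1, by omega⟩
        exact Q.mul_mem_right _ hx.1
    · rw [hmul]
      refine Filt.add hadd ?_ ?_
      · rcases Nat.eq_zero_or_pos N with h | h
        · subst h
          obtain ⟨M, rfl⟩ : ∃ N', M = N' + 1 := ⟨M - 1, by omega⟩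
          have : L = M + 0 := by omega
          rw [this]
          exact ih (hx.mono (by omega)) (by trivial) this
        · obtain ⟨N, rfl⟩ : ∃ N', N = N' + 1 := ⟨N - 1, by omega⟩
          have : L = M + N := by omega
          rw [this]
          exact ih hx hy.2 this
      · rcases Nat.eq_zero_or_pos M with h | h
        · subst h
          obtain ⟨N, rfl⟩ : ∃ N', N = N' + 1 := ⟨N - 1, by omega⟩
          have : L = N + 0 := by omega
          rw [this]
          exact ih (hy.mono (by omega)) (by trivial) this
        · obtain ⟨M, rfl⟩ : ∃ N', M = N' + 1 := ⟨M - 1, by omega⟩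
          have : L = N + M := by omega
          rw [this]
          exact ih hy hx.2 this

theorem Filt.prod (hadd : ∀ x y, D (x + y) = D x + D y)
    (hmul : ∀ x y, D (x * y) = x * D y + y * D x) {ι : Type*} {s : Finset ι} {M : ℕ} {x : ι → A}
    (h : ∀ i ∈ s, Filt D Q M (x i)) : Filt D Q (s.card * M) (∏ i ∈ s, x i) := by
  classical
  induction s using Finset.induction_on with
  | empty => simp; trivial
  | insert a s ha ih =>
    rw [Finset.prod_insert ha, Finset.card_insert_of_notMem ha, add_mul, one_mul, add_comm]
    exact (h a (Finset.mem_insert_self _ _)).mul hadd hmul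
      (ih fun i hi => h i (Finset.mem_insert_of_mem hi))

end Filt

section
variable {k B G : Type u} [Field k] [CommRing B] [Algebra k B] [Group G] [Fintype G]
    [MulSemiringAction G B] {e Cb : ℕ}
namespace StepData
variable (S : StepData k B G e Cb)

theorem isDomain (S : StepData k B G e Cb) : IsDomain B := S.i_inj.isDomain S.i.toRingHom

theorem smul_smul_k (S : StepData k B G e Cb) (g : G) (a : k) (x : B) : g • (a • x) = a • (g • x) := by
  rw [Algebra.smul_def, smul_mul', S.smul_k, ← Algebra.smul_def]

theorem norm_mem (w : B) : ∃ P : k[X], aeval S.y P = ∏ h : G, h • w := by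
  apply S.inv
  intro g
  rw [Finset.smul_prod']
  simp_rw [← mul_smul]
  exact Fintype.prod_equiv (Equiv.mulLeft g) _ _ (fun x => rfl)

theorem norm_ne (S : StepData k B G e Cb) {w : B} (hw : w ≠ 0) : ∏ h : G, h • w ≠ 0 := by
  have := S.isDomain
  rw [Finset.prod_ne_zero_iff]
  intro h _ h0
  apply hw
  rwa [smul_eq_zero_iff_eq] at h0

theorem norm_zero {w : B} {n : G → ℤ} (hn : ∀ h : G, Vge (n h) (S.i (h • w)))
    (hpos : 0 < ∑ h, n h) : w = 0 := by
  by_contra hw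
  obtain ⟨P, hP⟩ := S.norm_mem w
  have hne := S.norm_ne hw
  rw [← hP] at hne
  have hP0 : P ≠ 0 := by rintro rfl; simp at hne
  have h1 := orderTop_aeval S.e_pos S.ord_y hP0
  have h2 : Vge (∑ h, n h) (S.i (aeval S.y P)) := by
    rw [hP, map_prod]
    exact vge_prod' fun h _ => hn h
  rw [← aeval_algHom_apply] at h2
  refine not_vge_of_orderTop h1 ?_ h2
  push_cast
  have : (0 : ℤ) ≤ (e : ℤ) * P.natDegree := by positivity
  linarith

theorem norm_deg {w : B} (hw : w ≠ 0) {m : ℕ} (hn : ∀ h : G, Vge (-m) (S.i (h • w))) :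
    ∃ P : k[X], P ≠ 0 ∧ aeval S.y P = ∏ h : G, h • w ∧ e * P.natDegree ≤ Fintype.card G * m := by
  obtain ⟨P, hP⟩ := S.norm_mem w
  have hne := S.norm_ne hw
  rw [← hP] at hne
  have hP0 : P ≠ 0 := by rintro rfl; simp at hne
  refine ⟨P, hP0, hP, ?_⟩
  by_contra hlt
  push Not at hlt
  have h1 := orderTop_aeval S.e_pos S.ord_y hP0
  have h2 : Vge ((Finset.univ : Finset G).card * (-m)) (S.i (aeval S.y P)) := by
    rw [hP, map_prod]
    exact Vge.prod fun h _ => hn h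
  rw [← aeval_algHom_apply] at h2
  refine not_vge_of_orderTop h1 ?_ h2
  rw [Finset.card_univ]
  have : ((Fintype.card G * m : ℕ) : ℤ) < (e * P.natDegree : ℕ) := by exact_mod_cast hlt
  push_cast at *
  linarith

/-- the basic elements -/
def w (a : ℕ) (p : G × Fin a) : B := S.bas p.1 * S.y ^ (p.2 : ℕ)

theorem w_indep (a : ℕ) : LinearIndependent k (S.w a) := by
  rw [Fintype.linearIndependent_iff]
  intro x hx
  have h := S.bas_indep (fun j => ∑ l : Fin a, C (x (j, l)) * X ^ (l : ℕ)) (by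
    rw [← hx, Fintype.sum_prod_type]
    refine Finset.sum_congr rfl fun j _ => ?_
    rw [map_sum, Finset.sum_mul]
    refine Finset.sum_congr rfl fun l _ => ?_
    simp only [w, map_mul, aeval_C, map_pow, aeval_X, Algebra.smul_def]
    ring)
  rintro ⟨j, l⟩
  have h2 := congrArg (fun P : k[X] => P.coeff l) (congrFun h j)
  simp only [finsetSum_coeff, coeff_C_mul_X_pow, Pi.zero_apply, coeff_zero] at h2
  rw [Finset.sum_eq_single l] at h2
  · simpa using h2
  · intro l' _ hl'
    rw [if_neg]
    intro h
    exact hl' (Fin.ext h.symm)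
  · simp

theorem w_ord (a : ℕ) (p : G × Fin a) (h : G) : Vge (-(e * a + Cb : ℕ)) (S.i (h • S.w a p)) := by
  rw [w, smul_mul', smul_pow', S.smul_y, map_mul, map_pow]
  refine ((S.ord_bas h p.1).mul (Vge.pow S.ord_y.ge p.2)).mono ?_
  have : (p.2 : ℤ) ≤ a := by exact_mod_cast p.2.2.le
  have h2 : (0 : ℤ) ≤ e := by positivity
  push_cast
  nlinarith

theorem span_ord (a : ℕ) {x : B} (hx : x ∈ Submodule.span k (Set.range (S.w a))) (h : G) :
    Vge (-(e * a + Cb : ℕ)) (S.i (h • x)) := by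
  induction hx using Submodule.span_induction with
  | mem x hx => obtain ⟨p, rfl⟩ := hx; exact S.w_ord a p h
  | zero => simpa using vge_zero _
  | add x y _ _ hx hy => rw [smul_add, map_add]; exact hx.add hy
  | smul c x _ hx =>
    rw [S.smul_smul_k, map_smul]; exact hx.smul c

theorem D_iter_smul (m : ℕ) (h : G) (x : B) : S.D^[m] (h • x) = h • S.D^[m] x := by
  induction m generalizing x with
  | zero => rfl
  | succ m ih => rw [Function.iterate_succ_apply, S.D_smul, ih, Function.iterate_succ_apply]

theorem D_iter_ord (m : ℕ) {n : ℤ} {x : B} (h : Vge n (S.i x)) :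
    Vge (n - m * Cb) (S.i (S.D^[m] x)) := by
  induction m generalizing x n with
  | zero => simpa using h
  | succ m ih =>
    rw [Function.iterate_succ_apply]
    exact (ih (S.ord_D n x h)).mono (by push_cast; linarith)

/-- A basis of the span with distinct orders. -/
theorem exists_v (a : ℕ) : ∃ (T : Finset ℤ) (v : ℤ → B), Fintype.card G * a ≤ T.card ∧
    (∀ t ∈ T, ∀ t' ∈ T, t - t' ≤ Fintype.card G * (e * a + Cb : ℕ)) ∧
    (∀ t ∈ T, (S.i (v t)).orderTop = t) ∧
    ∀ t ∈ T, v t ∈ Submodule.span k (Set.range (S.w a)) := by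
  classical
  set A : ℕ := e * a + Cb with hA
  set V := Submodule.span k (Set.range (S.w a)) with hV
  have hup : ∀ x ∈ V, ∀ t : ℤ, (S.i x).orderTop = t → -(A : ℤ) ≤ t ∧ t ≤ (Fintype.card G - 1) * A := by
    intro x hx t ht
    constructor
    · by_contra hlt
      push Not at hlt
      refine not_vge_of_orderTop ht hlt ?_
      have := S.span_ord a hx 1
      rwa [one_smul] at this
    · by_contra hlt
      push Not at hlt
      have hx0 : x = 0 := by
        refine S.norm_zero (n := fun h => if h = 1 then t else -A) ?_ ?_
        · intro h
          split_ifs with h1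
          · rw [h1, one_smul]; exact ht.ge
          · exact S.span_ord a hx h
        · rw [← Finset.add_sum_erase _ _ (Finset.mem_univ (1 : G))]
          rw [Finset.sum_congr rfl (g := fun _ => (-A : ℤ))
            (fun h hh => if_neg (Finset.ne_of_mem_erase hh))]
          rw [Finset.sum_const, Finset.card_erase_of_mem (Finset.mem_univ _), Finset.card_univ]
          simp only [if_true, nsmul_eq_mul]
          rw [Nat.cast_sub Fintype.card_pos]
          push_cast
          linarith
      rw [hx0, map_zero, HahnSeries.orderTop_zero] at ht
      exact absurd ht (by simp)
  set T : Finset ℤ := (Finset.Icc (-(A : ℤ)) ((Fintype.card G - 1) * A)).filter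
    (fun t => ∃ x ∈ V, (S.i x).orderTop = t) with hT
  have hTm : ∀ t ∈ T, ∃ x ∈ V, (S.i x).orderTop = t := fun t ht => (Finset.mem_filter.1 ht).2
  refine ⟨T, fun t => if h : ∃ x ∈ V, (S.i x).orderTop = t then h.choose else 0, ?_, ?_, ?_, ?_⟩
  · let φ : V →ₗ[k] (T → k) :=
      { toFun := fun x t => (S.i x).coeff t
        map_add' := by intro x y; ext t; simp
        map_smul' := by intro c x; ext t; simp }
    have hφ : Function.Injective φ := by
      rw [injective_iff_map_eq_zero]
      intro x hx
      by_contra hx0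
      have hne : S.i x ≠ 0 := by
        intro h
        apply hx0
        have := S.i_inj (h.trans (map_zero S.i).symm)
        exact Subtype.ext this
      obtain ⟨t, ht⟩ := exists_orderTop hne
      have htT : t ∈ T := Finset.mem_filter.2
        ⟨Finset.mem_Icc.2 (hup x x.2 t ht), x, x.2, ht⟩
      have := congrFun hx ⟨t, htT⟩
      exact HahnSeries.coeff_orderTop_ne ht this
    have h1 := LinearMap.finrank_le_finrank_of_injective hφ
    rw [hV, finrank_span_eq_card (S.w_indep a)] at h1
    simpa using h1
  · intro t ht t' ht'
    have h1 := Finset.mem_Icc.1 (Finset.mem_filter.1 ht).1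
    have h2 := Finset.mem_Icc.1 (Finset.mem_filter.1 ht').1
    linarith [h1.2, h2.1]
  · intro t ht
    simp only [dif_pos (hTm t ht)]
    exact (hTm t ht).choose_spec.2
  · intro t ht
    simp only [dif_pos (hTm t ht)]
    exact (hTm t ht).choose_spec.1

/-- multiplicity of a root from the filtration -/
theorem filt_poly {t : k} {Q : Ideal B} (hQ : Q.IsPrime) (hy : S.y - algebraMap k B t ∈ Q)
    (hD : S.Del.eval t ≠ 0) (r : ℕ) (hr : ∀ j : ℕ, 0 < j → j ≤ r → (j : k) ≠ 0) (R : ℕ) (N : k[X])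
    (hN : N.eval t ≠ 0) (hF : Filt S.D Q R (aeval S.y ((X - C t) ^ r * N))) : R ≤ r := by
  have hev : ∀ P : k[X], aeval S.y P ∈ Q → P.eval t = 0 := by
    intro P hP
    by_contra hne
    obtain ⟨P', hP'⟩ := X_sub_C_dvd_sub_C_eval (a := t) (p := P)
    have h1 : algebraMap k B (P.eval t) ∈ Q := by
      have : aeval S.y P - algebraMap k B (P.eval t) ∈ Q := by
        have := congrArg (aeval S.y) hP'
        simp only [map_sub, aeval_C, map_mul, aeval_X] at this
        rw [this]
        exact Q.mul_mem_right _ hy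
      have h2 := Q.sub_mem hP this
      rwa [sub_sub_cancel] at h2
    exact hQ.ne_top (Q.eq_top_of_isUnit_mem h1 ((IsUnit.mk0 _ hne).map _))
  induction r generalizing R N with
  | zero =>
    rcases R with _ | R
    · exact le_rfl
    · exact absurd (hev _ (by simpa using hF.1)) hN
  | succ r ih =>
    rcases R with _ | R
    · omega
    · have h2 := hF.2
      rw [Derivation.map_aeval, S.D_y, smul_eq_mul, ← map_mul] at h2
      have hh : derivative ((X - C t) ^ (r + 1) * N) * S.Del
          = (X - C t) ^ r * (S.Del * (C ((r + 1 : ℕ) : k) * N + (X - C t) * derivative N)) := by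
        simp only [derivative_mul, derivative_pow, derivative_sub, derivative_X, derivative_C]
        push_cast
        ring
      rw [hh] at h2
      have := ih (fun j hj hjr => hr j hj (by omega)) R _ (by
        simp only [eval_mul, eval_add, eval_C, eval_sub, eval_X, sub_self, zero_mul, add_zero]
        exact mul_ne_zero hD (mul_ne_zero (hr _ (by omega) le_rfl) hN)) h2
      omega

end StepData
end
end QLC

namespace QLC
universe u
section
variable {k B G : Type u} [Field k] [Finite k] [CommRing B] [Algebra k B] [Group G] [Fintype G]
    [MulSemiringAction G B] {e Cb : ℕ}
namespace StepData

theorem D_pow_card (S : StepData k B G e Cb) (u : B) : S.D (u ^ Nat.card k) = 0 := by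
  have h0 : ((Nat.card k : ℕ) : k) = 0 := by
    letI := Fintype.ofFinite k
    rw [Nat.card_eq_fintype_card]; exact FiniteField.cast_card_eq_zero k
  have h1 : ((Nat.card k : ℕ) : B) = 0 := by
    rw [← map_natCast (algebraMap k B), h0, map_zero]
  rw [Derivation.leibniz_pow, nsmul_eq_mul, h1, zero_mul]

theorem D_iter_sum (S : StepData k B G e Cb) {T : Finset ℤ} (v u : ℤ → B) (m : ℕ) :
    S.D^[m] (∑ t ∈ T, v t * u t ^ Nat.card k) = ∑ t ∈ T, S.D^[m] (v t) * u t ^ Nat.card k := by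
  induction m generalizing v with
  | zero => rfl
  | succ m ih =>
    rw [Function.iterate_succ_apply, map_sum]
    have : ∀ t ∈ T, S.D (v t * u t ^ Nat.card k) = S.D (v t) * u t ^ Nat.card k := by
      intro t _
      rw [Derivation.leibniz, S.D_pow_card, smul_zero, zero_add, smul_eq_mul, mul_comm]
    rw [Finset.sum_congr rfl this, ih (fun t => S.D (v t))]
    rfl

/-- Existence of the auxiliary coefficients. -/
theorem exists_aux (S : StepData k B G e Cb) (g : G) (a b M : ℕ) (T : Finset ℤ) (v : ℤ → B)
    (hT : Fintype.card G * a ≤ T.card)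
    (hv : ∀ t ∈ T, v t ∈ Submodule.span k (Set.range (S.w a)))
    (hcount : M * S.reps.card * (e * (a + b) + 2 * Cb + M * Cb + 1)
      < Fintype.card G * a * (Fintype.card G * b)) :
    ∃ u : ℤ → B, (∃ t ∈ T, u t ≠ 0) ∧
      (∀ t ∈ T, u t ∈ Submodule.span k (Set.range (S.w b))) ∧
      ∀ m < M, ∑ t ∈ T, S.D^[m] (v t) * (g • u t) = 0 := by
  classical
  set Lc := e * (a + b) + 2 * Cb + M * Cb + 1 with hLc
  let us : (T × (G × Fin b) → k) →ₗ[k] (T → B) :=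
    { toFun := fun x t => ∑ p, x (t, p) • S.w b p
      map_add' := by intro x y; ext t; simp [add_smul, Finset.sum_add_distrib]
      map_smul' := by intro c x; ext t; simp [Finset.smul_sum, smul_smul] }
  let Dl : ℕ → B →ₗ[k] B := fun m => (S.D : B →ₗ[k] B) ^ m
  have hDl : ∀ m x, Dl m x = S.D^[m] x := by
    intro m x
    simp only [Dl, Module.End.pow_apply]
    rfl
  let gl : G → B →ₗ[k] B := fun h =>
    { toFun := fun x => h • x
      map_add' := by intro x y; simp
      map_smul' := by intro c x; exact S.smul_smul_k h c x }
  let W : ℕ → (T → B) →ₗ[k] B := fun m =>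
    { toFun := fun u => ∑ t : T, S.D^[m] (v t) * (g • u t)
      map_add' := by intro x y; simp [mul_add, Finset.sum_add_distrib]
      map_smul' := by
        intro c x
        simp only [Pi.smul_apply, S.smul_smul_k, RingHom.id_apply, Finset.smul_sum, mul_smul_comm] }
  let Φ : (T × (G × Fin b) → k) →ₗ[k] ((Fin M × S.reps × Fin Lc) → k) :=
    { toFun := fun x p => (S.i (gl p.2.1 (W p.1 (us x)))).coeff (-(p.2.2 : ℕ) : ℤ)
      map_add' := by intro x y; ext p; simp
      map_smul' := by intro c x; ext p; simp }
  have hker : LinearMap.ker Φ ≠ ⊥ := by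
    apply LinearMap.ker_ne_bot_of_finrank_lt
    simp only [Module.finrank_pi, Fintype.card_prod, Fintype.card_fin, Fintype.card_coe]
    calc M * (S.reps.card * Lc) = M * S.reps.card * Lc := by ring
      _ < _ := hcount
      _ ≤ _ := Nat.mul_le_mul_right _ hT
  obtain ⟨x, hx, hx0⟩ := (Submodule.ne_bot_iff _).1 hker
  have husspan : ∀ t, us x t ∈ Submodule.span k (Set.range (S.w b)) := by
    intro t
    exact Submodule.sum_mem _ fun p _ => Submodule.smul_mem _ _ (Submodule.subset_span ⟨p, rfl⟩)
  have hW : ∀ m < M, W m (us x) = 0 := by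
    intro m hm
    refine S.norm_zero (n := fun _ => 1) ?_ (by
      simp [Fintype.card_pos])
    intro h
    obtain ⟨h₀, hh₀, hsp⟩ := S.reps_spec h
    apply hsp
    have hlow : Vge (-(Lc - 1 : ℤ)) (S.i (h₀ • W m (us x))) := by
      change Vge _ (S.i (h₀ • ∑ t : T, S.D^[m] (v t) * (g • us x t)))
      rw [Finset.smul_sum, map_sum]
      refine Vge.sum fun t _ => ?_
      rw [smul_mul', map_mul, ← mul_smul, ← S.D_iter_smul]
      refine ((S.D_iter_ord m (S.span_ord a (hv t t.2) h₀)).mul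
        (S.span_ord b (husspan t) (h₀ * g))).mono ?_
      have : (m : ℤ) * Cb ≤ M * Cb := by
        have : (m : ℤ) ≤ M := by exact_mod_cast hm.le
        nlinarith [(Nat.cast_nonneg Cb : (0 : ℤ) ≤ Cb)]
      rw [hLc]
      push_cast
      linarith
    rw [vge_iff] at hlow ⊢
    intro j hj
    by_cases hj2 : j < -(Lc - 1 : ℤ)
    · exact hlow j hj2
    · have hl : ((-j).toNat : ℤ) = -j := Int.toNat_of_nonneg (by omega)
      have hlt : (-j).toNat < Lc := by
        rw [← Int.ofNat_lt, hl]; omega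
      have := congrFun hx (⟨m, hm⟩, ⟨h₀, hh₀⟩, ⟨(-j).toNat, hlt⟩)
      change (S.i (h₀ • W m (us x))).coeff (-((-j).toNat : ℤ)) = 0 at this
      rwa [hl, neg_neg] at this
  refine ⟨fun t => if ht : t ∈ T then us x ⟨t, ht⟩ else 0, ?_, ?_, ?_⟩
  · by_contra hne
    push Not at hne
    apply hx0
    ext ⟨⟨t, ht⟩, p⟩
    have h1 := hne t ht
    simp only [dif_pos ht] at h1
    exact Fintype.linearIndependent_iff.1 (S.w_indep b) (fun p => x (⟨t, ht⟩, p)) h1 p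
  · intro t ht
    simp only [dif_pos ht]
    exact husspan _
  · intro m hm
    rw [← hW m hm]
    change _ = ∑ t : T, S.D^[m] (v t) * (g • us x t)
    rw [← Finset.sum_coe_sort T]
    refine Finset.sum_congr rfl fun t _ => ?_
    simp only [dif_pos t.2, Subtype.coe_eta]

theorem sum_ne (S : StepData k B G e Cb) {T : Finset ℤ} {v u : ℤ → B}
    (hv : ∀ t ∈ T, (S.i (v t)).orderTop = t)
    (hlt : ∀ t ∈ T, ∀ t' ∈ T, t - t' < Nat.card k)
    (hu : ∃ t ∈ T, u t ≠ 0) : ∑ t ∈ T, v t * u t ^ Nat.card k ≠ 0 := by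
  intro h0
  have h1 := congrArg S.i h0
  rw [map_sum, map_zero] at h1
  obtain ⟨t₀, ht₀, hu₀⟩ := hu
  have hne : ∀ t, u t ≠ 0 → S.i (u t) ≠ 0 := fun t h h2 => h (S.i_inj (h2.trans (map_zero S.i).symm))
  have hvne : ∀ t ∈ T, S.i (v t) ≠ 0 := by
    intro t ht h
    have := hv t ht
    rw [h, HahnSeries.orderTop_zero] at this
    exact absurd this (by simp)
  refine sum_ne_zero_of_orderTop ?_ ht₀ ?_ h1
  · intro t ht t' ht' hn hn' heq
    rw [map_mul, map_pow] at hn hn' heq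
    rw [map_mul, map_pow] at heq
    have hp : (Nat.card k) ≠ 0 := Nat.card_pos.ne'
    obtain ⟨s, hs⟩ := exists_orderTop (x := S.i (u t)) (by
      intro h; rw [h, zero_pow hp, mul_zero] at hn; exact hn rfl)
    obtain ⟨s', hs'⟩ := exists_orderTop (x := S.i (u t')) (by
      intro h; rw [h, zero_pow hp, mul_zero] at hn'; exact hn' rfl)
    rw [HahnSeries.orderTop_mul, HahnSeries.orderTop_mul, hv t ht, hv t' ht', orderTop_pow_int hs,
      orderTop_pow_int hs', ← WithTop.coe_add, ← WithTop.coe_add, WithTop.coe_inj] at heq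
    have h3 := hlt t ht t' ht'
    have h4 := hlt t' ht' t ht
    have hss : s = s' := by
      by_contra hne
      rcases lt_or_gt_of_ne hne with h | h
      · have : (Nat.card k : ℤ) * (s + 1) ≤ Nat.card k * s' := by
          apply mul_le_mul_of_nonneg_left (by omega) (by positivity)
        linarith
      · have : (Nat.card k : ℤ) * (s' + 1) ≤ Nat.card k * s := by
          apply mul_le_mul_of_nonneg_left (by omega) (by positivity)
        linarith
    subst hss
    linarith
  · rw [map_mul, map_pow]
    exact mul_ne_zero (hvne t₀ ht₀) (pow_ne_zero _ (hne t₀ hu₀))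

theorem core (S : StepData k B G e Cb) (g : G) (a b M : ℕ)
    (hcount : M * S.reps.card * (e * (a + b) + 2 * Cb + M * Cb + 1)
      < Fintype.card G * a * (Fintype.card G * b))
    (hq : Fintype.card G * (e * a + Cb) < Nat.card k)
    (hp : ∀ j : ℕ, 0 < j → j < Fintype.card G * M → (j : k) ≠ 0)
    (T : Finset k) (hT : ∀ t ∈ T, S.Del.eval t ≠ 0 ∧ FrobAt k S.y t g) :
    e * (T.card * (Nat.card (Subgroup.centralizer {g}) * M)) ≤
      Fintype.card G * (e * a + Cb + Nat.card k * (e * b + Cb)) := by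
  classical
  obtain ⟨O, v, hOc, hOd, hvo, hvs⟩ := S.exists_v a
  obtain ⟨u, hu0, hus, hW⟩ := S.exists_aux g a b M O v hOc hvs hcount
  set q := Nat.card k with hqdef
  set F := ∑ t ∈ O, v t * u t ^ q with hF
  have hF0 : F ≠ 0 := S.sum_ne hvo (fun t ht t' ht' => lt_of_le_of_lt (hOd t ht t' ht')
    (by exact_mod_cast hq)) hu0
  have hFo : ∀ h : G, Vge (-((e * a + Cb + q * (e * b + Cb) : ℕ) : ℤ)) (S.i (h • F)) := by
    intro h
    rw [hF, Finset.smul_sum, map_sum]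
    refine Vge.sum fun t ht => ?_
    rw [smul_mul', smul_pow', map_mul, map_pow]
    refine ((S.span_ord a (hvs t ht) h).mul ((S.span_ord b (hus t ht) h).pow q)).mono ?_
    push_cast
    linarith
  obtain ⟨P, hP0, hPn, hPd⟩ := S.norm_deg hF0 hFo
  set Z := Finset.univ.filter (fun h : G => h * g = g * h) with hZ
  have hZc : Nat.card (Subgroup.centralizer {g}) = Z.card := by
    rw [Nat.card_eq_fintype_card, Fintype.card_subtype]
    congr 1
    ext h
    simp only [hZ, Finset.mem_filter, Finset.mem_univ, true_and, Subgroup.mem_centralizer_iff,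
      Set.mem_singleton_iff, forall_eq]
    exact eq_comm
  set R := Z.card * M with hR
  have hZle : Z.card ≤ Fintype.card G := Finset.card_le_univ _
  have hmult : ∀ t ∈ T, R ≤ P.rootMultiplicity t := by
    intro t ht
    obtain ⟨hD, Q, hQp, hQy, hQf⟩ := hT t ht
    by_contra hlt
    push Not at hlt
    obtain ⟨N, hN, hNd⟩ := exists_eq_pow_rootMultiplicity_mul_and_not_dvd P hP0 t
    have hadd : ∀ x y, S.D (x + y) = S.D x + S.D y := map_add _
    have hmul : ∀ x y, S.D (x * y) = x * S.D y + y * S.D x := by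
      intro x y; rw [Derivation.leibniz, smul_eq_mul, smul_eq_mul]
    have hfilt : Filt S.D Q R (aeval S.y P) := by
      rw [hPn, ← Finset.prod_filter_mul_prod_filter_not Finset.univ (fun h : G => h * g = g * h)]
      have h1 : Filt S.D Q R (∏ h ∈ Z, h • F) := by
        refine Filt.prod hadd hmul fun h hh => filt_of_forall fun m hm => ?_
        have hcomm : h * g = g * h := (Finset.mem_filter.1 hh).2
        rw [S.D_iter_smul, hF, S.D_iter_sum, Finset.smul_sum]
        have h2 : ∑ t ∈ O, h • (S.D^[m] (v t) * (g • u t)) = 0 := by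
          rw [← Finset.smul_sum, hW m hm, smul_zero]
        have h3 : ∑ t ∈ O, h • (S.D^[m] (v t) * u t ^ q)
            = ∑ t ∈ O, (h • (S.D^[m] (v t) * u t ^ q) - h • (S.D^[m] (v t) * (g • u t))) := by
          rw [Finset.sum_sub_distrib, h2, sub_zero]
        rw [h3]
        refine Q.sum_mem fun t _ => ?_
        rw [smul_mul', smul_mul', smul_pow', ← mul_sub]
        refine Q.mul_mem_left _ ?_
        have := Q.neg_mem (hQf (h • u t))
        rwa [neg_sub, ← mul_smul, ← hcomm, mul_smul] at this
      exact h1.mul (N := 0) hadd hmul (by trivial)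
    rw [hN] at hfilt
    have := S.filt_poly hQp hQy hD (P.rootMultiplicity t) (fun j hj hjr => hp j hj (by
      calc j ≤ _ := hjr
        _ < R := hlt
        _ ≤ _ := Nat.mul_le_mul_right _ hZle)) R N (by
          intro h0; exact hNd (dvd_iff_isRoot.2 h0)) hfilt
    omega
  have hsum : T.card * R ≤ P.natDegree := by
    calc T.card * R = ∑ t ∈ T, R := by simp
      _ ≤ ∑ t ∈ T, P.roots.count t := Finset.sum_le_sum fun t ht => by
          rw [count_roots]; exact hmult t ht
      _ ≤ P.roots.card := by
          calc ∑ t ∈ T, P.roots.count t ≤ ∑ t ∈ T ∪ P.roots.toFinset, P.roots.count t :=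
                Finset.sum_le_sum_of_subset Finset.subset_union_left
            _ = P.roots.card := by
                apply Multiset.sum_count_eq_card
                intro a ha
                exact Finset.mem_union_right _ (Multiset.mem_toFinset.2 ha)
      _ ≤ _ := P.card_roots'
  rw [hZc]
  exact (Nat.mul_le_mul_left e hsum).trans hPd

end StepData
end
end QLC

namespace QLC
universe u

theorem ringChar_le_card (k : Type u) [Field k] [Finite k] : ringChar k ≤ Nat.card k := by
  have h := ringChar.spec k (Nat.card k)
  have h0 : ((Nat.card k : ℕ) : k) = 0 := by
    let _ := Fintype.ofFinite k
    rw [Nat.card_eq_fintype_card]; exact FiniteField.cast_card_eq_zero k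
  exact Nat.le_of_dvd Nat.card_pos (h.1 h0)

theorem cast_ne_zero_of_lt {k : Type u} [Field k] {j : ℕ} (hj : 0 < j) (hlt : j < ringChar k) :
    (j : k) ≠ 0 := by
  intro h
  exact absurd (Nat.le_of_dvd hj ((ringChar.spec k j).1 h)) (by omega)

theorem stepanov (d e Cb : ℕ) (η : ℝ) (hη : 0 < η) : ∃ p0 : ℕ,
    ∀ (k B G : Type u) [Field k] [Finite k] [CommRing B] [Algebra k B] [Group G] [Fintype G]
    [MulSemiringAction G B] (S : StepData k B G e Cb), Fintype.card G = d → p0 ≤ ringChar k →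
    ∀ (g : G) (T : Finset k), (∀ t ∈ T, S.Del.eval t ≠ 0 ∧ FrobAt k S.y t g) →
    (T.card : ℝ) * Nat.card (Subgroup.centralizer {g}) ≤ (1 + η) * Nat.card k := by
  obtain ⟨s, hs⟩ := exists_nat_ge (2 * (1 + Cb) / η)
  have hs1 : 2 * (1 + (Cb : ℝ)) ≤ s * η := by rwa [div_le_iff₀ hη] at hs
  have hspos : 0 < s := by
    rcases Nat.eq_zero_or_pos s with h | h
    · subst h
      have : (0 : ℝ) ≤ Cb := by positivity
      norm_num at hs1
      linarith
    · exact h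
  set M := d * s with hM
  set K1 := 2 * Cb + M * Cb + 1 with hK1
  set a := s * (s + 1 + K1) + 1 with ha
  obtain ⟨N, hN⟩ := exists_nat_ge (2 * (a + Cb) / η)
  have hN1 : 2 * ((a : ℝ) + Cb) ≤ N * η := by rwa [div_le_iff₀ hη] at hN
  refine ⟨N + d * M + d * (e * a + Cb) + 1, ?_⟩
  intro k B G _ _ _ _ _ _ _ S hd hp g T hT
  have hqp := ringChar_le_card k
  have hdpos : 0 < d := hd ▸ Fintype.card_pos
  have hcore := S.core g a (s + 1) M (by
      rw [hd]
      have hre : S.reps.card * e = d := hd ▸ S.reps_card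
      have hr : S.reps.card ≤ d := by
        rw [← hre]; exact Nat.le_mul_of_pos_right _ S.e_pos
      calc M * S.reps.card * (e * (a + (s + 1)) + 2 * Cb + M * Cb + 1)
          = M * (S.reps.card * e) * (a + (s + 1)) + M * S.reps.card * K1 := by rw [hK1]; ring
        _ ≤ M * d * (a + (s + 1)) + M * d * K1 := by
            rw [hre]
            gcongr
        _ = d * d * (s * a + s * (s + 1 + K1)) := by rw [hM]; ring
        _ < d * d * (s * a + a) := by
            apply Nat.mul_lt_mul_of_pos_left
            · omega
            · positivity
        _ = _ := by ring)
    (by rw [hd]; omega)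
    (by
      intro j hj hlt
      rw [hd] at hlt
      exact cast_ne_zero_of_lt hj (by omega)) T hT
  rw [hd] at hcore
  set Z := Nat.card (Subgroup.centralizer {g})
  set q := Nat.card k with hq
  have hNq : N ≤ q := by omega
  have e1 : 1 ≤ e := S.e_pos
  have h1 : T.card * (Z * s) ≤ a + Cb + q * (s + 1 + Cb) := by
    have : (d * e) * (T.card * (Z * s)) ≤ (d * e) * (a + Cb + q * (s + 1 + Cb)) := by
      calc (d * e) * (T.card * (Z * s)) = e * (T.card * (Z * M)) := by rw [hM]; ring
        _ ≤ d * (e * a + Cb + q * (e * (s + 1) + Cb)) := hcore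
        _ ≤ d * (e * a + e * Cb + q * (e * (s + 1) + e * Cb)) := by
            have : Cb ≤ e * Cb := Nat.le_mul_of_pos_left _ e1
            gcongr
        _ = _ := by ring
    exact Nat.le_of_mul_le_mul_left this (by positivity)
  have h2 : (T.card : ℝ) * (Z * s) ≤ a + Cb + q * (s + 1 + Cb) := by exact_mod_cast h1
  have hsr : (1 : ℝ) ≤ s := by exact_mod_cast hspos
  have hNq' : (N : ℝ) ≤ q := by exact_mod_cast hNq
  have hq0 : (0 : ℝ) ≤ q := by positivity
  have h3 : ((T.card : ℝ) * Z) * s ≤ ((1 + η) * q) * s := by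
    have h4 : (a : ℝ) + Cb ≤ q * s * η / 2 := by
      have : (N : ℝ) * η ≤ q * s * η := by
        have : (N : ℝ) ≤ q * s := by nlinarith
        exact mul_le_mul_of_nonneg_right this hη.le
      linarith
    have h5 : (q : ℝ) * (1 + Cb) ≤ q * (s * η / 2) := mul_le_mul_of_nonneg_left (by linarith) hq0
    nlinarith
  exact le_of_mul_le_mul_right h3 (by linarith)

theorem FrobAt.conj {k B G : Type u} [Field k] [CommRing B] [Algebra k B] [Group G]
    [MulSemiringAction G B] {y : B} {t : k} {g : G} (hy : ∀ g : G, g • y = y)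
    (hk : ∀ (g : G) (a : k), g • algebraMap k B a = algebraMap k B a)
    (h : FrobAt k y t g) (s : G) : FrobAt k y t (s * g * s⁻¹) := by
  obtain ⟨Q, hQ, hQy, hQf⟩ := h
  refine ⟨Q.comap (MulSemiringAction.toRingHom G B s⁻¹), Ideal.IsPrime.comap _, ?_, ?_⟩
  · rw [Ideal.mem_comap]
    simpa [MulSemiringAction.toRingHom_apply, smul_sub, hy, hk] using hQy
  · intro x
    rw [Ideal.mem_comap]
    have := hQf (s⁻¹ • x)
    simpa [MulSemiringAction.toRingHom_apply, smul_sub, smul_pow', ← mul_smul, mul_assoc] using this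

theorem card_conj_mul {G : Type u} [Group G] [Fintype G] [DecidableEq G] (g : G) :
    ((Finset.univ : Finset G).image (fun s => s * g * s⁻¹)).card
      * Nat.card (Subgroup.centralizer {g}) = Fintype.card G := by
  classical
  have h := MulAction.card_orbit_mul_card_stabilizer_eq_card_group (ConjAct G) g
  rw [ConjAct.card] at h
  rw [← h]
  congr 1
  · rw [Fintype.card_of_subtype]
    intro x
    simp only [Finset.mem_image, Finset.mem_univ, true_and, MulAction.mem_orbit_iff]
    constructor
    · rintro ⟨s, rfl⟩; exact ⟨ConjAct.toConjAct s, by rw [ConjAct.toConjAct_smul]⟩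
    · rintro ⟨s, rfl⟩; exact ⟨ConjAct.ofConjAct s, by rw [ConjAct.smul_def]⟩
  · rw [← Nat.card_eq_fintype_card]
    rw [ConjAct.stabilizer_eq_centralizer]
    exact Nat.card_congr (Equiv.refl _)

theorem chebotarev (d e Cb : ℕ) (η : ℝ) (hη : 0 < η) : ∃ p0 : ℕ,
    ∀ (k B G : Type u) [Field k] [Finite k] [CommRing B] [Algebra k B] [Group G] [Fintype G]
    [MulSemiringAction G B] (S : StepData k B G e Cb), Fintype.card G = d → p0 ≤ ringChar k →
    ∀ (U : Finset G) (_ : ∀ g ∈ U, ∀ s : G, s * g * s⁻¹ ∈ U) (T : Finset k),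
    (∀ t ∈ T, S.Del.eval t ≠ 0 ∧ ∃ g ∈ U, FrobAt k S.y t g) →
    (T.card : ℝ) * d ≤ (1 + η) * Nat.card k * U.card := by
  classical
  obtain ⟨p0, hp0⟩ := stepanov d e Cb η hη
  refine ⟨p0, ?_⟩
  intro k B G _ _ _ _ _ _ _ S hd hp U hU T hT
  have h1 : ∀ g ∈ U, ((T.filter (fun t => FrobAt k S.y t g)).card : ℝ)
      * Nat.card (Subgroup.centralizer {g}) ≤ (1 + η) * Nat.card k := by
    intro g _
    apply hp0 k B G S hd hp
    intro t ht
    rw [Finset.mem_filter] at ht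
    exact ⟨(hT t ht.1).1, ht.2⟩
  have h2 : T.card * d ≤ ∑ g ∈ U, (T.filter (fun t => FrobAt k S.y t g)).card
      * Nat.card (Subgroup.centralizer {g}) := by
    calc T.card * d = ∑ t ∈ T, d := by simp
      _ ≤ ∑ t ∈ T, ∑ g ∈ U, if FrobAt k S.y t g then Nat.card (Subgroup.centralizer {g}) else 0 := by
          refine Finset.sum_le_sum fun t ht => ?_
          obtain ⟨_, g, hg, hf⟩ := hT t ht
          rw [← hd, ← card_conj_mul g]
          rw [← Finset.sum_filter, ← smul_eq_mul, ← Finset.sum_const]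
          calc ∑ x ∈ (Finset.univ : Finset G).image (fun s => s * g * s⁻¹),
                Nat.card (Subgroup.centralizer {g})
              = ∑ x ∈ (Finset.univ : Finset G).image (fun s => s * g * s⁻¹),
                Nat.card (Subgroup.centralizer {x}) := by
                refine Finset.sum_congr rfl fun x hx => ?_
                obtain ⟨s, -, rfl⟩ := Finset.mem_image.1 hx
                have e1 := card_conj_mul g
                have e2 := card_conj_mul (s * g * s⁻¹)
                have e3 : (Finset.univ : Finset G).image (fun r => r * (s * g * s⁻¹) * r⁻¹)
                    = (Finset.univ : Finset G).image (fun s => s * g * s⁻¹) := by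
                  ext z
                  simp only [Finset.mem_image, Finset.mem_univ, true_and]
                  constructor
                  · rintro ⟨r, rfl⟩; exact ⟨r * s, by group⟩
                  · rintro ⟨r, rfl⟩; exact ⟨r * s⁻¹, by group⟩
                rw [e3, ← e1] at e2
                refine (Nat.eq_of_mul_eq_mul_left ?_ e2).symm
                exact Finset.card_pos.2 ⟨_, hx⟩
            _ ≤ _ := by
                refine Finset.sum_le_sum_of_subset ?_
                intro x hx
                obtain ⟨s, -, rfl⟩ := Finset.mem_image.1 hx
                exact Finset.mem_filter.2 ⟨hU g hg s, hf.conj S.smul_y S.smul_k s⟩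
      _ = _ := by
          rw [Finset.sum_comm]
          refine Finset.sum_congr rfl fun g _ => ?_
          rw [← Finset.sum_filter, Finset.sum_const, smul_eq_mul]
  calc (T.card : ℝ) * d = ((T.card * d : ℕ) : ℝ) := by push_cast; ring
    _ ≤ ((∑ g ∈ U, (T.filter (fun t => FrobAt k S.y t g)).card
      * Nat.card (Subgroup.centralizer {g}) : ℕ) : ℝ) := by exact_mod_cast h2
    _ = ∑ g ∈ U, ((T.filter (fun t => FrobAt k S.y t g)).card : ℝ)
      * Nat.card (Subgroup.centralizer {g}) := by push_cast; rfl
    _ ≤ ∑ g ∈ U, (1 + η) * Nat.card k := Finset.sum_le_sum h1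
    _ = _ := by rw [Finset.sum_const, nsmul_eq_mul]; ring

end QLC

namespace QLC
universe u

theorem StepData.aeval_inj {k B G : Type u} [Field k] [CommRing B] [Algebra k B] [Group G]
    [Fintype G] [MulSemiringAction G B] {e Cb : ℕ} (S : StepData k B G e Cb) :
    Function.Injective (aeval S.y : k[X] →ₐ[k] B) := by
  rw [injective_iff_map_eq_zero]
  intro P hP
  by_contra h
  have h1 := orderTop_aeval S.e_pos S.ord_y h
  rw [aeval_algHom_apply, hP, map_zero, HahnSeries.orderTop_zero] at h1
  exact absurd h1 WithTop.top_ne_coe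

theorem StepData.exists_frob {k B G : Type u} [Field k] [Finite k] [CommRing B] [Algebra k B]
    [Group G] [Fintype G] [MulSemiringAction G B] {e Cb : ℕ} (S : StepData k B G e Cb)
    (hft : Algebra.FiniteType k B) (t : k) : ∃ g : G, FrobAt k S.y t g := by
  classical
  let : Algebra k[X] B := (aeval S.y : k[X] →ₐ[k] B).toRingHom.toAlgebra
  have hmap : ∀ P : k[X], algebraMap k[X] B P = aeval S.y P := fun P => rfl
  have hfix : ∀ (g : G) (P : k[X]), g • aeval S.y P = aeval S.y P := by
    intro g P
    induction P using Polynomial.induction_on' with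
    | add P Q hP hQ => rw [map_add, smul_add, hP, hQ]
    | monomial n a =>
      rw [aeval_monomial, smul_mul', smul_pow', S.smul_y, S.smul_k]
  have : SMulCommClass G k[X] B := ⟨fun g P x => by
    rw [Algebra.smul_def, smul_mul', hmap, hfix, Algebra.smul_def, hmap]⟩
  have : Algebra.IsInvariant k[X] B G := ⟨fun x hx => S.inv x hx⟩
  have : Algebra.IsIntegral k[X] B := Algebra.IsInvariant.isIntegral k[X] B G
  have hinj : Function.Injective (algebraMap k[X] B) := S.aeval_inj
  let P : Ideal k[X] := Ideal.span {X - C t}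
  have hPmax : P.IsMaximal := by
    apply PrincipalIdealRing.isMaximal_of_irreducible (irreducible_X_sub_C t)
  obtain ⟨Q, hQ, hQc⟩ := Ideal.exists_ideal_over_maximal_of_isIntegral (S := B) P (by
    rw [(RingHom.injective_iff_ker_eq_bot _).1 hinj]; exact bot_le)
  have := hQ
  have : Finite (B ⧸ Q) := by
    have : Algebra.FiniteType k (B ⧸ Q) := by infer_instance
    let := Ideal.Quotient.field Q
    have : Module.Finite k (B ⧸ Q) := finite_of_finite_type_of_isJacobsonRing k (B ⧸ Q)
    exact Module.finite_of_finite k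
  obtain ⟨g, hg⟩ := IsArithFrobAt.exists_of_isInvariant k[X] G Q
  have hcard : Nat.card (k[X] ⧸ Q.under k[X]) = Nat.card k := by
    have : Q.under k[X] = P := hQc
    rw [this]
    exact Nat.card_congr (quotientSpanXSubCAlgEquiv t).toEquiv
  refine ⟨g, Q, hQ.isPrime, ?_, ?_⟩
  · have : (X - C t : k[X]) ∈ Q.comap (algebraMap k[X] B) := by
      rw [hQc]; exact Ideal.subset_span rfl
    rw [Ideal.mem_comap, hmap] at this
    simpa using this
  · intro x
    have := hg x
    rw [hcard] at this
    exact this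

end QLC

namespace QLC
universe u

/-- A derivation of a separable algebraic extension killing the generator of the base is zero. -/
theorem deriv_eq_zero {k F E : Type u} [Field k] [Field F] [Field E] [Algebra k[X] F]
    [IsFractionRing k[X] F] [Algebra F E] [Algebra k[X] E] [IsScalarTower k[X] F E] [Algebra k E]
    [IsScalarTower k k[X] E] [FiniteDimensional F E] [Algebra.IsSeparable F E]
    (D : Derivation k E E) (hD : D (algebraMap k[X] E X) = 0) : D = 0 := by
  have h1 : ∀ P : k[X], D (algebraMap k[X] E P) = 0 := by
    intro P
    have : algebraMap k[X] E P = aeval (algebraMap k[X] E X) P := by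
      conv_lhs => rw [← aeval_X_left_apply P]
      rw [← aeval_algebraMap_apply]
    rw [this, Derivation.map_aeval, hD, smul_zero]
  have h2 : ∀ c : F, D (algebraMap F E c) = 0 := by
    intro c
    obtain ⟨a, b, hb, rfl⟩ := IsFractionRing.div_surjective (A := k[X]) c
    have hb0 : algebraMap k[X] E b ≠ 0 := by
      rw [IsScalarTower.algebraMap_apply k[X] F E, Ne,
        FaithfulSMul.algebraMap_eq_zero_iff, IsFractionRing.to_map_eq_zero_iff]
      exact nonZeroDivisors.ne_zero hb
    rw [map_div₀, ← IsScalarTower.algebraMap_apply, ← IsScalarTower.algebraMap_apply,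
      Derivation.leibniz_div, h1, h1]
    simp
  let D' : Derivation F E E := Derivation.mk'
    { toFun := D
      map_add' := map_add D
      map_smul' := by
        intro c x
        have hs : ∀ z : E, c • z = algebraMap F E c * z := Algebra.smul_def c
        rw [hs, Derivation.leibniz, h2, smul_zero, add_zero, RingHom.id_apply, hs, smul_eq_mul] }
    (by intro a b; exact D.leibniz a b)
  ext x
  change D' x = 0
  have h3 := D'.map_aeval (minpoly F x) x
  rw [minpoly.aeval, map_zero, smul_eq_mul, eq_comm, mul_eq_zero] at h3
  rcases h3 with h | h
  · exact absurd h (Separable.aeval_derivative_ne_zero (Algebra.IsSeparable.isSeparable F x)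
      (minpoly.aeval F x))
  · exact h

section Span
variable {F E : Type u} [Field F] [Field E] [Algebra F E] [FiniteDimensional F E]

open Pointwise in
theorem span_pow_eq_top {Z : Set E} (hZ : Algebra.adjoin F Z = ⊤) {d : ℕ}
    (hd : Module.finrank F E ≤ d) : Submodule.span F ((insert 1 Z : Set E) ^ d) = ⊤ := by
  rw [← Submodule.span_pow]
  set S := Submodule.span F (insert 1 Z : Set E) with hS
  have hone : (1 : Submodule F E) ≤ S := by
    rw [Submodule.one_le]; exact Submodule.subset_span (Set.mem_insert _ _)
  have hmono : ∀ j, S ^ j ≤ S ^ (j + 1) := fun j => pow_le_pow_right₀ hone (Nat.le_succ j)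
  have key : ∀ j, S ^ j = ⊤ ∨ j + 1 ≤ Module.finrank F (S ^ j : Submodule F E) := by
    intro j
    induction j with
    | zero =>
      right
      rw [pow_zero]
      rw [Submodule.one_eq_span, finrank_span_singleton one_ne_zero]
    | succ j ih =>
      rcases ih with h | h
      · left; exact top_le_iff.1 (h ▸ hmono j)
      · by_cases heq : S ^ j = S ^ (j + 1)
        · left
          rw [← heq]
          have hst : ∀ i, S ^ (j + i) = S ^ j := by
            intro i
            induction i with
            | zero => rfl
            | succ i ih => rw [← add_assoc, pow_succ, ih, ← pow_succ, ← heq]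
          let A : Subalgebra F E := (S ^ j).toSubalgebra
            ((Submodule.one_le.1 ((one_pow j).symm.le.trans (pow_le_pow_left' hone j))))
            (by
              intro x y hx hy
              have := Submodule.mul_mem_mul hx hy
              rwa [← pow_add, hst] at this)
          have hA : Algebra.adjoin F Z ≤ A := by
            apply Algebra.adjoin_le
            intro z hz
            change z ∈ S ^ j
            rw [heq, add_comm, pow_add, pow_one]
            have : z * 1 ∈ S * S ^ j := Submodule.mul_mem_mul
              (Submodule.subset_span (Set.mem_insert_of_mem _ hz)) A.one_mem
            rwa [mul_one] at this
          rw [hZ] at hA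
          rw [eq_top_iff]
          intro x _
          exact hA (Algebra.mem_top (x := x))
        · right
          have := Submodule.finrank_lt_finrank_of_lt (lt_of_le_of_ne (hmono j) heq)
          omega
  rcases key d with h | h
  · exact h
  · have := Submodule.finrank_le (S ^ d)
    omega
end Span

section Builder
variable {k F E : Type u} [Field k] [Field F] [Field E] [Algebra k[X] F]
    [IsFractionRing k[X] F] [Algebra F E] [Algebra k[X] E] [IsScalarTower k[X] F E] [Algebra k E]
    [IsScalarTower k k[X] E]

/-- The ring generated by `Z`. -/
noncomputable abbrev RB (k : Type u) {E : Type u} [Field k] [Field E] [Algebra k[X] E] (Z : Set E) :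
    Subalgebra k[X] E := Algebra.adjoin k[X] Z

theorem gal_k (g : E ≃ₐ[F] E) (P : k[X]) : g (algebraMap k[X] E P) = algebraMap k[X] E P := by
  rw [IsScalarTower.algebraMap_apply k[X] F E, g.commutes]

theorem RB_stable {Z : Set E} (hZ : ∀ g : E ≃ₐ[F] E, ∀ z ∈ Z, g z ∈ Z) (g : E ≃ₐ[F] E) {x : E}
    (hx : x ∈ RB k Z) : g x ∈ RB k Z := by
  induction hx using Algebra.adjoin_induction with
  | mem x hx => exact Algebra.subset_adjoin (hZ g x hx)
  | algebraMap r => rw [gal_k]; exact Subalgebra.algebraMap_mem _ _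
  | add x y _ _ hx hy => rw [map_add]; exact add_mem hx hy
  | mul x y _ _ hx hy => rw [map_mul]; exact mul_mem hx hy

/-- The Galois action on `RB`. -/
@[reducible] noncomputable def RB_action {Z : Set E} (hZ : ∀ g : E ≃ₐ[F] E, ∀ z ∈ Z, g z ∈ Z) :
    MulSemiringAction (E ≃ₐ[F] E) (RB k Z) where
  smul g x := ⟨g x, RB_stable hZ g x.2⟩
  one_smul x := rfl
  mul_smul g h x := rfl
  smul_zero g := Subtype.ext (map_zero g)
  smul_add g x y := Subtype.ext (map_add g _ _)
  smul_one g := Subtype.ext (map_one g)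
  smul_mul g x y := Subtype.ext (map_mul g _ _)

/-- Data on a Galois extension from which `StepData` is built. -/
structure PreStep (k F E : Type u) [Field k] [Field F] [Field E] [Algebra k[X] F]
    [IsFractionRing k[X] F] [Algebra F E] [Algebra k[X] E] [IsScalarTower k[X] F E] [Algebra k E]
    [IsScalarTower k k[X] E] (Z : Set E) (e c : ℕ) where
  fin : Z.Finite
  int : ∀ z ∈ Z, IsIntegral k[X] z
  stab : ∀ g : E ≃ₐ[F] E, ∀ z ∈ Z, g z ∈ Z
  gen : Algebra.adjoin F Z = ⊤
  i : E →ₐ[k] HahnSeries ℤ k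
  e_pos : 0 < e
  ord_y : (i (algebraMap k[X] E X)).orderTop = ((-e : ℤ) : WithTop ℤ)
  ord_Z : ∀ z ∈ Z, Vge (-c) (i z)
  Del : k[X]
  D : Derivation k E E
  D_y : D (algebraMap k[X] E X) = algebraMap k[X] E Del
  D_Z : ∀ z ∈ Z, D z ∈ RB k Z
  ord_D : ∀ (n : ℤ) (x : E), Vge n (i x) → Vge (n - c) (i (D x))
  reps : Finset (E ≃ₐ[F] E)
  reps_card : reps.card * e = Nat.card (E ≃ₐ[F] E)
  reps_spec : ∀ h : E ≃ₐ[F] E, ∃ h₀ ∈ reps, ∀ (n : ℤ) (x : E), Vge n (i (h₀ x)) → Vge n (i (h x))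

theorem aeval_X_eq (P : k[X]) : aeval (algebraMap k[X] E X) P = algebraMap k[X] E P := by
  conv_rhs => rw [← aeval_X_left_apply P]
  rw [← aeval_algebraMap_apply]

namespace PreStep
variable {Z : Set E} {e c : ℕ} [FiniteDimensional F E] [IsGalois F E]

theorem D_comm (S : PreStep k F E Z e c) (g : E ≃ₐ[F] E) (x : E) : S.D (g x) = g (S.D x) := by
  have hk : ∀ a : k, g (algebraMap k E a) = algebraMap k E a := by
    intro a
    rw [IsScalarTower.algebraMap_apply k k[X] E, gal_k]
  let D' : Derivation k E E := Derivation.mk'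
    { toFun := fun x => g.symm (S.D (g x)) - S.D x
      map_add' := by
        intro x y
        simp only [map_add]
        abel
      map_smul' := by
        intro a x
        have hk' : g.symm (algebraMap k E a) = algebraMap k E a := by
          rw [AlgEquiv.symm_apply_eq, hk]
        have hs : ∀ z : E, a • z = algebraMap k E a * z := Algebra.smul_def a
        simp only [hs, map_mul, hk, Derivation.leibniz, Derivation.map_algebraMap,
          smul_zero, add_zero, smul_eq_mul, hk', RingHom.id_apply]
        rw [mul_zero, mul_zero, add_zero, add_zero, map_mul g.symm, hk']
        ring }
    (by
      intro a b
      simp only [LinearMap.coe_mk, AddHom.coe_mk, map_mul, Derivation.leibniz, smul_eq_mul, map_add,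
        AlgEquiv.symm_apply_apply]
      ring)
  have h0 : D' = 0 := by
    apply deriv_eq_zero (F := F)
    change g.symm (S.D (g _)) - S.D _ = 0
    rw [gal_k, S.D_y, sub_eq_zero, AlgEquiv.symm_apply_eq, gal_k]
  have := congrArg (fun D : Derivation k E E => D x) h0
  change g.symm (S.D (g x)) - S.D x = 0 at this
  rw [sub_eq_zero, AlgEquiv.symm_apply_eq] at this
  exact this

theorem D_mem (S : PreStep k F E Z e c) {x : E} (hx : x ∈ RB k Z) : S.D x ∈ RB k Z := by
  induction hx using Algebra.adjoin_induction with
  | mem x hx => exact S.D_Z x hx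
  | algebraMap r =>
    rw [← aeval_X_eq, Derivation.map_aeval, aeval_X_eq, S.D_y, smul_eq_mul]
    exact mul_mem (Subalgebra.algebraMap_mem _ _) (Subalgebra.algebraMap_mem _ _)
  | add x y _ _ hx hy => rw [map_add]; exact add_mem hx hy
  | mul x y hx' hy' hx hy =>
    rw [Derivation.leibniz, smul_eq_mul, smul_eq_mul]
    exact add_mem (mul_mem hx' hy) (mul_mem hy' hx)

theorem RB_int (S : PreStep k F E Z e c) {x : E} (hx : x ∈ RB k Z) : IsIntegral k[X] x := by
  induction hx using Algebra.adjoin_induction with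
  | mem x hx => exact S.int x hx
  | algebraMap r => exact isIntegral_algebraMap
  | add x y _ _ hx hy => exact hx.add hy
  | mul x y _ _ hx hy => exact hx.mul hy

open Pointwise in
theorem exists_bas (S : PreStep k F E Z e c) : ∃ b : (E ≃ₐ[F] E) → RB k Z,
    LinearIndependent F (fun j => (b j : E)) ∧
    ∀ g j : E ≃ₐ[F] E, Vge (-(Nat.card (E ≃ₐ[F] E) * c : ℕ)) (S.i (g (b j))) := by
  classical
  set d := Nat.card (E ≃ₐ[F] E) with hd
  have hdf : d = Module.finrank F E := IsGalois.card_aut_eq_finrank F E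
  have hpow : ∀ n, ∀ x ∈ (insert 1 Z : Set E) ^ n, x ∈ RB k Z ∧
      ∀ g : E ≃ₐ[F] E, Vge (-(n * c : ℕ)) (S.i (g x)) := by
    intro n
    induction n with
    | zero =>
      intro x hx
      rw [pow_zero, Set.mem_one] at hx
      subst hx
      refine ⟨one_mem _, fun g => ?_⟩
      rw [map_one, map_one]
      simpa using vge_one
    | succ n ih =>
      intro x hx
      rw [pow_succ] at hx
      obtain ⟨x, hx', z, hz, rfl⟩ := Set.mem_mul.1 hx
      obtain ⟨h1, h2⟩ := ih x hx'
      rcases hz with rfl | hz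
      · rw [mul_one]
        refine ⟨h1, fun g => (h2 g).mono ?_⟩
        push_cast
        nlinarith [(Nat.cast_nonneg c : (0 : ℤ) ≤ c)]
      · refine ⟨mul_mem h1 (Algebra.subset_adjoin hz), fun g => ?_⟩
        rw [map_mul, map_mul]
        refine ((h2 g).mul (S.ord_Z _ (S.stab g z hz))).mono ?_
        push_cast
        linarith
  have htop := span_pow_eq_top S.gen hdf.ge
  obtain ⟨b, hb, hsp, hli⟩ := exists_linearIndependent F ((insert 1 Z : Set E) ^ d)
  rw [htop] at hsp
  let bb := Module.Basis.mk hli (by rw [Subtype.range_coe]; exact hsp.ge)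
  have hcard : Nat.card (E ≃ₐ[F] E) = Nat.card b := by
    rw [← hd, hdf, Module.finrank_eq_nat_card_basis bb]
  have : Finite b := Module.Finite.finite_basis bb
  let eqv : (E ≃ₐ[F] E) ≃ b := Classical.choice ((Finite.card_eq).1 hcard)
  refine ⟨fun j => ⟨(eqv j : E), (hpow d _ (hb (eqv j).2)).1⟩, ?_, ?_⟩
  · exact hli.comp eqv eqv.injective
  · intro g j
    exact (hpow d _ (hb (eqv j).2)).2 g

/-- Build the Stepanov data. -/
noncomputable def toStep (S : PreStep k F E Z e c) {d : ℕ} (hd : Nat.card (E ≃ₐ[F] E) = d)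
    (hd1 : 1 ≤ d) :
    letI := RB_action (k := k) S.stab
    StepData k (RB k Z) (E ≃ₐ[F] E) e (d * c) :=
  letI := RB_action (k := k) S.stab
  { y := algebraMap k[X] (RB k Z) X
    Del := S.Del
    D := Derivation.mk'
      { toFun := fun x => ⟨S.D x, S.D_mem x.2⟩
        map_add' := by intro x y; apply Subtype.ext; exact map_add S.D _ _
        map_smul' := by
          intro a x; apply Subtype.ext
          exact S.D.map_smul a (x : E) }
      (by
        intro a b; apply Subtype.ext
        exact S.D.leibniz (a : E) (b : E))
    i := S.i.comp ((RB k Z).val.restrictScalars k)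
    i_inj := fun x y h => Subtype.ext (S.i.injective h)
    smul_k := fun g a => Subtype.ext (by
      change g (algebraMap k E a) = algebraMap k E a
      rw [IsScalarTower.algebraMap_apply k k[X] E, gal_k])
    smul_y := fun g => Subtype.ext (gal_k g X)
    inv := by
      intro x hx
      have h1 : ∀ g : E ≃ₐ[F] E, g (x : E) = x := fun g => congrArg Subtype.val (hx g)
      obtain ⟨c, hc⟩ := (IsGalois.mem_range_algebraMap_iff_fixed (F := F) (x : E)).2 h1
      have hci : IsIntegral k[X] c := by
        have := S.RB_int x.2
        rw [← hc] at this
        exact (isIntegral_algebraMap_iff (FaithfulSMul.algebraMap_injective F E)).1 this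
      obtain ⟨P, hP⟩ := IsIntegrallyClosed.isIntegral_iff.1 hci
      refine ⟨P, Subtype.ext ?_⟩
      rw [aeval_algebraMap_apply, aeval_X_left_apply]
      change algebraMap k[X] E P = x
      rw [IsScalarTower.algebraMap_apply k[X] F E, hP, hc]
    bas := S.exists_bas.choose
    bas_indep := by
      intro P hP
      have hli := Fintype.linearIndependent_iff.1 S.exists_bas.choose_spec.1
        (fun j => algebraMap k[X] F (P j)) (by
          have := congrArg (Subtype.val) hP
          rw [AddSubmonoidClass.coe_finsetSum] at this
          rw [← ZeroMemClass.coe_zero (RB k Z), ← this]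
          refine Finset.sum_congr rfl fun j _ => ?_
          rw [Algebra.smul_def, ← IsScalarTower.algebraMap_apply]
          rw [MulMemClass.coe_mul]
          congr 1
          rw [aeval_algebraMap_apply, aeval_X_left_apply]
          rfl)
      funext j
      have := hli j
      rwa [IsFractionRing.to_map_eq_zero_iff] at this
    D_smul := fun g x => Subtype.ext (S.D_comm g x)
    D_y := Subtype.ext (by
      rw [aeval_algebraMap_apply, aeval_X_left_apply]
      exact S.D_y)
    e_pos := S.e_pos
    ord_y := S.ord_y
    ord_bas := by
      intro g j
      rw [← hd]
      exact S.exists_bas.choose_spec.2 g j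
    ord_D := by
      intro n x hx
      refine (S.ord_D n x hx).mono ?_
      push_cast
      have : (1 : ℤ) ≤ d := by exact_mod_cast hd1
      nlinarith [(Nat.cast_nonneg c : (0 : ℤ) ≤ c)]
    reps := S.reps
    reps_card := by rw [S.reps_card, Nat.card_eq_fintype_card]
    reps_spec := by
      intro h
      obtain ⟨h₀, hh, hs⟩ := S.reps_spec h
      exact ⟨h₀, hh, fun n x => hs n x⟩ }

theorem finiteType (S : PreStep k F E Z e c) : Algebra.FiniteType k (RB k Z) := by
  have : Algebra.FiniteType k[X] (RB k Z) := by
    rw [← Subalgebra.fg_iff_finiteType]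
    exact ⟨S.fin.toFinset, by simp⟩
  exact Algebra.FiniteType.trans (S := k[X]) inferInstance inferInstance

end PreStep
end Builder
end QLC

namespace QLC
universe u

section Sqrt
variable {K : Type u} [Field K]

/-- coefficients of the square root. -/
noncomputable def sqc (p : ℕ → K) (a : K) : ℕ → K
  | 0 => a
  | n + 1 => (p (n + 1) - ∑ i : Fin n, sqc p a (i + 1) * sqc p a (n - i)) / (2 * a)
decreasing_by all_goals omega

theorem ps_sqrt (h2 : (2 : K) ≠ 0) (p : PowerSeries K) (a : K) (ha : a ≠ 0)
    (hp : PowerSeries.coeff 0 p = a ^ 2) :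
    ∃ w : PowerSeries K, w * w = p ∧ PowerSeries.coeff 0 w = a := by
  set b := sqc (fun n => PowerSeries.coeff n p) a with hb
  have hb0 : b 0 = a := by rw [hb, sqc]
  refine ⟨PowerSeries.mk b, ?_, by rw [PowerSeries.coeff_mk, hb0]⟩
  ext n
  rw [PowerSeries.coeff_mul]
  simp only [PowerSeries.coeff_mk]
  cases n with
  | zero => simp [hb0, ← pow_two, hp]
  | succ n =>
    rw [Finset.Nat.sum_antidiagonal_eq_sum_range_succ (fun i j => b i * b j), Finset.sum_range_succ,
      Finset.sum_range_succ']
    have h1 : b (n + 1) = (PowerSeries.coeff (n + 1) p - ∑ i : Fin n, b (i + 1) * b (n - i)) / (2 * a) := by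
      rw [hb, sqc]
    have h3 : ∑ i ∈ Finset.range n, b (i + 1) * b (n + 1 - (i + 1)) =
        ∑ i : Fin n, b (i + 1) * b (n - i) := by
      rw [Finset.sum_range]
      refine Finset.sum_congr rfl fun i _ => ?_
      congr 2
      omega
    rw [h3]
    simp only [Nat.sub_self, Nat.sub_zero, hb0]
    have h4 : b (n + 1) * (2 * a) = PowerSeries.coeff (n + 1) p - ∑ i : Fin n, b (i + 1) * b (n - i) := by
      rw [h1, div_mul_cancel₀ _ (mul_ne_zero h2 ha)]
    linear_combination h4

theorem hs_sqrt (h2 : (2 : K) ≠ 0) (x : HahnSeries ℤ K) (m : ℤ) (a : K) (ha : a ≠ 0)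
    (hv : Vge (2 * m) x) (hc : x.coeff (2 * m) = a ^ 2) :
    ∃ w : HahnSeries ℤ K, w ^ 2 = x ∧ Vge m w ∧ w.coeff m = a := by
  let p : PowerSeries K := PowerSeries.mk fun n => x.coeff (2 * m + n)
  obtain ⟨v, hv1, hv2⟩ := ps_sqrt h2 p a ha (by simp [p, hc])
  have hx : x = HahnSeries.single (2 * m) 1 * HahnSeries.ofPowerSeries ℤ K p := by
    ext j
    have := HahnSeries.coeff_single_mul (r := (1 : K)) (x := HahnSeries.ofPowerSeries ℤ K p) (a := j) (b := 2 * m)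
    rw [this, one_mul, PowerSeries.coeff_coe]
    split_ifs with h
    · exact vge_iff.1 hv j (by omega)
    · simp only [p, PowerSeries.coeff_mk]
      congr 1
      omega
  have hw : ∀ j, (HahnSeries.single m 1 * HahnSeries.ofPowerSeries ℤ K v).coeff j =
      if j - m < 0 then 0 else PowerSeries.coeff (j - m).natAbs v := by
    intro j
    have := HahnSeries.coeff_single_mul (r := (1 : K)) (x := HahnSeries.ofPowerSeries ℤ K v) (a := j) (b := m)
    rw [this, one_mul, PowerSeries.coeff_coe]
  refine ⟨HahnSeries.single m 1 * HahnSeries.ofPowerSeries ℤ K v, ?_, ?_, ?_⟩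
  · rw [hx, mul_pow, pow_two, pow_two, ← map_mul (HahnSeries.ofPowerSeries ℤ K), hv1,
      HahnSeries.single_mul_single, mul_one, two_mul]
  · rw [vge_iff]
    intro j hj
    rw [hw, if_pos (by omega)]
  · rw [hw]; simpa using hv2

end Sqrt

section Scale
variable {K : Type u} [Field K]

/-- Multiply coefficients pointwise by `φ`. -/
def cmul (φ : ℤ → K) (x : HahnSeries ℤ K) : HahnSeries ℤ K where
  coeff j := φ j * x.coeff j
  isPWO_support' := x.isPWO_support.mono (by
    intro j hj hx
    apply hj
    simp [hx])

@[simp] theorem coeff_cmul (φ : ℤ → K) (x : HahnSeries ℤ K) (j : ℤ) :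
    (cmul φ x).coeff j = φ j * x.coeff j := rfl

theorem support_cmul (φ : ℤ → K) (x : HahnSeries ℤ K) : (cmul φ x).support ⊆ x.support := by
  intro j hj hx
  apply hj
  simp [hx]

theorem cmul_mul_coeff (φ ψ : ℤ → K) (x y : HahnSeries ℤ K) (j : ℤ) :
    (cmul φ x * cmul ψ y).coeff j = ∑ ij ∈ Finset.antidiagonal x.isPWO_support y.isPWO_support j,
      (φ ij.1 * ψ ij.2) * (x.coeff ij.1 * y.coeff ij.2) := by
  rw [HahnSeries.coeff_mul]
  simp only [coeff_cmul]
  have h : ∀ ij : ℤ × ℤ, φ ij.1 * x.coeff ij.1 * (ψ ij.2 * y.coeff ij.2) =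
      (φ ij.1 * ψ ij.2) * (x.coeff ij.1 * y.coeff ij.2) := fun ij => by ring
  simp only [h]
  refine Finset.sum_subset (fun gh hgh => ?_) (fun gh hgh hz => ?_)
  · rw [Finset.mem_antidiagonal] at hgh ⊢
    exact ⟨support_cmul _ _ hgh.1, support_cmul _ _ hgh.2.1, hgh.2.2⟩
  · rw [Finset.mem_antidiagonal] at hgh hz
    by_contra hne
    rw [← h] at hne
    exact hz ⟨left_ne_zero_of_mul hne, right_ne_zero_of_mul hne, hgh.2.2⟩

/-- Substitution `s ↦ ζ s` as a ring automorphism. -/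
noncomputable def sig (ζ : Kˣ) : HahnSeries ℤ K ≃ₐ[K] HahnSeries ℤ K where
  toFun := cmul (fun j => ((ζ ^ j : Kˣ) : K))
  invFun := cmul (fun j => ((ζ⁻¹ ^ j : Kˣ) : K))
  left_inv x := by
    ext j
    simp only [coeff_cmul, ← mul_assoc, ← Units.val_mul, ← mul_zpow]
    simp
  right_inv x := by
    ext j
    simp only [coeff_cmul, ← mul_assoc, ← Units.val_mul, ← mul_zpow]
    simp
  map_add' x y := by
    ext j
    simp [mul_add]
  map_mul' x y := by
    ext j
    rw [cmul_mul_coeff, coeff_cmul, HahnSeries.coeff_mul, Finset.mul_sum]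
    refine Finset.sum_congr rfl fun ij hij => ?_
    rw [Finset.mem_antidiagonal] at hij
    rw [← hij.2.2, zpow_add, Units.val_mul]
  commutes' a := by
    ext j
    rw [coeff_cmul]
    change _ * (HahnSeries.C a).coeff j = (HahnSeries.C a).coeff j
    rw [HahnSeries.C_apply, HahnSeries.coeff_single]
    split_ifs with h <;> simp [h]

theorem sig_coeff (ζ : Kˣ) (x : HahnSeries ℤ K) (j : ℤ) :
    (sig ζ x).coeff j = ((ζ ^ j : Kˣ) : K) * x.coeff j := rfl

theorem sig_vge (ζ : Kˣ) (n : ℤ) (x : HahnSeries ℤ K) : Vge n (sig ζ x) ↔ Vge n x := by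
  simp only [vge_iff, sig_coeff, Units.mul_right_eq_zero]

theorem sig_single (ζ : Kˣ) (j : ℤ) (a : K) : sig ζ (HahnSeries.single j a) =
    HahnSeries.single j (((ζ ^ j : Kˣ) : K) * a) := by
  ext i
  rw [sig_coeff, HahnSeries.coeff_single, HahnSeries.coeff_single]
  split_ifs with h <;> simp [h]

/-- The Euler derivation. -/
noncomputable def euler : Derivation K (HahnSeries ℤ K) (HahnSeries ℤ K) := Derivation.mk'
  { toFun := cmul (fun j => (j : K))
    map_add' := by
      intro x y; ext j; simp [mul_add]
    map_smul' := by
      intro a x; ext j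
      change (j : K) * (a * x.coeff j) = a * ((j : K) * x.coeff j)
      ring }
  (by
    intro x y
    ext j
    have h1 : ∀ z : HahnSeries ℤ K, z = cmul (fun _ => (1 : K)) z := fun z => by ext j; simp
    change (cmul (fun j => (j : K)) (x * y)).coeff j =
      (x * cmul (fun j => (j : K)) y + y * cmul (fun j => (j : K)) x).coeff j
    rw [mul_comm y, HahnSeries.coeff_add, coeff_cmul, HahnSeries.coeff_mul, Finset.mul_sum]
    conv_rhs => 
      rw [h1 x, cmul_mul_coeff]
    have h2 : cmul (fun j => (j : K)) (cmul (fun _ => (1 : K)) x) * y =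
      cmul (fun j => (j : K)) x * cmul (fun _ => (1 : K)) y := by rw [← h1, ← h1]
    rw [h2, cmul_mul_coeff, ← Finset.sum_add_distrib]
    refine Finset.sum_congr rfl fun ij hij => ?_
    rw [Finset.mem_antidiagonal] at hij
    rw [← hij.2.2]
    push_cast
    ring)

theorem euler_coeff (x : HahnSeries ℤ K) (j : ℤ) : (euler x).coeff j = (j : K) * x.coeff j := rfl

end Scale
end QLC

namespace QLC
universe u

section Builder2
variable {k F E : Type u} [Field k] [Field F] [Field E] [Algebra k[X] F]
    [IsFractionRing k[X] F] [Algebra F E] [Algebra k[X] E] [IsScalarTower k[X] F E] [Algebra k E]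
    [IsScalarTower k k[X] E]

/-- The derivation `d/dy` on Laurent series in `s` with `y = s^(-e)`. -/
noncomputable def DL (k : Type u) [Field k] (e : ℕ) :
    Derivation k (HahnSeries ℤ k) (HahnSeries ℤ k) :=
  (HahnSeries.single (e : ℤ) (-(e : k)⁻¹) : HahnSeries ℤ k) • euler

theorem DL_apply (e : ℕ) (x : HahnSeries ℤ k) :
    DL k e x = HahnSeries.single (e : ℤ) (-(e : k)⁻¹) * euler x := rfl

theorem DL_y {e : ℕ} (he : (e : k) ≠ 0) : DL k e (HahnSeries.single (-e : ℤ) 1) = 1 := by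
  rw [DL_apply]
  have : euler (HahnSeries.single (-e : ℤ) (1 : k)) = HahnSeries.single (-e : ℤ) (-(e : k)) := by
    ext j
    rw [euler_coeff, HahnSeries.coeff_single, HahnSeries.coeff_single]
    split_ifs with h <;> simp [h]
  rw [this, HahnSeries.single_mul_single]
  simp [he]

theorem vge_single (n : ℤ) (a : k) : Vge n (HahnSeries.single n a) := by
  rw [vge_iff]
  intro j hj
  rw [HahnSeries.coeff_single_of_ne hj.ne]

theorem DL_vge {e : ℕ} {n : ℤ} {x : HahnSeries ℤ k} (h : Vge n x) : Vge (e + n) (DL k e x) := by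
  rw [DL_apply]
  refine (vge_single _ _).mul ?_
  rw [vge_iff] at *
  intro j hj
  rw [euler_coeff, h j hj, mul_zero]

theorem exists_D {Z : Set E} {e : ℕ} (i : E →ₐ[k] HahnSeries ℤ k) (he : (e : k) ≠ 0)
    (hy : i (algebraMap k[X] E X) = HahnSeries.single (-e : ℤ) 1) (gen : Algebra.adjoin F Z = ⊤)
    (hZ : ∀ z ∈ Z, ∃ Q w : k[X], aeval z Q = algebraMap k[X] E w ∧ aeval z (derivative Q) ≠ 0) :
    ∃ D : Derivation k E E, D (algebraMap k[X] E X) = 1 ∧ ∀ x, i (D x) = DL k e (i x) := by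
  have h1 : ∀ P : k[X], DL k e (i (algebraMap k[X] E P)) = i (algebraMap k[X] E (derivative P)) := by
    intro P
    rw [← aeval_X_eq, ← aeval_algHom_apply, Derivation.map_aeval, hy, DL_y he, smul_eq_mul, mul_one,
      ← hy, aeval_algHom_apply, aeval_X_eq]
  have hall : ∀ x : E, ∃ x' : E, i x' = DL k e (i x) := by
    intro x
    have hx : x ∈ Algebra.adjoin F Z := by rw [gen]; exact Algebra.mem_top
    induction hx using Algebra.adjoin_induction with
    | mem z hz =>
      obtain ⟨Q, w, hQ, hQ'⟩ := hZ z hz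
      have h2 := congrArg (fun t => DL k e (i t)) hQ
      rw [h1, ← aeval_algHom_apply, Derivation.map_aeval, smul_eq_mul, aeval_algHom_apply] at h2
      refine ⟨algebraMap k[X] E (derivative w) / aeval z (derivative Q), ?_⟩
      rw [map_div₀, ← h2, mul_div_cancel_left₀]
      rwa [Ne, map_eq_zero]
    | algebraMap c =>
      obtain ⟨a, b, hb, rfl⟩ := IsFractionRing.div_surjective (A := k[X]) c
      rw [map_div₀, ← IsScalarTower.algebraMap_apply, ← IsScalarTower.algebraMap_apply, map_div₀,
        Derivation.leibniz_div, h1, h1]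
      refine ⟨(algebraMap k[X] E b)⁻¹ ^ 2 * (algebraMap k[X] E b * algebraMap k[X] E (derivative a)
        - algebraMap k[X] E a * algebraMap k[X] E (derivative b)), ?_⟩
      simp only [map_mul, map_sub, map_pow, map_inv₀, smul_eq_mul]
    | add x y _ _ hx hy =>
      obtain ⟨x', hx⟩ := hx
      obtain ⟨y', hy⟩ := hy
      exact ⟨x' + y', by rw [map_add, map_add, map_add, hx, hy]⟩
    | mul x y _ _ hx hy =>
      obtain ⟨x', hx⟩ := hx
      obtain ⟨y', hy⟩ := hy
      exact ⟨x * y' + y * x', by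
        rw [map_add, map_mul, map_mul, map_mul, Derivation.leibniz, hx, hy, smul_eq_mul, smul_eq_mul]⟩
  choose D hD using hall
  have inj : ∀ a b : E, i a = i b → a = b := fun a b h => i.injective h
  refine ⟨Derivation.mk'
    { toFun := D
      map_add' := by intro x y; apply inj _ _; rw [map_add, hD, hD, hD, map_add, map_add]
      map_smul' := by
        intro a x; apply inj _ _
        rw [hD, map_smul i, (DL k e).map_smul, RingHom.id_apply, map_smul i, hD] }
    (by
      intro x y; apply inj _ _
      change i (D (x * y)) = i (x * D y + y * D x)
      rw [hD, map_mul, Derivation.leibniz, map_add, map_mul, map_mul, hD, hD, smul_eq_mul,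
        smul_eq_mul]), ?_, hD⟩
  apply inj _ _
  change i (D _) = _
  rw [hD, hy, DL_y he, map_one]

theorem ord_root {e : ℕ} (he : 0 < e) {Y x : HahnSeries ℤ k} (hY : Y.orderTop = ((-e : ℤ) : WithTop ℤ))
    {Q w : k[X]} (hQ : 1 ≤ Q.natDegree) (h : aeval x Q = aeval Y w) {δ : ℕ}
    (hw : w.natDegree ≤ δ) : Vge (-(e * δ : ℕ)) x := by
  by_cases hx : x = 0
  · rw [hx]; exact vge_zero _
  obtain ⟨m, hm⟩ := exists_orderTop hx
  by_cases hm0 : 0 ≤ m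
  · refine Vge.mono (n := m) (by unfold Vge; rw [hm]) ?_
    have : (0 : ℤ) ≤ (e * δ : ℕ) := Nat.cast_nonneg _
    omega
  · obtain ⟨m', rfl⟩ : ∃ m' : ℕ, m = -(m' : ℤ) := ⟨(-m).toNat, by omega⟩
    have hm'0 : 0 < m' := by omega
    have hQ0 : Q ≠ 0 := by rintro rfl; simp at hQ
    have h1 := orderTop_aeval hm'0 hm hQ0
    rw [h] at h1
    have hw0 : w ≠ 0 := by
      rintro rfl
      rw [map_zero, HahnSeries.orderTop_zero] at h1
      exact absurd h1 WithTop.top_ne_coe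
    rw [orderTop_aeval he hY hw0] at h1
    have h2 : e * w.natDegree = m' * Q.natDegree := by
      have := WithTop.coe_injective h1
      push_cast at this
      have h3 : (e : ℤ) * w.natDegree = m' * Q.natDegree := by linarith
      exact_mod_cast h3
    refine Vge.mono (n := -(m' : ℤ)) (by unfold Vge; rw [hm]) ?_
    have h3 : m' ≤ e * δ := calc
      m' ≤ m' * Q.natDegree := Nat.le_mul_of_pos_right _ hQ
      _ = e * w.natDegree := h2.symm
      _ ≤ e * δ := Nat.mul_le_mul_left _ hw
    have : (m' : ℤ) ≤ (e * δ : ℕ) := by exact_mod_cast h3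
    omega

theorem exists_preStep {Z : Set E} {e δ : ℕ} (fin : Z.Finite)
    (stab : ∀ g : E ≃ₐ[F] E, ∀ z ∈ Z, g z ∈ Z) (gen : Algebra.adjoin F Z = ⊤)
    (i : E →ₐ[k] HahnSeries ℤ k) (e_pos : 0 < e) (he : (e : k) ≠ 0)
    (hy : i (algebraMap k[X] E X) = HahnSeries.single (-e : ℤ) 1)
    (Del : k[X]) (hδ : Del.natDegree ≤ δ)
    (hZ : ∀ z ∈ Z, ∃ Q w : k[X], Q.Monic ∧ 1 ≤ Q.natDegree ∧ w.natDegree ≤ δ ∧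
      aeval z Q = algebraMap k[X] E w ∧ aeval z (derivative Q) ≠ 0 ∧
      ∃ h ∈ RB k Z, algebraMap k[X] E (Del * derivative w) = aeval z (derivative Q) * h)
    (reps : Finset (E ≃ₐ[F] E)) (reps_card : reps.card * e = Nat.card (E ≃ₐ[F] E))
    (reps_spec : ∀ h : E ≃ₐ[F] E, ∃ h₀ ∈ reps, ∀ (n : ℤ) (x : E), Vge n (i (h₀ x)) → Vge n (i (h x))) :
    ∃ S : PreStep k F E Z e (e * δ), S.Del = Del := by
  obtain ⟨D, hD1, hD2⟩ := exists_D (F := F) i he hy gen (fun z hz => by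
    obtain ⟨Q, w, _, _, _, h1, h2, _⟩ := hZ z hz
    exact ⟨Q, w, h1, h2⟩)
  have ord_y : (i (algebraMap k[X] E X)).orderTop = ((-e : ℤ) : WithTop ℤ) := by
    rw [hy, HahnSeries.orderTop_single one_ne_zero]
  have hi : ∀ P : k[X], i (algebraMap k[X] E P) = aeval (i (algebraMap k[X] E X)) P := by
    intro P
    rw [aeval_algHom_apply, aeval_X_eq]
  refine ⟨{ fin := fin, int := ?_, stab := stab, gen := gen, i := i, e_pos := e_pos, ord_y := ord_y,
            ord_Z := ?_, Del := Del, D := algebraMap k[X] E Del • D, D_y := ?_, D_Z := ?_, ord_D := ?_,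
            reps := reps, reps_card := reps_card, reps_spec := reps_spec }, rfl⟩
  · intro z hz
    obtain ⟨Q, w, hm, hd, _, h1, _⟩ := hZ z hz
    refine IsIntegral.of_aeval_monic (p := Q.map (algebraMap k k[X])) (hm.map _) ?_ ?_
    · rw [Polynomial.natDegree_map]; omega
    · rw [aeval_map_algebraMap, h1]; exact isIntegral_algebraMap
  · intro z hz
    obtain ⟨Q, w, hm, hd, hw, h1, _⟩ := hZ z hz
    refine ord_root e_pos ord_y hd ?_ hw
    rw [aeval_algHom_apply, h1, hi]
  · rw [Derivation.smul_apply, hD1, smul_eq_mul, mul_one]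
  · intro z hz
    obtain ⟨Q, w, hm, hd, hw, h1, h2, h, hR, h3⟩ := hZ z hz
    have h4 := congrArg D h1
    rw [Derivation.map_aeval, ← aeval_X_eq w, Derivation.map_aeval, hD1, aeval_X_eq, smul_eq_mul,
      smul_eq_mul, mul_one] at h4
    have : algebraMap k[X] E Del * D z = h := by
      apply mul_left_cancel₀ h2
      rw [← h3, map_mul, ← h4]; ring
    rw [Derivation.smul_apply, smul_eq_mul, this]
    exact hR
  · intro n x hx
    rw [Derivation.smul_apply, smul_eq_mul, map_mul, hD2]
    have h5 : Vge (-(e * δ : ℕ)) (i (algebraMap k[X] E Del)) := by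
      by_cases h0 : Del = 0
      · rw [h0, map_zero, map_zero]; exact vge_zero _
      · have := orderTop_aeval e_pos ord_y h0
        rw [← hi] at this
        refine Vge.mono (n := -(e * Del.natDegree : ℕ)) (by unfold Vge; rw [this]) ?_
        have : e * Del.natDegree ≤ e * δ := Nat.mul_le_mul_left _ hδ
        have : ((e * Del.natDegree : ℕ) : ℤ) ≤ (e * δ : ℕ) := by exact_mod_cast this
        omega
    refine (h5.mul (DL_vge hx)).mono ?_
    omega

/-- `g` is a Frobenius element at `t`. -/
def FrobE (k : Type u) {F E : Type u} [Field k] [Field F] [Field E] [Algebra F E] [Algebra k[X] E]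
    [Algebra k E] [IsScalarTower k k[X] E] (Z : Set E) (t : k) (g : E ≃ₐ[F] E) : Prop :=
  ∃ (Ω : Type u) (_ : Field Ω) (_ : Algebra k Ω) (π : RB k Z →ₐ[k] Ω),
    (∀ P, π (algebraMap k[X] (RB k Z) P) = algebraMap k Ω (P.eval t)) ∧
    ∀ x x' : RB k Z, (x' : E) = g x → π x' = π x ^ (Nat.card k)

theorem FrobE.iff {Z : Set E} (hZ : ∀ g : E ≃ₐ[F] E, ∀ z ∈ Z, g z ∈ Z) (t : k) (g : E ≃ₐ[F] E) :
    letI := RB_action (k := k) hZ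
    FrobE k Z t g ↔ FrobAt k (algebraMap k[X] (RB k Z) X) t g := by
  let := RB_action (k := k) hZ
  have hXC : ∀ P : k[X], P = aeval (X : k[X]) P := fun P => (aeval_X_left_apply P).symm
  constructor
  · rintro ⟨Ω, _, _, π, h1, h2⟩
    refine ⟨RingHom.ker π, RingHom.ker_isPrime _, ?_, ?_⟩
    · rw [RingHom.mem_ker, map_sub, h1, eval_X, AlgHom.commutes, sub_self]
    · intro x
      rw [RingHom.mem_ker, map_sub, map_pow, h2 x (g • x) rfl, sub_self]
  · rintro ⟨Q, hQ, h1, h2⟩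
    refine ⟨FractionRing (RB k Z ⧸ Q), inferInstance, inferInstance,
      (IsScalarTower.toAlgHom k (RB k Z ⧸ Q) (FractionRing (RB k Z ⧸ Q))).comp
        (Ideal.Quotient.mkₐ k Q), ?_, ?_⟩
    · intro P
      have h3 : Ideal.Quotient.mkₐ k Q (algebraMap k[X] (RB k Z) X) =
          algebraMap k _ t := by
        rw [← (Ideal.Quotient.mkₐ k Q).commutes, ← sub_eq_zero, ← map_sub]
        exact Ideal.Quotient.eq_zero_iff_mem.2 h1
      have h4 : algebraMap k[X] (RB k Z) P = aeval (algebraMap k[X] (RB k Z) X) P := by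
        conv_lhs => rw [hXC P]
        rw [← aeval_algebraMap_apply]
      rw [AlgHom.comp_apply, h4, ← aeval_algHom_apply, h3, aeval_algebraMap_apply, AlgHom.commutes,
        coe_aeval_eq_eval]
    · intro x x' hx
      have hx' : x' = g • x := Subtype.ext hx
      rw [← map_pow, AlgHom.comp_apply, AlgHom.comp_apply]
      congr 1
      rw [← sub_eq_zero, ← map_sub, hx']
      exact Ideal.Quotient.eq_zero_iff_mem.2 (h2 x)

theorem exists_frobE [Finite k] [FiniteDimensional F E] [IsGalois F E] {Z : Set E} {e c : ℕ}
    (S : PreStep k F E Z e c) (t : k) : ∃ g : E ≃ₐ[F] E, FrobE k Z t g := by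
  let := RB_action (k := k) S.stab
  obtain ⟨g, hg⟩ := (S.toStep rfl (Nat.card_pos)).exists_frob S.finiteType t
  exact ⟨g, (FrobE.iff S.stab t g).2 hg⟩

end Builder2

theorem cheb2 (d e c : ℕ) (η : ℝ) (hη : 0 < η) : ∃ p0 : ℕ, ∀ (k F E : Type u) [Field k] [Finite k]
    [Field F] [Field E] [Algebra k[X] F] [IsFractionRing k[X] F] [Algebra F E] [Algebra k[X] E]
    [IsScalarTower k[X] F E] [Algebra k E] [IsScalarTower k k[X] E] [FiniteDimensional F E]
    [IsGalois F E] (Z : Set E) (S : PreStep k F E Z e c), Nat.card (E ≃ₐ[F] E) ≤ d →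
    p0 ≤ ringChar k → ∀ (U : Set (E ≃ₐ[F] E)), (∀ g ∈ U, ∀ s, s * g * s⁻¹ ∈ U) → ∀ T : Finset k,
    (∀ t ∈ T, S.Del.eval t ≠ 0 ∧ ∃ g ∈ U, FrobE k Z t g) →
    (T.card : ℝ) * Nat.card (E ≃ₐ[F] E) ≤ (1 + η) * Nat.card k * U.ncard := by
  choose p hp using fun d' => chebotarev.{u} d' e (d' * c) η hη
  refine ⟨(Finset.range (d + 1)).sup p, ?_⟩
  intro k F E _ _ _ _ _ _ _ _ _ _ _ _ _ Z S hd hp0 U hU T hT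
  classical
  let := RB_action (k := k) S.stab
  have h1 : p (Nat.card (E ≃ₐ[F] E)) ≤ ringChar k :=
    le_trans (Finset.le_sup (Finset.mem_range.2 (by omega))) hp0
  have := hp _ k (RB k Z) (E ≃ₐ[F] E) (S.toStep rfl Nat.card_pos) (Nat.card_eq_fintype_card).symm h1
    U.toFinset (by simpa using hU) T (by
      intro t ht
      obtain ⟨h1, g, hg, h2⟩ := hT t ht
      exact ⟨h1, g, by simpa using hg, (FrobE.iff S.stab t g).1 h2⟩)
  rwa [← Set.ncard_eq_toFinset_card'] at this

end QLC

namespace QLC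
universe u

/-- The polynomial `Q(Z) - w(y)` over `F = k(y)`. -/
noncomputable def PP {k : Type u} (F : Type u) [Field k] [Field F] [Algebra k[X] F] (Q w : k[X]) : F[X] :=
  Q.map ((algebraMap k[X] F).comp C) - C (algebraMap k[X] F w)

section Emb
variable {k F E : Type u} [Field k] [Field F] [Field E] [Algebra k[X] F]
    [IsFractionRing k[X] F] [Algebra F E] [Algebra k[X] E] [IsScalarTower k[X] F E] [Algebra k E]
    [IsScalarTower k k[X] E] {Q w : k[X]}

theorem monic_sub_C' {R : Type u} [Field R] {P : R[X]} (hP : P.Monic) (hd : 1 ≤ P.natDegree) (a : R) :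
    (P - C a).Monic := by
  refine hP.sub_of_left ?_
  refine lt_of_le_of_lt degree_C_le ?_
  rw [← natDegree_pos_iff_degree_pos]; omega

theorem PP_monic (hQ : Q.Monic) (hd : 1 ≤ Q.natDegree) : (PP F Q w).Monic := by
  unfold PP
  refine monic_sub_C' (hQ.map _) ?_ _
  rwa [hQ.natDegree_map]

theorem PP_natDegree (hQ : Q.Monic) (hd : 1 ≤ Q.natDegree) : (PP F Q w).natDegree = Q.natDegree := by
  unfold PP
  rw [natDegree_sub_C, hQ.natDegree_map]

theorem PP_map {L : Type u} [Field L] [Algebra k L] (j : F →+* L)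
    (hj : ∀ a : k, j (algebraMap k[X] F (C a)) = algebraMap k L a) :
    (PP F Q w).map j = Q.map (algebraMap k L) - C (j (algebraMap k[X] F w)) := by
  unfold PP
  rw [Polynomial.map_sub, Polynomial.map_map, Polynomial.map_C]
  congr 2
  ext a
  exact hj a

theorem algE (a : k) : algebraMap k[X] E (C a) = algebraMap k E a :=
  (IsScalarTower.algebraMap_apply k k[X] E a).symm

theorem PP_mapE : (PP F Q w).map (algebraMap F E) =
    Q.map (algebraMap k E) - C (algebraMap k[X] E w) := by
  rw [PP_map, ← IsScalarTower.algebraMap_apply]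
  intro a
  rw [← IsScalarTower.algebraMap_apply, algE]

/-- The set of roots. -/
def RT (E : Type u) [Field E] [Algebra k[X] E] [Algebra k E] (Q w : k[X]) : Set E :=
  {z | aeval z Q = algebraMap k[X] E w}

theorem RT_eq (hQ : Q.Monic) (hd : 1 ≤ Q.natDegree) : RT E Q w = (PP F Q w).rootSet E := by
  ext z
  rw [mem_rootSet, ← eval_map_algebraMap, PP_mapE]
  simp only [RT, Set.mem_setOf_eq, eval_sub, eval_map_algebraMap, eval_C, sub_eq_zero]
  exact ⟨fun h => ⟨(PP_monic hQ hd).ne_zero, h⟩, fun h => h.2⟩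

theorem RT_gen [IsSplittingField F E (PP F Q w)] (hQ : Q.Monic) (hd : 1 ≤ Q.natDegree) :
    Algebra.adjoin F (RT E Q w) = ⊤ := by
  rw [RT_eq (F := F) hQ hd]; exact IsSplittingField.adjoin_rootSet E _

theorem RT_finite (F : Type u) [Field F] [Algebra k[X] F] [IsFractionRing k[X] F] [Algebra F E]
    [IsScalarTower k[X] F E] (hQ : Q.Monic) (hd : 1 ≤ Q.natDegree) : (RT E Q w).Finite := by
  rw [RT_eq (F := F) hQ hd]; exact rootSet_finite _ _

theorem gal_aeval (g : E ≃ₐ[F] E) (P : k[X]) (x : E) : g (aeval x P) = aeval (g x) P := by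
  have hg : ∀ a : k, g (algebraMap k E a) = algebraMap k E a := by
    intro a; rw [← algE, gal_k]
  let g' : E →ₐ[k] E := { (g : E →+* E) with commutes' := hg }
  exact (aeval_algHom_apply g' x P).symm

theorem RT_stab (g : E ≃ₐ[F] E) (z : E) (hz : z ∈ RT E Q w) : g z ∈ RT E Q w := by
  change aeval (g z) Q = _
  rw [← gal_aeval, show aeval z Q = _ from hz, gal_k]

/-- Extending an embedding of `k(y)` to the splitting field. -/
theorem exists_emb [IsSplittingField F E (PP F Q w)] {L : Type u} [Field L] [Algebra k L] (Y : L)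
    (hY : Function.Injective (aeval Y : k[X] →ₐ[k] L))
    (hs : (Q.map (algebraMap k L) - C (aeval Y w)).Splits) :
    ∃ i : E →ₐ[k] L, i (algebraMap k[X] E X) = Y := by
  let j : F →+* L := IsFractionRing.lift (g := (aeval Y : k[X] →ₐ[k] L).toRingHom) hY
  have hj : ∀ P : k[X], j (algebraMap k[X] F P) = aeval Y P := by
    intro P
    exact IsFractionRing.lift_algebraMap (K := F) hY P
  let := j.toAlgebra
  have h1 : ((PP F Q w).map (algebraMap F L)).Splits := by
    change ((PP F Q w).map j).Splits
    rw [PP_map j (by intro a; rw [hj, aeval_C]), hj]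
    exact hs
  let i0 : E →ₐ[F] L := IsSplittingField.lift E (PP F Q w) h1
  have hi : ∀ P : k[X], i0 (algebraMap k[X] E P) = aeval Y P := by
    intro P
    rw [IsScalarTower.algebraMap_apply k[X] F E, i0.commutes]
    exact hj P
  refine ⟨{ (i0 : E →+* L) with commutes' := ?_ }, ?_⟩
  · intro a
    change i0 (algebraMap k E a) = _
    rw [← algE, hi, aeval_C]
  · change i0 _ = Y
    rw [hi, aeval_X]

/-- Ranges of two embeddings. -/
theorem range_le [IsSplittingField F E (PP F Q w)] (hQ : Q.Monic) (hd : 1 ≤ Q.natDegree)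
    {L : Type u} [Field L] [Algebra k L] (Φ Φ' : E →ₐ[k] L)
    (h1 : Φ (algebraMap k[X] E w) = Φ' (algebraMap k[X] E w))
    (h2 : ∃ u, Φ u = Φ' (algebraMap k[X] E X)) (x : E) : ∃ x', Φ x' = Φ' x := by
  have hP : ∀ P : k[X], ∃ x', Φ x' = Φ' (algebraMap k[X] E P) := by
    obtain ⟨u, hu⟩ := h2
    intro P
    refine ⟨aeval u P, ?_⟩
    rw [← aeval_algHom_apply, hu, aeval_algHom_apply, aeval_X_eq]
  have hx : x ∈ Algebra.adjoin F (RT E Q w) := by rw [RT_gen hQ hd]; exact Algebra.mem_top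
  induction hx using Algebra.adjoin_induction with
  | mem z hz =>
    have hs := IsSplittingField.splits E (PP F Q w)
    rw [PP_mapE] at hs
    have hne : Q.map (algebraMap k E) - C (algebraMap k[X] E w) ≠ 0 := by
      rw [← PP_mapE (F := F)]
      exact ((PP_monic hQ hd).map _).ne_zero
    have := hs.mem_range_of_isRoot hne (i := (Φ : E →+* L)) (x := Φ' z) (by
      rw [IsRoot.def, Polynomial.map_sub, Polynomial.map_map, Polynomial.map_C, eval_sub, eval_C]
      have h3 : ((Φ : E →+* L).comp (algebraMap k E)) = algebraMap k L := by
        ext a; exact Φ.commutes a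
      rw [h3, eval_map_algebraMap, aeval_algHom_apply, show aeval z Q = _ from hz]
      change _ - Φ _ = 0
      rw [h1, sub_self])
    obtain ⟨x', hx'⟩ := this
    exact ⟨x', hx'⟩
  | algebraMap c =>
    obtain ⟨a, b, hb, rfl⟩ := IsFractionRing.div_surjective (A := k[X]) c
    obtain ⟨a', ha'⟩ := hP a
    obtain ⟨b', hb'⟩ := hP b
    refine ⟨a' / b', ?_⟩
    rw [map_div₀, map_div₀, map_div₀, ← IsScalarTower.algebraMap_apply,
      ← IsScalarTower.algebraMap_apply, ha', hb']
  | add x y _ _ hx hy =>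
    obtain ⟨x', hx⟩ := hx
    obtain ⟨y', hy⟩ := hy
    exact ⟨x' + y', by rw [map_add, map_add, hx, hy]⟩
  | mul x y _ _ hx hy =>
    obtain ⟨x', hx⟩ := hx
    obtain ⟨y', hy⟩ := hy
    exact ⟨x' * y', by rw [map_mul, map_mul, hx, hy]⟩

/-- Transfer of automorphisms. -/
theorem exists_transfer [IsSplittingField F E (PP F Q w)] (hQ : Q.Monic) (hd : 1 ≤ Q.natDegree)
    {L : Type u} [Field L] [Algebra k L] (Φ Φ' : E →ₐ[k] L)
    (h1 : Φ (algebraMap k[X] E w) = Φ' (algebraMap k[X] E w))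
    (h2 : ∃ u, Φ u = Φ' (algebraMap k[X] E X)) (h3 : ∃ u, Φ' u = Φ (algebraMap k[X] E X)) :
    ∃ β : E ≃ₐ[k] E, ∀ x, Φ (β x) = Φ' x := by
  choose b hb using range_le (F := F) hQ hd Φ Φ' h1 h2
  choose b' hb' using range_le (F := F) hQ hd Φ' Φ h1.symm h3
  have inj : ∀ x y, Φ x = Φ y → x = y := fun x y h => Φ.injective h
  have inj' : ∀ x y, Φ' x = Φ' y → x = y := fun x y h => Φ'.injective h
  refine ⟨{ toFun := b, invFun := b', left_inv := ?_, right_inv := ?_, map_mul' := ?_,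
            map_add' := ?_, commutes' := ?_ }, hb⟩
  · intro x; apply inj' _ _; rw [hb', hb]
  · intro x; apply inj _ _; rw [hb, hb']
  · intro x y; apply inj _ _; rw [hb, map_mul, map_mul, hb, hb]
  · intro x y; apply inj _ _; rw [hb, map_add, map_add, hb, hb]
  · intro a; apply inj _ _; rw [hb, Φ.commutes, Φ'.commutes]

/-- A `k`-automorphism fixing `y` is an `F`-automorphism. -/
theorem exists_gal (β : E ≃ₐ[k] E) (hβ : β (algebraMap k[X] E X) = algebraMap k[X] E X) :
    ∃ g : E ≃ₐ[F] E, ∀ x, g x = β x := by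
  have hP : ∀ P : k[X], β (algebraMap k[X] E P) = algebraMap k[X] E P := by
    intro P
    rw [← aeval_X_eq]
    have := aeval_algHom_apply (β : E →ₐ[k] E) (algebraMap k[X] E X) P
    simp only [AlgEquiv.coe_toAlgHom] at this
    rw [← this, hβ]
  refine ⟨{ (β : E ≃+* E) with commutes' := ?_ }, fun x => rfl⟩
  intro c
  change β _ = _
  obtain ⟨a, b, hb, rfl⟩ := IsFractionRing.div_surjective (A := k[X]) c
  rw [map_div₀, map_div₀, ← IsScalarTower.algebraMap_apply, ← IsScalarTower.algebraMap_apply, hP, hP]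

theorem PP_galois [IsSplittingField F E (PP F Q w)] (hQ : Q.Monic) (hd : 1 ≤ Q.natDegree)
    (hsep : ∀ z ∈ RT E Q w, aeval z (derivative Q) ≠ 0) : IsGalois F E := by
  refine IsGalois.of_separable_splitting_field (p := PP F Q w) ?_
  rw [← separable_map (algebraMap F E), PP_mapE]
  have hs := IsSplittingField.splits E (PP F Q w)
  rw [PP_mapE] at hs
  have hm : (Q.map (algebraMap k E) - C (algebraMap k[X] E w)).Monic := by
    rw [← PP_mapE (F := F)]; exact (PP_monic hQ hd).map _
  classical
  rw [← nodup_roots_iff_of_splits hm.ne_zero hs, Multiset.nodup_iff_count_le_one]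
  intro z
  rw [count_roots]
  by_contra hlt
  have := (one_lt_rootMultiplicity_iff_isRoot hm.ne_zero).1 (not_le.1 hlt)
  obtain ⟨h1, h2⟩ := this
  rw [IsRoot.def, eval_sub, eval_map_algebraMap, eval_C, sub_eq_zero] at h1
  refine hsep z h1 ?_
  rw [IsRoot.def, derivative_sub, derivative_C, sub_zero, derivative_map, eval_map_algebraMap] at h2
  exact h2

end Emb
end QLC

namespace QLC
universe u

/-- Iterates of `x² + c`. -/
def it {R : Type u} [CommRing R] (c : R) : ℕ → R → R
  | 0, x => x
  | n + 1, x => it c n x ^ 2 + c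

/-- Iterates of `X² + c`, as polynomials. -/
noncomputable def fi {R : Type u} [CommRing R] (c : R) : ℕ → R[X]
  | 0 => X
  | n + 1 => fi c n ^ 2 + C c

section It
variable {R : Type u} [CommRing R] (c : R)

@[simp] theorem it_zero (x : R) : it c 0 x = x := rfl
theorem it_succ (n : ℕ) (x : R) : it c (n + 1) x = it c n x ^ 2 + c := rfl
theorem it_succ' (n : ℕ) (x : R) : it c (n + 1) x = it c n (x ^ 2 + c) := by
  induction n with
  | zero => rfl
  | succ n ih => rw [it_succ, ih, ← it_succ]
theorem it_add (m n : ℕ) (x : R) : it c (m + n) x = it c m (it c n x) := by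
  induction m with
  | zero => simp
  | succ m ih => rw [Nat.succ_add, it_succ, ih, ← it_succ]
theorem it_neg (n : ℕ) (x : R) : it c (n + 1) (-x) = it c (n + 1) x := by
  rw [it_succ', it_succ', neg_sq]
theorem it_eq_iterate (n : ℕ) (x : R) : it c n x = (fun x => x ^ 2 + c)^[n] x := by
  induction n with
  | zero => rfl
  | succ n ih => rw [it_succ, ih, Function.iterate_succ_apply']
theorem it_map {S : Type u} [CommRing S] (φ : R →+* S) (n : ℕ) (x : R) : φ (it c n x) = it (φ c) n (φ x) := by
  induction n with
  | zero => rfl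
  | succ n ih => rw [it_succ, it_succ, map_add, map_pow, ih]
theorem fi_eval (n : ℕ) (x : R) : (fi c n).eval x = it c n x := by
  induction n with
  | zero => simp [fi]
  | succ n ih => simp [fi, ih, it_succ]
theorem fi_map {S : Type u} [CommRing S] (φ : R →+* S) (n : ℕ) : (fi c n).map φ = fi (φ c) n := by
  induction n with
  | zero => simp [fi]
  | succ n ih => simp [fi, ih]
theorem fi_aeval {S : Type u} [CommRing S] [Algebra R S] (n : ℕ) (x : S) :
    aeval x (fi c n) = it (algebraMap R S c) n x := by
  rw [← eval_map_algebraMap, fi_map, fi_eval]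

theorem fi_monic_deg [Nontrivial R] (n : ℕ) : (fi c n).Monic ∧ (fi c n).natDegree = 2 ^ n := by
  induction n with
  | zero => exact ⟨monic_X, by simp [fi]⟩
  | succ n ih =>
    obtain ⟨h1, h2⟩ := ih
    have h3 : (fi c n ^ 2).natDegree = 2 ^ (n + 1) := by
      rw [h1.natDegree_pow, h2, pow_succ']
    refine ⟨?_, ?_⟩
    · refine (h1.pow 2).add_of_left ?_
      refine lt_of_le_of_lt degree_C_le ?_
      rw [← natDegree_pos_iff_degree_pos, h3]; positivity
    · rw [fi, natDegree_add_C, h3]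

theorem fi_deriv (n : ℕ) (x : R) :
    (derivative (fi c n)).eval x = 2 ^ n * ∏ j ∈ Finset.range n, it c j x := by
  induction n with
  | zero => simp [fi]
  | succ n ih =>
    rw [fi, derivative_add, derivative_C, add_zero, derivative_sq, eval_mul, eval_mul, ih, eval_C,
      fi_eval, Finset.prod_range_succ]
    ring

theorem fi_deriv_aeval {S : Type u} [CommRing S] [Algebra R S] (n : ℕ) (x : S) :
    aeval x (derivative (fi c n)) = 2 ^ n * ∏ j ∈ Finset.range n, it (algebraMap R S c) j x := by
  rw [← eval_map_algebraMap, ← derivative_map, fi_map, fi_deriv]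

/-- `it n x - it n 0` is divisible by `x`. -/
theorem it_dvd (n : ℕ) : ∃ h : R[X], ∀ {S : Type u} [CommRing S] [Algebra R S] (x : S),
    it (algebraMap R S c) n x - algebraMap R S (it c n 0) = x * aeval x h := by
  refine ⟨divX (fi c n), ?_⟩
  intro S _ _ x
  rw [← fi_aeval, ← fi_eval, ← coeff_zero_eq_eval_zero]
  conv_lhs => rw [← divX_mul_X_add (fi c n)]
  simp
  ring
end It

/-- Hereditary splitting of `f^n - v`. -/
def Spl {L : Type u} [Field L] (c : L) : ℕ → L → Prop
  | 0, _ => True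
  | n + 1, v => ∃ w, w ^ 2 = v - c ∧ Spl c n w ∧ Spl c n (-w)

theorem Spl.splits {L : Type u} [Field L] (c : L) (n : ℕ) (v : L) (h : Spl c n v) :
    (fi c n - C v).Splits := by
  induction n generalizing v with
  | zero => exact Splits.X_sub_C v
  | succ n ih =>
    obtain ⟨w, hw, h1, h2⟩ := h
    have : fi c (n + 1) - C v = (fi c n - C w) * (fi c n - C (-w)) := by
      have : C v = C w ^ 2 + C c := by rw [← C_pow, ← C_add, hw]; ring_nf
      rw [fi, this, C_neg]; ring
    rw [this]
    exact (ih w h1).mul (ih (-w) h2)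

section HS
variable {K : Type u} [Field K]

theorem coeff_alg (a : K) (j : ℤ) : (algebraMap K (HahnSeries ℤ K) a).coeff j = if j = 0 then a else 0 := by
  rw [HahnSeries.algebraMap_apply]
  simp [HahnSeries.coeff_single]

/-- splitting at infinity -/
theorem spl_inf (h2 : (2 : K) ≠ 0) (c : K) (n : ℕ) (hζ : ∀ j < n, ∃ ν : K, ν ^ 2 ^ j = -1) (μ : K) (hμ : μ ≠ 0)
    (v : HahnSeries ℤ K) (hv : Vge (-2 ^ n) v) (hc : v.coeff (-2 ^ n) = μ ^ 2 ^ n) :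
    Spl (algebraMap K (HahnSeries ℤ K) c) n v := by
  induction n generalizing v μ with
  | zero => trivial
  | succ n ih =>
    have hneg : ∀ m : ℕ, (-2 ^ m : ℤ) < 0 := by intro m; simp
    obtain ⟨w, hw1, hw2, hw3⟩ := hs_sqrt h2 (v - algebraMap K _ c) (-2 ^ n) (μ ^ 2 ^ n) (pow_ne_zero _ hμ)
      (by
        refine (hv.mono ?_).sub ((vge_algebraMap c).mono ?_)
        · rw [pow_succ]; linarith
        · have := hneg n; linarith)
      (by
        rw [HahnSeries.coeff_sub, coeff_alg, if_neg (by have := hneg n; omega)]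
        rw [show (2 * -2 ^ n : ℤ) = -2 ^ (n + 1) by ring, hc]
        ring)
    have hζ' : ∀ j < n, ∃ ν : K, ν ^ 2 ^ j = -1 := fun j hj => hζ j (by omega)
    refine ⟨w, hw1, ih hζ' μ hμ w hw2 hw3, ?_⟩
    obtain ⟨ν, hν⟩ := hζ n (by omega)
    have hν0 : ν ≠ 0 := by
      rintro rfl
      rw [zero_pow (by positivity)] at hν
      exact one_ne_zero (neg_eq_zero.1 hν.symm)
    refine ih hζ' (ν * μ) (mul_ne_zero hν0 hμ) (-w) hw2.neg ?_
    rw [HahnSeries.coeff_neg, hw3, mul_pow, hν]; ring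

variable [IsAlgClosed K]

/-- splitting at an unramified point -/
theorem spl_unr (h2 : (2 : K) ≠ 0) (c : K) (n : ℕ) (v : HahnSeries ℤ K) (hv : Vge 0 v)
    (hc : ∀ i, 1 ≤ i → i ≤ n → v.coeff 0 ≠ it c i 0) :
    Spl (algebraMap K (HahnSeries ℤ K) c) n v := by
  induction n generalizing v with
  | zero => trivial
  | succ n ih =>
    obtain ⟨a, ha⟩ := IsAlgClosed.exists_pow_nat_eq (v.coeff 0 - c) (n := 2) (by norm_num)
    have ha0 : a ≠ 0 := by
      rintro rfl
      apply hc 1 le_rfl (by omega)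
      rw [it_succ, it_zero]
      simp only [ne_eq, OfNat.ofNat_ne_zero, not_false_eq_true, zero_pow] at *
      rw [zero_add]
      exact (sub_eq_zero.1 ha.symm)
    obtain ⟨w, hw1, hw2, hw3⟩ := hs_sqrt h2 (v - algebraMap K _ c) 0 a ha0
      (by simpa using hv.sub (vge_algebraMap c))
      (by rw [HahnSeries.coeff_sub, coeff_alg]; simp [ha])
    refine ⟨w, hw1, ih w hw2 ?_, ih (-w) hw2.neg ?_⟩
    · intro i h1 h3 h4
      apply hc (i + 1) (by omega) (by omega)
      rw [it_succ, ← h4, hw3, ha]; ring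
    · intro i h1 h3 h4
      apply hc (i + 1) (by omega) (by omega)
      rw [it_succ, ← h4, HahnSeries.coeff_neg, hw3, neg_sq, ha]; ring

/-- splitting at a simply ramified point -/
theorem spl_ram (h2 : (2 : K) ≠ 0) (c : K) (n : ℕ) (hn : ∀ i, 1 ≤ i → i ≤ n → it c i 0 ≠ 0)
    (v : HahnSeries ℤ K) (a : K)
    (hv : (v - algebraMap K _ a).orderTop = ((2 : ℤ) : WithTop ℤ)) :
    Spl (algebraMap K (HahnSeries ℤ K) c) n v := by
  induction n generalizing v a with
  | zero => trivial
  | succ n ih =>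
    have hn' : ∀ i, 1 ≤ i → i ≤ n → it c i 0 ≠ 0 := fun i h1 h2 => hn i h1 (by omega)
    have hV : Vge 2 (v - algebraMap K _ a) := by unfold Vge; rw [hv]
    by_cases hac : a = c
    · subst hac
      have hne := HahnSeries.coeff_orderTop_ne hv
      obtain ⟨b, hb⟩ := IsAlgClosed.exists_pow_nat_eq ((v - algebraMap K _ a).coeff 2) (n := 2) (by norm_num)
      obtain ⟨w, hw1, hw2, hw3⟩ := hs_sqrt h2 (v - algebraMap K _ a) 1 b
        (by rintro rfl; apply hne; rw [← hb]; simp) (by simpa using hV) (by simp [hb])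
      have hw0 : w.coeff 0 = 0 := (vge_iff.1 hw2) 0 (by norm_num)
      refine ⟨w, hw1, spl_unr h2 _ n w (hw2.mono (by norm_num)) ?_,
        spl_unr h2 _ n (-w) (hw2.neg.mono (by norm_num)) ?_⟩
      · intro i h1 h3; rw [hw0]; exact (hn' i h1 h3).symm
      · intro i h1 h3; rw [HahnSeries.coeff_neg, hw0, neg_zero]; exact (hn' i h1 h3).symm
    · have hac' : a - c ≠ 0 := sub_ne_zero.2 hac
      obtain ⟨b, hb⟩ := IsAlgClosed.exists_pow_nat_eq (a - c) (n := 2) (by norm_num)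
      have hb0 : b ≠ 0 := by rintro rfl; apply hac'; rw [← hb]; simp
      have h0 : v.coeff 0 = a := by
        have := (vge_iff.1 hV) 0 (by norm_num)
        rw [HahnSeries.coeff_sub, coeff_alg, if_pos rfl, sub_eq_zero] at this
        exact this
      obtain ⟨w, hw1, hw2, hw3⟩ := hs_sqrt h2 (v - algebraMap K _ c) 0 b hb0
        (by
          have := (hV.mono (show (0:ℤ) ≤ 2 by norm_num)).add ((vge_algebraMap a).sub (vge_algebraMap c))
          simpa using this)
        (by rw [HahnSeries.coeff_sub, coeff_alg]; simp [hb, h0])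
      have hprod : (w - algebraMap K _ b) * (w + algebraMap K _ b) = v - algebraMap K _ a := by
        have : (algebraMap K (HahnSeries ℤ K) b) ^ 2 = algebraMap K _ a - algebraMap K _ c := by
          rw [← map_pow, hb, map_sub]
        linear_combination hw1 - this
      have hu : (w + algebraMap K _ b).orderTop = ((0 : ℤ) : WithTop ℤ) := by
        refine le_antisymm (HahnSeries.orderTop_le_of_coeff_ne_zero ?_) (hw2.add (vge_algebraMap b))
        rw [HahnSeries.coeff_add, hw3, coeff_alg, if_pos rfl, ← two_mul]
        exact mul_ne_zero h2 hb0
      have hord : (w - algebraMap K _ b).orderTop = ((2 : ℤ) : WithTop ℤ) := by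
        rw [← hv, ← hprod, HahnSeries.orderTop_mul, hu]
        simp
      refine ⟨w, hw1, ih hn' w b hord, ih hn' (-w) (-b) ?_⟩
      rw [map_neg, ← neg_sub_neg, neg_neg, neg_neg, ← hord, ← neg_sub, HahnSeries.orderTop_neg]

theorem alg_const {k L : Type u} [Field k] [Field L] [Algebra k K] [Algebra k L] [Algebra K L] [IsScalarTower k K L]
    (Y : L) (hY : ∀ a : K, Y ≠ algebraMap K L a) : Function.Injective (aeval Y : k[X] →ₐ[k] L) := by
  rw [injective_iff_map_eq_zero]
  intro P hP
  by_contra hP0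
  have hs := IsAlgClosed.splits (P.map (algebraMap k K))
  have hne : P.map (algebraMap k K) ≠ 0 := Polynomial.map_ne_zero hP0
  have := hs.mem_range_of_isRoot hne (i := algebraMap K L) (x := Y) (by
    rw [IsRoot.def, Polynomial.map_map, ← IsScalarTower.algebraMap_eq, eval_map_algebraMap, hP])
  obtain ⟨a, ha⟩ := this
  exact hY a ha.symm
end HS
end QLC

namespace QLC
universe u

instance tower_inst {k : Type u} [Field k] (Q w : k[X]) :
    IsScalarTower k k[X] (PP (FractionRing k[X]) Q w).SplittingField := by
  refine IsScalarTower.of_algebraMap_eq fun a => ?_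
  rw [IsScalarTower.algebraMap_apply k (FractionRing k[X]) (PP (FractionRing k[X]) Q w).SplittingField,
    IsScalarTower.algebraMap_apply k k[X] (FractionRing k[X]),
    ← IsScalarTower.algebraMap_apply k[X] (FractionRing k[X]) (PP (FractionRing k[X]) Q w).SplittingField]

section Gen
variable {k F E : Type u} [Field k] [Field F] [Field E] [Algebra k[X] F]
    [IsFractionRing k[X] F] [Algebra F E] [Algebra k[X] E] [IsScalarTower k[X] F E] [Algebra k E]
    [IsScalarTower k k[X] E] {Q w : k[X]}

theorem gal_ext {Z : Set E} (gen : Algebra.adjoin F Z = ⊤) (g h : E ≃ₐ[F] E) (H : ∀ z ∈ Z, g z = h z) :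
    g = h := by
  have : (g : E →ₐ[F] E) = h := AlgHom.ext_of_adjoin_eq_top gen H
  ext x
  exact DFunLike.congr_fun this x

theorem RT_ncard (F : Type u) [Field F] [Algebra k[X] F] [IsFractionRing k[X] F] [Algebra F E]
    [IsScalarTower k[X] F E] (hQ : Q.Monic) (hd : 1 ≤ Q.natDegree) :
    (RT E Q w).ncard ≤ Q.natDegree := by
  rw [RT_eq (F := F) hQ hd, ← PP_natDegree (F := F) (w := w) hQ hd]
  exact ncard_rootSet_le _ _

theorem gal_card_le [IsSplittingField F E (PP F Q w)] (hQ : Q.Monic) (hd : 1 ≤ Q.natDegree) :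
    Nat.card (E ≃ₐ[F] E) ≤ Q.natDegree ^ Q.natDegree := by
  have hfin := RT_finite (E := E) (w := w) F hQ hd
  have := hfin.to_subtype
  let φ : (E ≃ₐ[F] E) → (RT E Q w → RT E Q w) := fun g z => ⟨g z, RT_stab g z z.2⟩
  have hφ : Function.Injective φ := by
    intro g h hgh
    refine gal_ext (RT_gen (F := F) (w := w) hQ hd) g h fun z hz => ?_
    exact congrArg Subtype.val (congrFun hgh ⟨z, hz⟩)
  refine (Nat.card_le_card_of_injective φ hφ).trans ?_
  rw [Nat.card_fun, Nat.card_coe_set_eq]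
  have h1 := RT_ncard (E := E) (w := w) F hQ hd
  calc (RT E Q w).ncard ^ (RT E Q w).ncard ≤ Q.natDegree ^ (RT E Q w).ncard := Nat.pow_le_pow_left h1 _
    _ ≤ _ := Nat.pow_le_pow_right hd h1

theorem frob_sqrt [Finite k] {Z : Set E} {t : k} {g : E ≃ₐ[F] E} (hg : FrobE k Z t g) (h2 : (2 : k) ≠ 0)
    {r : E} (hr : r ∈ Z) (hgr : g r ∈ Z) {a : k} (hr2 : r ^ 2 = algebraMap k[X] E w) (ha : a ≠ 0)
    (hw : w.eval t = a ^ 2) : g r = r := by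
  obtain ⟨Ω, _, _, π, h1, hF⟩ := hg
  have inj : ∀ a b : k, algebraMap k Ω a = algebraMap k Ω b → a = b :=
    fun a b h => (algebraMap k Ω).injective h
  have hgr2 : (g r) ^ 2 = r ^ 2 := by rw [← map_pow, hr2, gal_k]
  let R : RB k Z := ⟨r, Algebra.subset_adjoin hr⟩
  let R' : RB k Z := ⟨g r, Algebra.subset_adjoin hgr⟩
  have hR : π R ^ 2 = (algebraMap k Ω a) ^ 2 := by
    rw [← map_pow, ← map_pow, ← hw, ← h1]
    congr 1
    exact Subtype.ext hr2
  have hR' : π R' = π R := by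
    rw [hF R R' rfl]
    have := Fintype.ofFinite k
    rcases sq_eq_sq_iff_eq_or_eq_neg.1 hR with h | h
    · rw [h, ← map_pow, Nat.card_eq_fintype_card, FiniteField.pow_card]
    · rw [h, ← map_neg, ← map_pow, Nat.card_eq_fintype_card, FiniteField.pow_card]
  rcases sq_eq_sq_iff_eq_or_eq_neg.1 hgr2 with h | h
  · exact h
  · exfalso
    have h3 : π R' = - π R := by
      rw [← map_neg]; congr 1; exact Subtype.ext h
    have h4 : π R = 0 := by
      have h5 : algebraMap k Ω 2 * π R = 0 := by
        rw [map_ofNat]; rw [h3] at hR'; linear_combination -hR'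
      rcases mul_eq_zero.1 h5 with h | h
      · exact absurd (inj _ 0 (by rw [h, map_zero])) h2
      · exact h
    rw [h4, ← map_pow, zero_pow two_ne_zero, ← map_zero (algebraMap k Ω)] at hR
    exact pow_ne_zero 2 ha (inj _ _ hR).symm

theorem coeff_aeval_single (e : ℕ) (he : 0 < e) (P : k[X]) (j : ℕ) :
    (aeval (HahnSeries.single (-e : ℤ) (1 : k)) P).coeff (-(e * j : ℤ)) = P.coeff j := by
  rw [aeval_eq_sum_range, HahnSeries.coeff_sum]
  simp only [HahnSeries.coeff_smul, HahnSeries.single_pow, one_pow, HahnSeries.coeff_single, nsmul_eq_mul]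
  rw [Finset.sum_eq_single j]
  · simp [mul_comm]
  · intro b _ hb
    rw [if_neg, smul_zero]
    intro h
    apply hb
    have h' : (e : ℤ) * (b - j) = 0 := by linear_combination h
    rcases mul_eq_zero.1 h' with h | h <;> omega
  · intro h
    rw [coeff_eq_zero_of_natDegree_lt (by simpa using h), zero_smul]

theorem inj_single {e : ℕ} (he : 0 < e) :
    Function.Injective (aeval (HahnSeries.single (-e : ℤ) (1 : k)) : k[X] →ₐ[k] HahnSeries ℤ k) := by
  rw [injective_iff_map_eq_zero]
  intro P hP
  by_contra h
  have := orderTop_aeval he (HahnSeries.orderTop_single (Γ := ℤ) (a := (-e : ℤ)) (one_ne_zero (α := k))) h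
  rw [hP, HahnSeries.orderTop_zero] at this
  exact WithTop.top_ne_coe this

end Gen

theorem hyper (D : ℕ) (η : ℝ) (hη : 0 < η) : ∃ p0 : ℕ, ∀ (k : Type u) [Field k] [Finite k], p0 ≤ ringChar k →
    ∀ G : k[X], G.Monic → G.natDegree ≤ D → Even G.natDegree → ¬ IsSquare G →
    ∀ T : Finset k, (∀ t ∈ T, ∃ a, a ≠ 0 ∧ G.eval t = a ^ 2) → 2 * (T.card : ℝ) ≤ (1 + η) * Nat.card k := by
  obtain ⟨p0, hp0⟩ := cheb2.{u} (2 ^ 2) 1 (1 * D) η hη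
  refine ⟨max p0 3, ?_⟩
  intro k _ _ hp G hG hGD hGe hGs T hT
  have h2 : (2 : k) ≠ 0 := by
    intro h
    have : ringChar k ∣ 2 := (ringChar.spec k 2).1 (by exact_mod_cast h)
    have := Nat.le_of_dvd (by norm_num) this
    omega
  let F := FractionRing k[X]
  let Q : k[X] := X ^ 2
  have hQ : Q.Monic := monic_X_pow 2
  have hQd : Q.natDegree = 2 := natDegree_X_pow 2
  have hd : 1 ≤ Q.natDegree := by omega
  let E := (PP F Q G).SplittingField
  have hG0 : algebraMap k[X] E G ≠ 0 := by
    rw [IsScalarTower.algebraMap_apply k[X] F E]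
    have inj : Function.Injective (algebraMap k[X] F) := IsFractionRing.injective _ _
    rw [Ne, map_eq_zero, map_eq_zero_iff _ inj]
    exact hG.ne_zero
  have hmem : ∀ r : E, r ∈ RT E Q G ↔ r ^ 2 = algebraMap k[X] E G := by
    intro r; simp [RT, Q]
  have hr0 : ∀ r ∈ RT E Q G, r ≠ 0 := by
    rintro r hr rfl
    rw [hmem] at hr
    apply hG0; rw [← hr]; simp
  have h2E : (2 : E) ≠ 0 := by
    have : algebraMap k E 2 = 2 := map_ofNat _ 2
    rw [← this, Ne, map_eq_zero]; exact h2
  have hder : ∀ r : E, aeval r (derivative Q) = 2 * r := by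
    intro r; rw [show derivative Q = C 2 * X by simp only [Q]; rw [derivative_X_pow]; simp]; rw [map_mul, aeval_C, aeval_X, map_ofNat]
  have hgal : IsGalois F E := by
    refine PP_galois (Q := Q) (w := G) hQ hd ?_
    intro z hz
    rw [hder]
    exact mul_ne_zero h2E (hr0 z hz)
  obtain ⟨i, hi⟩ : ∃ i : E →ₐ[k] HahnSeries ℤ k, i (algebraMap k[X] E X) = HahnSeries.single (-(1 : ℕ) : ℤ) 1 := by
    refine exists_emb (F := F) (Q := Q) (w := G) _ (inj_single one_pos) ?_
    obtain ⟨d, hd⟩ := hGe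
    obtain ⟨v, hv, _⟩ := hs_sqrt h2 (aeval (HahnSeries.single (-(1 : ℕ) : ℤ) (1 : k)) G) (-d) 1 one_ne_zero
      (by
        unfold Vge
        rw [orderTop_aeval one_pos (HahnSeries.orderTop_single (Γ := ℤ) one_ne_zero) hG.ne_zero, hd]
        apply WithTop.coe_le_coe.2; push_cast; linarith)
      (by
        have := coeff_aeval_single 1 one_pos G G.natDegree
        rw [hG.coeff_natDegree, hd] at this
        rw [one_pow, show (2 * -(d : ℤ)) = -(((1 : ℕ) : ℤ) * ((d + d : ℕ) : ℤ)) by push_cast; ring]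
        exact this)
    have : Q.map (algebraMap k (HahnSeries ℤ k)) -
        C (aeval (HahnSeries.single (-(1 : ℕ) : ℤ) (1 : k)) G) = (X - C v) * (X - C (-v)) := by
      rw [← hv]; simp [Q]; ring
    rw [this]
    exact (Splits.X_sub_C _).mul (Splits.X_sub_C _)
  classical
  have := Fintype.ofFinite (E ≃ₐ[F] E)
  obtain ⟨S, hS⟩ := exists_preStep (F := F) (Z := RT E Q G) (e := 1) (δ := D) (RT_finite F hQ hd)
    (fun g z hz => RT_stab g z hz) (RT_gen hQ hd) i one_pos (by simp) hi G hGD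
    (by
      intro z hz
      refine ⟨Q, G, hQ, hd, hGD, hz, by rw [hder]; exact mul_ne_zero h2E (hr0 z hz), ?_⟩
      refine ⟨algebraMap k[X] E (C (1 / 2)) * (z * algebraMap k[X] E (derivative G)), ?_, ?_⟩
      · exact mul_mem (Subalgebra.algebraMap_mem _ _) (mul_mem (Algebra.subset_adjoin hz)
          (Subalgebra.algebraMap_mem _ _))
      · rw [hder, map_mul, ← (hmem z).1 hz, algE, map_div₀, map_one, map_ofNat]
        linear_combination (z ^ 2 * algebraMap k[X] E (derivative G)) * (div_mul_cancel₀ (1 : E) h2E).symm)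
    Finset.univ (by rw [mul_one, Finset.card_univ, Nat.card_eq_fintype_card])
    (fun h => ⟨h, Finset.mem_univ _, fun _ _ h => h⟩)
  have hmain := hp0 k F E (RT E Q G) S (by rw [← hQd]; exact gal_card_le (w := G) hQ hd) (by omega)
    {1} (by intro g hg s; rw [Set.mem_singleton_iff] at *; rw [hg]; simp) T (by
      intro t ht
      obtain ⟨a, ha, hta⟩ := hT t ht
      refine ⟨by rw [hS, hta]; exact pow_ne_zero _ ha, ?_⟩
      obtain ⟨g, hg⟩ := exists_frobE S t
      refine ⟨g, ?_, hg⟩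
      rw [Set.mem_singleton_iff]
      refine gal_ext (RT_gen (F := F) (Q := Q) (w := G) hQ hd) g 1 ?_
      intro z hz
      exact frob_sqrt hg h2 hz (RT_stab g z hz) ((hmem z).1 hz) ha hta)
  rw [Set.ncard_singleton, Nat.cast_one, mul_one] at hmain
  refine le_trans ?_ hmain
  rw [mul_comm]
  refine mul_le_mul_of_nonneg_left ?_ (Nat.cast_nonneg _)
  -- the Galois group is nontrivial
  have hcard : 2 ≤ Nat.card (E ≃ₐ[F] E) := by
    by_contra hlt
    have h1 : Nat.card (E ≃ₐ[F] E) = 1 := by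
      have : 0 < Nat.card (E ≃ₐ[F] E) := Nat.card_pos
      omega
    rw [IsGalois.card_aut_eq_finrank] at h1
    obtain ⟨r, hr⟩ : ∃ r, r ∈ RT E Q G := by
      have hs := IsSplittingField.splits E (PP F Q G)
      obtain ⟨r, hr⟩ := hs.exists_eval_eq_zero (by
        rw [degree_map, degree_eq_natDegree (PP_monic hQ hd).ne_zero, PP_natDegree hQ hd, hQd]
        norm_num)
      refine ⟨r, ?_⟩
      rw [PP_mapE, eval_sub, eval_map_algebraMap, eval_C, sub_eq_zero] at hr
      exact hr
    have hb : (⊥ : Subalgebra F E) = ⊤ := Subalgebra.bot_eq_top_iff_finrank_eq_one.2 h1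
    have hrb : r ∈ (⊥ : Subalgebra F E) := by rw [hb]; exact Algebra.mem_top
    obtain ⟨ρ, hρ⟩ := Algebra.mem_bot.1 hrb
    have hρ2 : ρ ^ 2 = algebraMap k[X] F G := by
      apply (algebraMap F E).injective
      rw [map_pow, hρ, (hmem r).1 hr, ← IsScalarTower.algebraMap_apply]
    have hIntegral : IsIntegral k[X] ρ := by
      refine IsIntegral.of_pow (n := 2) (by norm_num) ?_
      rw [hρ2]; exact isIntegral_algebraMap
    obtain ⟨P, hP⟩ := IsIntegrallyClosed.isIntegral_iff.1 hIntegral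
    apply hGs
    refine ⟨P, ?_⟩
    apply IsFractionRing.injective k[X] F
    rw [← hρ2, ← hP, map_mul, sq]
  exact_mod_cast hcard

end QLC

namespace QLC
universe u

section Grp
variable {Γ : Type u} [Group Γ] [Finite Γ]

theorem exists_index_two (hp : IsPGroup 2 Γ) (H : Subgroup Γ) (hH : H ≠ ⊤) :
    ∃ M : Subgroup Γ, M.index = 2 ∧ H ≤ M := by
  have hF : Fact (Nat.Prime 2) := ⟨Nat.prime_two⟩
  obtain ⟨m, hm⟩ := IsPGroup.iff_card.1 hp
  obtain ⟨n, hn⟩ := IsPGroup.iff_card.1 (hp.to_subgroup H)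
  have hlt : Nat.card H < Nat.card Γ := by
    refine lt_of_le_of_ne (Subgroup.card_le_card_group H) fun h => hH (Subgroup.eq_top_of_card_eq H h)
  rw [hm, hn] at hlt
  have hnm : n < m := (Nat.pow_lt_pow_iff_right (by norm_num)).1 hlt
  obtain ⟨M, hM1, hM2⟩ := Sylow.exists_subgroup_card_pow_prime_le (p := 2) (n := n) (m := m - 1)
    (by rw [hm]; exact pow_dvd_pow 2 (by omega)) H hn (by omega)
  refine ⟨M, ?_, hM2⟩
  have := M.card_mul_index
  rw [hM1, hm, show 2 ^ m = 2 ^ (m - 1) * 2 by rw [← pow_succ]; congr 1; omega] at this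
  exact Nat.eq_of_mul_eq_mul_left (by positivity) this

theorem sub_eq (T M : Subgroup Γ) (b : Γ) (hb : ∀ t ∈ T, b * t * b⁻¹ ∈ T) (hb2 : b ^ 2 ∈ T)
    (hT : T ⊔ Subgroup.zpowers b = ⊤) (hTM : T ≤ M) (hbM : b ∉ M) : T = M := by
  have hnorm : T.Normal := by
    rw [← Subgroup.normalizer_eq_top_iff, ← top_le_iff, ← hT]
    refine sup_le Subgroup.le_normalizer ?_
    rw [Subgroup.zpowers_le, Subgroup.mem_normalizer_iff]
    intro h
    refine ⟨hb h, fun h1 => ?_⟩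
    have h2 := hb _ h1
    have h3 : h = (b ^ 2)⁻¹ * (b * (b * h * b⁻¹) * b⁻¹) * b ^ 2 := by group
    rw [h3]
    exact T.mul_mem (T.mul_mem (T.inv_mem hb2) h2) hb2
  refine le_antisymm hTM fun m hm => ?_
  have hmT : m ∈ T ⊔ Subgroup.zpowers b := by rw [hT]; trivial
  obtain ⟨t, ht, z, hz, rfl⟩ := Subgroup.mem_sup_of_normal_left.1 hmT
  obtain ⟨j, rfl⟩ := Subgroup.mem_zpowers_iff.1 hz
  have hbj : b ^ j ∈ M := (M.mul_mem_cancel_left (hTM ht)).1 hm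
  have key : ∀ i : ℤ, (b ^ (2 : ℤ)) ^ i ∈ T := fun i => T.zpow_mem (by exact_mod_cast hb2) i
  rcases Int.even_or_odd' j with ⟨i, rfl | rfl⟩
  · refine T.mul_mem ht ?_
    rw [zpow_mul]; exact key i
  · exfalso
    apply hbM
    rw [zpow_add, zpow_mul, zpow_one] at hbj
    exact (M.mul_mem_cancel_left (hTM (key i))).1 hbj

theorem group_one (hp : IsPGroup 2 Γ) (N : Subgroup Γ) [N.Normal] (M : Subgroup Γ) (hM : M.index = 2)
    (hNM : N ≤ M) (ρ b b' : Γ) (hρ : ρ ∈ M) (hb : b ∉ M) (hb' : b' ∉ M) (hb2 : b ^ 2 ∈ N) (hb'2 : b' ^ 2 ∈ N)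
    (h1 : ∀ L : Subgroup Γ, L.index = 2 → N ≤ L → b ∈ L → b' ∈ L → False)
    (h2 : ∀ L : Subgroup Γ, L.index = 2 → N ≤ L → ρ ∈ L → b ∈ L → False) :
    N ⊔ Subgroup.zpowers ρ = M := by
  have hbb' : b * b' ∈ M := (Subgroup.mul_mem_iff_of_index_two hM).2 (by tauto)
  set r := b * b' with hr
  let φ := QuotientGroup.mk' N
  have hφ : ∀ x, φ x = 1 ↔ x ∈ N := fun x => QuotientGroup.eq_one_iff x
  have φb : φ b * φ b = 1 := by rw [← map_mul, hφ, ← sq]; exact hb2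
  have φb' : φ b' * φ b' = 1 := by rw [← map_mul, hφ, ← sq]; exact hb'2
  have φr : φ b * φ r * (φ b)⁻¹ = (φ r)⁻¹ := by
    have e1 : (φ b)⁻¹ = φ b := inv_eq_of_mul_eq_one_left φb
    have e2 : (φ b')⁻¹ = φ b' := inv_eq_of_mul_eq_one_left φb'
    rw [hr, map_mul, mul_inv_rev, e1, e2, ← mul_assoc, φb, one_mul]
  have φrj : ∀ j : ℤ, φ b * φ r ^ j * (φ b)⁻¹ = (φ r ^ j)⁻¹ := by
    intro j
    rw [← conj_zpow, φr, inv_zpow]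
  have step : ∀ ρ' ∈ M, (∃ j : ℤ, ∃ n ∈ N, ρ' = n * r ^ j) →
      (∀ L : Subgroup Γ, L.index = 2 → N ≤ L → ρ' ∈ L → b ∈ L → False) → N ⊔ Subgroup.zpowers ρ' = M := by
    intro ρ' hρ' hj hL
    refine sub_eq _ M b ?_ ?_ ?_ ?_ hb
    · intro t ht
      obtain ⟨n, hn, z, hz, rfl⟩ := Subgroup.mem_sup_of_normal_left.1 ht
      obtain ⟨i, rfl⟩ := Subgroup.mem_zpowers_iff.1 hz
      obtain ⟨j, n', hn', hj⟩ := hj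
      have : b * (n * ρ' ^ i) * b⁻¹ * (ρ' ^ i) ∈ N := by
        rw [← hφ]
        have e : φ ρ' = φ r ^ j := by rw [hj, map_mul, (hφ n').2 hn', one_mul, map_zpow]
        simp only [map_mul, map_zpow, map_inv, (hφ n).2 hn, one_mul, e]
        rw [← zpow_mul, φrj, inv_mul_cancel]
      have h3 : b * (n * ρ' ^ i) * b⁻¹ = (b * (n * ρ' ^ i) * b⁻¹ * (ρ' ^ i)) * (ρ' ^ i)⁻¹ := by group
      rw [h3]
      refine Subgroup.mul_mem_sup this ?_
      exact Subgroup.inv_mem _ (Subgroup.zpow_mem_zpowers _ _)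
    · exact Subgroup.mem_sup_left hb2
    · by_contra hne
      obtain ⟨L, hL1, hL2⟩ := exists_index_two hp _ hne
      refine hL L hL1 (le_trans (le_trans le_sup_left le_sup_left) hL2)
        (hL2 (Subgroup.mem_sup_left (Subgroup.mem_sup_right (Subgroup.mem_zpowers _))))
        (hL2 (Subgroup.mem_sup_right (Subgroup.mem_zpowers _)))
    · refine sup_le hNM ?_
      rw [Subgroup.zpowers_le]; exact hρ'
  have hT : N ⊔ Subgroup.zpowers r = M := by
    refine step r hbb' ⟨1, 1, N.one_mem, by simp⟩ ?_
    intro L hL1 hL2 hL3 hL4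
    exact h1 L hL1 hL2 hL4 ((L.mul_mem_cancel_left hL4).1 hL3)
  refine step ρ hρ ?_ h2
  have : ρ ∈ N ⊔ Subgroup.zpowers r := by rw [hT]; exact hρ
  obtain ⟨n, hn, z, hz, rfl⟩ := Subgroup.mem_sup_of_normal_left.1 this
  obtain ⟨i, rfl⟩ := Subgroup.mem_zpowers_iff.1 hz
  exact ⟨i, n, hn, rfl⟩

theorem group_two (N1 N2 H : Subgroup Γ) [hn1 : N1.Normal] [hn2 : N2.Normal] (ρ : Γ) (θ : Γ ≃* Γ) (hρ : θ ρ = ρ)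
    (hN : ∀ g, g ∈ N2 ↔ θ g ∈ N1) (U U' : Set Γ) (hU : ∀ g, g ∈ U ↔ θ g ∈ U')
    (hUN : ∀ g ∈ U, ∀ n ∈ N1, g * n ∈ U) (hUN' : ∀ g ∈ U', ∀ n ∈ N2, g * n ∈ U')
    (h1 : N1 ≤ H) (h2 : N2 ≤ H)
    (hH : ∀ h ∈ H, ∃ i : ℤ, ∃ x ∈ N1, ∃ y ∈ N2, h = ρ ^ i * x * y) :
    ((U ∩ H).ncard : ℝ) ^ 2 ≤ Nat.card H * (U ∩ U' ∩ H).ncard := by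
  classical
  have := Fintype.ofFinite Γ
  let u : Γ → ℝ := fun g => if g ∈ U then 1 else 0
  let u' : Γ → ℝ := fun g => if g ∈ U' then 1 else 0
  have huN : ∀ g, ∀ n ∈ N1, u (g * n) = u g := by
    intro g n hn
    have : g * n ∈ U ↔ g ∈ U :=
      ⟨fun h => by simpa using hUN _ h n⁻¹ (N1.inv_mem hn), fun h => hUN _ h n hn⟩
    simp only [u, this]
  have huN' : ∀ g, ∀ n ∈ N2, u' (g * n) = u' g := by
    intro g n hn
    have : g * n ∈ U' ↔ g ∈ U' :=
      ⟨fun h => by simpa using hUN' _ h n⁻¹ (N2.inv_mem hn), fun h => hUN' _ h n hn⟩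
    simp only [u', this]
  let F1 : Finset Γ := Finset.univ.filter (· ∈ N1)
  let F2 : Finset Γ := Finset.univ.filter (· ∈ N2)
  let FH : Finset Γ := Finset.univ.filter (· ∈ H)
  let a : Γ → ℝ := fun h => ∑ n ∈ F2, u (h * n)
  let a' : Γ → ℝ := fun h => ∑ n ∈ F1, u' (h * n)
  have sum_tr : ∀ (S : Subgroup Γ) (f : Γ → ℝ) (x : Γ), x ∈ S →
      ∑ n ∈ Finset.univ.filter (· ∈ S), f (n * x) = ∑ n ∈ Finset.univ.filter (· ∈ S), f n := by
    intro S f x hx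
    refine Finset.sum_equiv (Equiv.mulRight x) ?_ (fun _ _ => rfl)
    intro i
    simp [S.mul_mem_cancel_right hx]
  have sum_tl : ∀ (S : Subgroup Γ) (f : Γ → ℝ) (x : Γ), x ∈ S →
      ∑ n ∈ Finset.univ.filter (· ∈ S), f (x * n) = ∑ n ∈ Finset.univ.filter (· ∈ S), f n := by
    intro S f x hx
    refine Finset.sum_equiv (Equiv.mulLeft x) ?_ (fun _ _ => rfl)
    intro i
    simp [S.mul_mem_cancel_left hx]
  have ha2 : ∀ h, ∀ y ∈ N2, a (h * y) = a h := by
    intro h y hy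
    simp only [a, mul_assoc]
    exact sum_tl N2 (fun n => u (h * n)) y hy
  have ha1 : ∀ h, ∀ x ∈ N1, a (h * x) = a h := by
    intro h x hx
    refine Finset.sum_congr rfl fun n _ => ?_
    rw [show h * x * n = h * n * (n⁻¹ * x * n⁻¹⁻¹) by group]
    exact huN _ _ (hn1.conj_mem x hx n⁻¹)
  have ha1' : ∀ h, ∀ y ∈ N1, a' (h * y) = a' h := by
    intro h y hy
    simp only [a', mul_assoc]
    exact sum_tl N1 (fun n => u' (h * n)) y hy
  have ha2' : ∀ h, ∀ x ∈ N2, a' (h * x) = a' h := by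
    intro h x hx
    refine Finset.sum_congr rfl fun n _ => ?_
    rw [show h * x * n = h * n * (n⁻¹ * x * n⁻¹⁻¹) by group]
    exact huN' _ _ (hn2.conj_mem x hx n⁻¹)
  have haρ : ∀ i : ℤ, a (ρ ^ i) = a' (ρ ^ i) := by
    intro i
    refine Finset.sum_equiv θ.toEquiv ?_ ?_
    · intro g; simp [F1, F2, hN]
    · intro g _
      have : ρ ^ i * g ∈ U ↔ ρ ^ i * θ g ∈ U' := by rw [hU, map_mul, map_zpow, hρ]
      simp [u, u', this]
  have haa : ∀ h ∈ FH, a' h = a h := by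
    intro h hh
    obtain ⟨i, x, hx, y, hy, rfl⟩ := hH h (by simpa [FH] using hh)
    rw [ha2 _ y hy, ha1 _ x hx, ha2' _ y hy, ha1' _ x hx, haρ]
  have S1 : ∑ h ∈ FH, a h = F2.card * ∑ h ∈ FH, u h := by
    rw [Finset.sum_comm, ← nsmul_eq_mul]
    refine Finset.sum_eq_card_nsmul fun n hn => ?_
    exact sum_tr H u n (h2 (by simpa [F2] using hn))
  have S2 : ∑ h ∈ FH, a h ^ 2 = F2.card * (F1.card * ∑ h ∈ FH, u h * u' h) := by
    have e1 : ∀ h ∈ FH, a h ^ 2 = ∑ n ∈ F2, ∑ m ∈ F1, (u (h * (m * n)) * u' (h * (m * n))) := by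
      intro h hh
      rw [sq]
      nth_rw 2 [← haa h hh]
      rw [Finset.sum_mul_sum]
      refine Finset.sum_congr rfl fun n hn => Finset.sum_congr rfl fun m hm => ?_
      have hm' : m ∈ N1 := by simpa [F1] using hm
      have hn' : n ∈ N2 := by simpa [F2] using hn
      rw [← mul_assoc, huN' _ n hn', show h * m * n = h * n * (n⁻¹ * m * n⁻¹⁻¹) by group,
        huN _ _ (hn1.conj_mem m hm' n⁻¹)]
    rw [Finset.sum_congr rfl e1, Finset.sum_comm, ← nsmul_eq_mul]
    refine Finset.sum_eq_card_nsmul fun n hn => ?_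
    rw [Finset.sum_comm, ← nsmul_eq_mul]
    refine Finset.sum_eq_card_nsmul fun m hm => ?_
    exact sum_tr H (fun x => u x * u' x) (m * n)
      (H.mul_mem (h1 (by simpa [F1] using hm)) (h2 (by simpa [F2] using hn)))
  have hc : F1.card = F2.card := by
    refine (Finset.card_bijective θ θ.bijective ?_).symm
    intro g; simp [F1, F2, hN]
  have hpos : (0 : ℝ) < F2.card := by
    have : 0 < F2.card := Finset.card_pos.2 ⟨1, by simp [F2, N2.one_mem]⟩
    exact_mod_cast this
  have C1 : ((U ∩ H).ncard : ℝ) = ∑ h ∈ FH, u h := by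
    rw [Finset.sum_boole, Set.ncard_eq_toFinset_card']
    congr 2
    ext x; simp [FH, and_comm]
  have C2 : ((U ∩ U' ∩ H).ncard : ℝ) = ∑ h ∈ FH, u h * u' h := by
    have : ∀ h, u h * u' h = if h ∈ U ∩ U' then 1 else 0 := by
      intro h; simp only [u, u', Set.mem_inter_iff]; split_ifs <;> simp_all
    simp only [this]
    rw [Finset.sum_boole, Set.ncard_eq_toFinset_card']
    congr 2
    ext x; simp [FH]; tauto
  have C3 : (Nat.card H : ℝ) = FH.card := by
    rw [Nat.card_eq_fintype_card, Fintype.card_subtype]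
  rw [C1, C2, C3]
  have CS := sq_sum_le_card_mul_sum_sq (s := FH) (f := a)
  rw [S1, S2, hc] at CS
  have : (F2.card : ℝ) ^ 2 * (∑ h ∈ FH, u h) ^ 2 ≤ (F2.card : ℝ) ^ 2 * (FH.card * ∑ h ∈ FH, u h * u' h) := by
    calc _ = (F2.card * ∑ h ∈ FH, u h) ^ 2 := by ring
      _ ≤ _ := CS
      _ = _ := by ring
  exact le_of_mul_le_mul_left this (by positivity)

end Grp
end QLC

namespace QLC
universe u

section Setup
variable {k F E : Type u} [Field k] [Field F] [Field E] [Algebra k[X] F]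
    [IsFractionRing k[X] F] [Algebra F E] [Algebra k[X] E] [IsScalarTower k[X] F E] [Algebra k E]
    [IsScalarTower k k[X] E] {c : k} {n : ℕ}

theorem algX_inj (F : Type u) {E : Type u} [Field F] [Field E] [Algebra k[X] F]
    [IsFractionRing k[X] F] [Algebra F E] [Algebra k[X] E] [IsScalarTower k[X] F E]
    (P R : k[X]) (h : algebraMap k[X] E P = algebraMap k[X] E R) : P = R := by
  rw [IsScalarTower.algebraMap_apply k[X] F E, IsScalarTower.algebraMap_apply k[X] F E] at h
  exact IsFractionRing.injective k[X] F ((algebraMap F E).injective h)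

theorem y_ne (F : Type u) {E : Type u} [Field F] [Field E] [Algebra k[X] F]
    [IsFractionRing k[X] F] [Algebra F E] [Algebra k[X] E] [IsScalarTower k[X] F E] [Algebra k E]
    [IsScalarTower k k[X] E] (a : k) : algebraMap k[X] E X ≠ algebraMap k E a := by
  rw [← algE]
  intro h
  exact X_ne_C a (algX_inj F _ _ h)

theorem fi_hQ (c : k) (n : ℕ) : (fi c (n + 1)).Monic ∧ 1 ≤ (fi c (n + 1)).natDegree := by
  refine ⟨(fi_monic_deg c _).1, ?_⟩
  rw [(fi_monic_deg c _).2]; exact Nat.one_le_two_pow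

theorem mem_RT (z : E) : z ∈ RT E (fi c (n + 1)) (X ^ 2 + C c) ↔
    it (algebraMap k E c) n z = algebraMap k[X] E X ∨ it (algebraMap k E c) n z = - algebraMap k[X] E X := by
  change aeval z _ = _ ↔ _
  rw [fi_aeval, it_succ, map_add, map_pow, algE, add_left_inj, sq_eq_sq_iff_eq_or_eq_neg]

theorem it_ne_zero (F : Type u) {E : Type u} [Field F] [Field E] [Algebra k[X] F]
    [IsFractionRing k[X] F] [Algebra F E] [Algebra k[X] E] [IsScalarTower k[X] F E] [Algebra k E]
    [IsScalarTower k k[X] E] {z : E} (hz : z ∈ RT E (fi c (n + 1)) (X ^ 2 + C c))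
    {j : ℕ} (hj : j ≤ n) : it (algebraMap k E c) j z ≠ 0 := by
  intro h
  have h1 : it (algebraMap k E c) n z = algebraMap k E (it c (n - j) 0) := by
    rw [show n = (n - j) + j by omega, it_add, h, Nat.add_sub_cancel, it_map, map_zero]
  rcases (mem_RT z).1 hz with h2 | h2
  · exact y_ne F (E := E) _ (h2.symm.trans h1)
  · refine y_ne F (E := E) (-it c (n - j) 0) ?_
    rw [map_neg, ← h1, h2, neg_neg]

theorem der_ne_zero (F : Type u) {E : Type u} [Field F] [Field E] [Algebra k[X] F]
    [IsFractionRing k[X] F] [Algebra F E] [Algebra k[X] E] [IsScalarTower k[X] F E] [Algebra k E]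
    [IsScalarTower k k[X] E] (h2 : (2 : k) ≠ 0) {z : E} (hz : z ∈ RT E (fi c (n + 1)) (X ^ 2 + C c)) :
    aeval z (derivative (fi c (n + 1))) ≠ 0 := by
  rw [fi_deriv_aeval]
  have h2E : (2 : E) ≠ 0 := by
    have : algebraMap k E 2 = 2 := map_ofNat _ 2
    rw [← this, Ne, map_eq_zero]; exact h2
  refine mul_ne_zero (pow_ne_zero _ h2E) (Finset.prod_ne_zero_iff.2 fun j hj => ?_)
  exact it_ne_zero F hz (by simpa [Nat.lt_succ_iff] using hj)

theorem fgalois [IsSplittingField F E (PP F (fi c (n + 1)) (X ^ 2 + C c))] (h2 : (2 : k) ≠ 0) : IsGalois F E :=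
  PP_galois (fi_hQ c n).1 (fi_hQ c n).2 fun _ hz => der_ne_zero F h2 hz

theorem emb_of_spl [IsSplittingField F E (PP F (fi c (n + 1)) (X ^ 2 + C c))] {L : Type u} [Field L]
    [Algebra k L] (Y : L) (hY : Function.Injective (aeval Y : k[X] →ₐ[k] L))
    (h1 : Spl (algebraMap k L c) n Y) (h2 : Spl (algebraMap k L c) n (-Y)) :
    ∃ i : E →ₐ[k] L, i (algebraMap k[X] E X) = Y := by
  refine exists_emb (F := F) (Q := fi c (n + 1)) (w := X ^ 2 + C c) Y hY ?_
  rw [fi_map]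
  refine Spl.splits _ _ _ ⟨Y, ?_, h1, h2⟩
  simp

theorem exists_inf [IsSplittingField F E (PP F (fi c (n + 1)) (X ^ 2 + C c))] (h2 : (2 : k) ≠ 0) {ζ : k}
    (hζ : ζ ^ 2 ^ n = -1) :
    ∃ i : E →ₐ[k] HahnSeries ℤ k, i (algebraMap k[X] E X) = HahnSeries.single (-(2 ^ n : ℕ) : ℤ) 1 := by
  have hν : ∀ j < n, ∃ ν : k, ν ^ 2 ^ j = -1 := by
    intro j hj
    refine ⟨ζ ^ 2 ^ (n - j), ?_⟩
    rw [← pow_mul, ← pow_add, show n - j + j = n by omega, hζ]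
  have hζ0 : ζ ≠ 0 := by
    rintro rfl
    rw [zero_pow (by positivity)] at hζ
    exact one_ne_zero (neg_eq_zero.1 hζ.symm)
  have hV : Vge (-2 ^ n) (HahnSeries.single (-(2 ^ n : ℕ) : ℤ) (1 : k)) := by
    unfold Vge; rw [HahnSeries.orderTop_single one_ne_zero]; push_cast; rfl
  refine emb_of_spl (F := F) (c := c) (n := n) _ (inj_single (by positivity)) ?_ ?_
  · refine spl_inf h2 c n hν 1 one_ne_zero _ hV ?_
    rw [HahnSeries.coeff_single, if_pos (by push_cast; rfl), one_pow]
  · refine spl_inf h2 c n hν ζ hζ0 _ hV.neg ?_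
    rw [HahnSeries.coeff_neg, HahnSeries.coeff_single, if_pos (by push_cast; rfl), hζ]

theorem exists_alpha [IsSplittingField F E (PP F (fi c (n + 1)) (X ^ 2 + C c))] {ζ : kˣ}
    (hζ : (ζ : k) ^ 2 ^ n = -1) (i : E →ₐ[k] HahnSeries ℤ k)
    (hi : i (algebraMap k[X] E X) = HahnSeries.single (-(2 ^ n : ℕ) : ℤ) 1) :
    ∃ α : E ≃ₐ[k] E, α (algebraMap k[X] E X) = - algebraMap k[X] E X ∧ ∀ x, i (α x) = sig ζ (i x) := by
  let Φ' : E →ₐ[k] HahnSeries ℤ k := (sig ζ : HahnSeries ℤ k →ₐ[k] HahnSeries ℤ k).comp i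
  have hΦ : ∀ x, Φ' x = sig ζ (i x) := fun x => rfl
  have hy : Φ' (algebraMap k[X] E X) = - i (algebraMap k[X] E X) := by
    rw [hΦ, hi, sig_single, zpow_neg, zpow_natCast, mul_one, ← HahnSeries.single_neg]
    congr 1
    rw [Units.val_inv_eq_inv_val, Units.val_pow_eq_pow_val, hζ, inv_neg, inv_one]
  obtain ⟨α, hα⟩ := exists_transfer (F := F) (Q := fi c (n + 1)) (w := X ^ 2 + C c) (fi_hQ c n).1 (fi_hQ c n).2 i Φ'
    (by
      rw [map_add, map_pow, algE, map_add, map_add, map_pow, map_pow, AlgHom.commutes, AlgHom.commutes, hy, neg_sq])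
    ⟨- algebraMap k[X] E X, by rw [hy, map_neg]⟩ ⟨- algebraMap k[X] E X, by rw [map_neg, hy, neg_neg]⟩
  have inj : ∀ a b, i a = i b → a = b := fun a b h => i.injective h
  refine ⟨α, ?_, hα⟩
  apply inj _ _
  rw [hα, hy, map_neg]

theorem exists_theta (α : E ≃ₐ[k] E) (hα : α (algebraMap k[X] E X) = - algebraMap k[X] E X) :
    ∃ θ : (E ≃ₐ[F] E) ≃* (E ≃ₐ[F] E), ∀ g x, θ g (α x) = α (g x) := by
  have toK : ∀ g : E ≃ₐ[F] E, ∃ g' : E ≃ₐ[k] E, ∀ x, g' x = g x := by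
    intro g
    refine ⟨{ (g : E ≃+* E) with commutes' := ?_ }, fun x => rfl⟩
    intro a
    change g _ = _
    rw [← algE, gal_k]
  have key : ∀ β : E ≃ₐ[k] E, β (algebraMap k[X] E X) = - algebraMap k[X] E X →
      ∀ g : E ≃ₐ[F] E, ∃ h : E ≃ₐ[F] E, ∀ x, h (β x) = β (g x) := by
    intro β hβ g
    obtain ⟨g', hg'⟩ := toK g
    have hβ' : β.symm (algebraMap k[X] E X) = - algebraMap k[X] E X := by
      rw [AlgEquiv.symm_apply_eq, map_neg, hβ, neg_neg]
    obtain ⟨h, hh⟩ := exists_gal (F := F) ((β.symm.trans g').trans β) (by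
      simp only [AlgEquiv.trans_apply]
      rw [hβ', hg', map_neg, gal_k, map_neg, hβ, neg_neg])
    refine ⟨h, fun x => ?_⟩
    rw [hh]
    simp only [AlgEquiv.trans_apply, AlgEquiv.symm_apply_apply, hg']
  have hβ' : α.symm (algebraMap k[X] E X) = - algebraMap k[X] E X := by
    rw [AlgEquiv.symm_apply_eq, map_neg, hα, neg_neg]
  choose θ hθ using key α hα
  choose θ' hθ' using key α.symm hβ'
  refine ⟨{ toFun := θ, invFun := θ', left_inv := ?_, right_inv := ?_, map_mul' := ?_ }, hθ⟩
  · intro g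
    ext x
    obtain ⟨x, rfl⟩ := α.symm.surjective x
    rw [hθ']
    obtain ⟨x, rfl⟩ := α.surjective x
    rw [hθ, α.symm_apply_apply, α.symm_apply_apply]
  · intro g
    ext x
    obtain ⟨x, rfl⟩ := α.surjective x
    rw [hθ]
    obtain ⟨x, rfl⟩ := α.symm.surjective x
    rw [hθ', α.apply_symm_apply, α.apply_symm_apply]
  · intro g h
    ext x
    obtain ⟨x, rfl⟩ := α.surjective x
    rw [hθ, AlgEquiv.mul_apply, AlgEquiv.mul_apply, hθ, hθ]

theorem exists_rho (α : E ≃ₐ[k] E) (hα : α (algebraMap k[X] E X) = - algebraMap k[X] E X) :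
    ∃ ρ : E ≃ₐ[F] E, ∀ x, ρ x = α (α x) := by
  obtain ⟨ρ, hρ⟩ := exists_gal (F := F) (α.trans α) (by
    rw [AlgEquiv.trans_apply, hα, map_neg, hα, neg_neg])
  exact ⟨ρ, hρ⟩

theorem rho_coeff {ζ : kˣ} (i : E →ₐ[k] HahnSeries ℤ k) {α : E ≃ₐ[k] E} (hα : ∀ x, i (α x) = sig ζ (i x))
    {ρ : E ≃ₐ[F] E} (hρ : ∀ x, ρ x = α (α x)) (m : ℕ) (x : E) (j : ℤ) :
    (i ((ρ ^ m) x)).coeff j = ((ζ ^ (2 * m * j) : kˣ) : k) * (i x).coeff j := by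
  induction m generalizing x with
  | zero => simp
  | succ m ih =>
    rw [pow_succ, AlgEquiv.mul_apply, ih, hρ, hα, hα, sig_coeff, sig_coeff, ← mul_assoc, ← mul_assoc,
      ← Units.val_mul, ← Units.val_mul, ← zpow_add, ← zpow_add]
    congr 3
    push_cast; ring

theorem rho_vge {ζ : kˣ} (i : E →ₐ[k] HahnSeries ℤ k) {α : E ≃ₐ[k] E} (hα : ∀ x, i (α x) = sig ζ (i x))
    {ρ : E ≃ₐ[F] E} (hρ : ∀ x, ρ x = α (α x)) (m : ℕ) (x : E) (j : ℤ) :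
    Vge j (i ((ρ ^ m) x)) ↔ Vge j (i x) := by
  simp only [vge_iff, rho_coeff i hα hρ, Units.mul_right_eq_zero]

theorem split_half [IsSplittingField F E (PP F (fi c (n + 1)) (X ^ 2 + C c))] (v : E)
    (hv : v = algebraMap k[X] E X ∨ v = - algebraMap k[X] E X) :
    (fi (algebraMap k E c) n - C v).Splits := by
  have hs := IsSplittingField.splits E (PP F (fi c (n + 1)) (X ^ 2 + C c))
  have hne : (PP F (fi c (n + 1)) (X ^ 2 + C c)).map (algebraMap F E) ≠ 0 :=
    Polynomial.map_ne_zero (PP_monic (fi_hQ c n).1 (fi_hQ c n).2).ne_zero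
  refine hs.of_dvd hne ⟨fi (algebraMap k E c) n + C v, ?_⟩
  have hv2 : algebraMap k[X] E X ^ 2 = v ^ 2 := by rcases hv with rfl | rfl <;> ring
  rw [PP_mapE, fi_map, map_add, map_pow, hv2, algE, fi, C_add, C_pow]
  ring

theorem half_monic (c v : E) : (fi c n - C v).Monic := by
  refine monic_sub_C' (fi_monic_deg c n).1 ?_ v
  rw [(fi_monic_deg c n).2]; exact Nat.one_le_two_pow

theorem half_root [IsSplittingField F E (PP F (fi c (n + 1)) (X ^ 2 + C c))] (v : E)
    (hv : v = algebraMap k[X] E X ∨ v = - algebraMap k[X] E X) :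
    ∃ z, it (algebraMap k E c) n z = v := by
  obtain ⟨z, hz⟩ := (split_half (F := F) (n := n) (c := c) v hv).exists_eval_eq_zero (by
    rw [degree_eq_natDegree (half_monic _ v).ne_zero, natDegree_sub_C, (fi_monic_deg _ n).2]
    norm_num)
  rw [eval_sub, fi_eval, eval_C, sub_eq_zero] at hz
  exact ⟨z, hz⟩

theorem orderOf_rho [IsSplittingField F E (PP F (fi c (n + 1)) (X ^ 2 + C c))] (hn : 1 ≤ n) (h2 : (2 : k) ≠ 0)
    {ζ : kˣ} (hζ : (ζ : k) ^ 2 ^ n = -1) (i : E →ₐ[k] HahnSeries ℤ k)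
    (hi : i (algebraMap k[X] E X) = HahnSeries.single (-(2 ^ n : ℕ) : ℤ) 1)
    {α : E ≃ₐ[k] E} (hα : ∀ x, i (α x) = sig ζ (i x))
    {ρ : E ≃ₐ[F] E} (hρ : ∀ x, ρ x = α (α x)) : orderOf ρ = 2 ^ n := by
  have hF : Fact (Nat.Prime 2) := ⟨Nat.prime_two⟩
  obtain ⟨m, rfl⟩ : ∃ m, n = m + 1 := ⟨n - 1, by omega⟩
  have hζ2 : ζ ^ 2 ^ (m + 1) = -1 := by
    ext; rw [Units.val_pow_eq_pow_val, hζ, Units.val_neg, Units.val_one]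
  have hζ1 : ζ ^ (2 * (2 ^ (m + 1) : ℕ) : ℤ) = 1 := by
    rw [mul_comm, zpow_mul, zpow_natCast, hζ2]
    norm_num
  have inj : ∀ a b, i a = i b → a = b := fun a b h => i.injective h
  refine orderOf_eq_prime_pow ?_ ?_
  · intro h
    obtain ⟨z, hz⟩ := half_root (F := F) (E := E) (n := m + 1) (c := c) _ (Or.inl rfl)
    have hz' : aeval (i z) (fi c (m + 1)) = HahnSeries.single (-(2 ^ (m + 1) : ℕ) : ℤ) 1 := by
      rw [aeval_algHom_apply, fi_aeval, hz, hi]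
    have ho : (aeval (i z) (fi c (m + 1))).orderTop = ((-(2 ^ (m + 1) : ℕ) : ℤ) : WithTop ℤ) := by
      rw [hz', HahnSeries.orderTop_single one_ne_zero]
    have hz0 : ¬ Vge 0 (i z) := by
      intro hv
      refine not_vge_of_orderTop ho (n := 0) (by simp) ?_
      rw [aeval_eq_sum_range]
      exact Vge.sum fun j _ => ((hv.pow j).mono (by simp)).smul _
    have hne : i z ≠ 0 := by intro h0; rw [h0] at hz0; exact hz0 (vge_zero 0)
    obtain ⟨t, ht⟩ := exists_orderTop hne
    have ht0 : t < 0 := by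
      by_contra h0
      apply hz0; unfold Vge; rw [ht]; exact WithTop.coe_le_coe.2 (by omega)
    have h3 := orderTop_aeval (e := t.natAbs) (by omega) (Y := i z)
      (by rw [ht]; congr 1; omega) (fi_monic_deg c (m + 1)).1.ne_zero
    rw [ho, (fi_monic_deg c (m + 1)).2] at h3
    have h4 := WithTop.coe_injective h3
    have ht1 : t = -1 := by
      have : t.natAbs * 2 ^ (m + 1) = 1 * 2 ^ (m + 1) := by
        have := neg_injective h4
        rw [one_mul]; exact_mod_cast this.symm
      have := Nat.eq_of_mul_eq_mul_right (by positivity) this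
      omega
    have h5 := rho_coeff i hα hρ (2 ^ m) z t
    rw [h] at h5
    have h6 := HahnSeries.coeff_orderTop_ne ht
    have h7 : ((ζ ^ (2 * (2 ^ m : ℕ) * t : ℤ) : kˣ) : k) = 1 := by
      refine mul_right_cancel₀ h6 ?_
      rw [one_mul]; exact h5.symm
    rw [ht1, show (2 * ((2 ^ m : ℕ) : ℤ) * -1) = -((2 ^ (m + 1) : ℕ) : ℤ) by push_cast; ring, zpow_neg,
      zpow_natCast, hζ2] at h7
    simp at h7
    apply h2
    linear_combination -h7
  · ext x
    apply inj _ _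
    ext j
    rw [rho_coeff i hα hρ, zpow_mul, hζ1]
    simp

theorem exists_reps [FiniteDimensional F E] {e : ℕ} {ζ : kˣ} (i : E →ₐ[k] HahnSeries ℤ k)
    {α : E ≃ₐ[k] E} (hα : ∀ x, i (α x) = sig ζ (i x))
    {ρ : E ≃ₐ[F] E} (hρ : ∀ x, ρ x = α (α x)) (ho : orderOf ρ = e) :
    ∃ reps : Finset (E ≃ₐ[F] E), reps.card * e = Nat.card (E ≃ₐ[F] E) ∧
    ∀ h : E ≃ₐ[F] E, ∃ h₀ ∈ reps, ∀ (m : ℤ) (x : E), Vge m (i (h₀ x)) → Vge m (i (h x)) := by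
  obtain ⟨T, hT, _⟩ := Subgroup.exists_isComplement_right (Subgroup.zpowers ρ) 1
  classical
  have hTf : T.Finite := Set.toFinite T
  refine ⟨hTf.toFinset, ?_, ?_⟩
  · rw [← hT.card_mul_card, ← ho, ← Nat.card_zpowers, mul_comm]
    congr 1
    rw [Nat.card_coe_set_eq, Set.ncard_eq_toFinset_card T hTf]
  · intro h
    obtain ⟨⟨⟨a, ha⟩, ⟨b, hb⟩⟩, hab, _⟩ := hT.existsUnique h
    refine ⟨b, by simpa using hb, ?_⟩
    intro m x hx
    obtain ⟨j, rfl⟩ := (mem_powers_iff_mem_zpowers.2 ha)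
    rw [← hab]
    exact (rho_vge i hα hρ j (b x) m).2 hx

theorem fix_pow (c : k) (g : E ≃ₐ[F] E) (j : ℕ) (x : E)
    (h : g (it (algebraMap k E c) j x) = it (algebraMap k E c) j x) : (g ^ 2 ^ j) x = x := by
  induction j generalizing x with
  | zero => simpa using h
  | succ j ih =>
    rw [it_succ'] at h
    have h1 := ih _ h
    rw [map_add, ← algE, gal_k, add_left_inj, map_pow, sq_eq_sq_iff_eq_or_eq_neg] at h1
    rw [pow_succ, pow_mul, sq, AlgEquiv.mul_apply]
    rcases h1 with h1 | h1
    · rw [h1, h1]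
    · rw [h1, map_neg, h1, neg_neg]

theorem pgroup [IsSplittingField F E (PP F (fi c (n + 1)) (X ^ 2 + C c))] : IsPGroup 2 (E ≃ₐ[F] E) := by
  intro g
  refine ⟨n + 1, ?_⟩
  refine gal_ext (RT_gen (F := F) (w := X ^ 2 + C c) (fi_hQ c n).1 (fi_hQ c n).2) _ _ fun z hz => ?_
  refine fix_pow c g (n + 1) z ?_
  have : it (algebraMap k E c) (n + 1) z = algebraMap k[X] E (X ^ 2 + C c) := by
    rw [← fi_aeval]; exact hz
  rw [this, gal_k]

end Setup
end QLC

namespace QLC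
universe u

theorem sq_sqfree {k : Type u} [Field k] (d : ℕ) (P : k[X]) (hd : P.natDegree ≤ d) (hP : P ≠ 0) :
    ∃ s q : k[X], P = s ^ 2 * q ∧ Squarefree q := by
  induction d using Nat.strong_induction_on generalizing P with
  | _ d ih =>
    by_cases hs : Squarefree P
    · exact ⟨1, P, by simp, hs⟩
    · unfold Squarefree at hs
      push Not at hs
      obtain ⟨x, ⟨t, ht⟩, hx⟩ := hs
      have hx0 : x ≠ 0 := by rintro rfl; apply hP; rw [ht]; simp
      have ht0 : t ≠ 0 := by rintro rfl; apply hP; rw [ht]; simp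
      have hxd : 0 < x.natDegree := by
        by_contra h0
        apply hx
        rw [Polynomial.isUnit_iff_degree_eq_zero, degree_eq_natDegree hx0]
        norm_cast; omega
      have hdeg : P.natDegree = x.natDegree + x.natDegree + t.natDegree := by
        rw [ht, natDegree_mul (mul_ne_zero hx0 hx0) ht0, natDegree_mul hx0 hx0]
      obtain ⟨s, q, h1, h2⟩ := ih t.natDegree (by omega) t le_rfl ht0
      exact ⟨x * s, q, by rw [ht, h1]; ring, h2⟩

section Setup
variable {k F E : Type u} [Field k] [Field F] [Field E] [Algebra k[X] F]
    [IsFractionRing k[X] F] [Algebra F E] [Algebra k[X] E] [IsScalarTower k[X] F E] [Algebra k E]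
    [IsScalarTower k k[X] E] {c : k} {n : ℕ}

theorem two_ne (h2 : (2 : k) ≠ 0) : (2 : E) ≠ 0 := by
  have : algebraMap k E 2 = 2 := map_ofNat _ 2
  rw [← this, Ne, map_eq_zero]; exact h2

/-- Index two subgroups are stabilizers of square roots of polynomials. -/
theorem index_two_sqrt [FiniteDimensional F E] [IsGalois F E] (h2 : (2 : k) ≠ 0) (i : E →ₐ[k] HahnSeries ℤ k)
    {e : ℕ} (he : 0 < e) (hi : i (algebraMap k[X] E X) = HahnSeries.single (-e : ℤ) 1)
    (M : Subgroup (E ≃ₐ[F] E)) (hM : M.index = 2) :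
    ∃ (r : E) (q : k[X]), q.Monic ∧ Squarefree q ∧ 0 < q.natDegree ∧ r ^ 2 = algebraMap k[X] E q ∧
      (∀ g ∈ M, g r = r) ∧ ∀ g ∉ M, g r ≠ r := by
  have h2E : (2 : E) ≠ 0 := two_ne h2
  have inj0 : ∀ a b : k[X], algebraMap k[X] E a = algebraMap k[X] E b → a = b := algX_inj F
  have hMt : M ≠ ⊤ := by rintro rfl; simp at hM
  obtain ⟨g0, hg0⟩ : ∃ g0, g0 ∉ M := by
    by_contra h; push Not at h; exact hMt ((Subgroup.eq_top_iff' M).2 h)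
  obtain ⟨x, hxM, hx⟩ : ∃ x, (∀ g ∈ M, g x = x) ∧ g0 x ≠ x := by
    by_contra h
    push Not at h
    apply hg0
    rw [← IntermediateField.fixingSubgroup_fixedField M, IntermediateField.mem_fixingSubgroup_iff]
    intro x hx
    exact h x fun g hg => hx ⟨g, hg⟩
  have hmul := fun a b => Subgroup.mul_mem_iff_of_index_two hM (a := a) (b := b)
  have hout : ∀ g ∉ M, g x = g0 x := by
    intro g hg
    have : g0⁻¹ * g ∈ M := by rw [hmul, inv_mem_iff]; tauto
    have h := hxM _ this
    have h' := congrArg g0 h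
    rw [← AlgEquiv.mul_apply, mul_inv_cancel_left] at h'
    exact h'
  have hr1 : ∀ g ∈ M, g (x - g0 x) = x - g0 x := by
    intro g hg
    rw [map_sub, hxM g hg, ← AlgEquiv.mul_apply, hout (g * g0) (by rw [hmul]; tauto)]
  have hr2 : ∀ g ∉ M, g (x - g0 x) = - (x - g0 x) := by
    intro g hg
    rw [map_sub, hout g hg, ← AlgEquiv.mul_apply, hxM (g * g0) (by rw [hmul]; tauto)]
    ring
  have hr0 : x - g0 x ≠ 0 := sub_ne_zero.2 (Ne.symm hx)
  generalize x - g0 x = r0 at hr0 hr1 hr2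
  obtain ⟨f, hf⟩ : r0 ^ 2 ∈ Set.range (algebraMap F E) := by
    rw [IsGalois.mem_range_algebraMap_iff_fixed]
    intro g
    rw [map_pow]
    by_cases hg : g ∈ M
    · rw [hr1 g hg]
    · rw [hr2 g hg, neg_sq]
  obtain ⟨a, b, hb, hab⟩ := IsFractionRing.div_surjective (A := k[X]) f
  have hb0 : b ≠ 0 := nonZeroDivisors.ne_zero hb
  have hbE : algebraMap k[X] E b ≠ 0 := fun h => hb0 (inj0 _ _ (by rw [h, map_zero]))
  have hr3 : (algebraMap k[X] E b * r0) ^ 2 = algebraMap k[X] E (a * b) := by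
    rw [mul_pow, ← hf, ← hab, map_div₀, ← IsScalarTower.algebraMap_apply, ← IsScalarTower.algebraMap_apply,
      map_mul]
    field_simp
  have hP : a * b ≠ 0 := by
    intro h0
    rw [h0, map_zero] at hr3
    exact mul_ne_zero hbE hr0 (pow_eq_zero_iff (two_ne_zero) |>.1 hr3)
  obtain ⟨s, q, hsq, hq⟩ := sq_sqfree _ (a * b) le_rfl hP
  have hs0 : s ≠ 0 := by rintro rfl; apply hP; rw [hsq]; simp
  have hq0 : q ≠ 0 := by rintro rfl; apply hP; rw [hsq]; simp
  have hsE : algebraMap k[X] E s ≠ 0 := fun h => hs0 (inj0 _ _ (by rw [h, map_zero]))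
  obtain ⟨r1, hr1eq⟩ : ∃ r1, r1 = algebraMap k[X] E b * r0 / algebraMap k[X] E s := ⟨_, rfl⟩
  have hr1sq : r1 ^ 2 = algebraMap k[X] E q := by
    rw [hr1eq, div_pow, hr3, hsq, map_mul, map_pow]; field_simp
  have hiq : i r1 * i r1 = aeval (HahnSeries.single (-e : ℤ) (1 : k)) q := by
    rw [← map_mul, ← sq, hr1sq, ← aeval_X_eq, ← aeval_algHom_apply, hi]
  have hlead : (aeval (HahnSeries.single (-e : ℤ) (1 : k)) q).leadingCoeff = q.leadingCoeff := by
    have ho := orderTop_aeval he (HahnSeries.orderTop_single (Γ := ℤ) (a := (-e : ℤ)) (one_ne_zero (α := k))) hq0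
    rw [HahnSeries.leadingCoeff_eq]
    have : (aeval (HahnSeries.single (-e : ℤ) (1 : k)) q).order = (-(e * q.natDegree : ℕ) : ℤ) := by
      refine WithTop.coe_injective ?_
      rw [HahnSeries.order_eq_orderTop_of_ne_zero, ho]
      intro h0
      rw [h0, HahnSeries.orderTop_zero] at ho
      exact WithTop.top_ne_coe ho
    rw [this]
    have := coeff_aeval_single e he q q.natDegree
    push_cast at this ⊢
    exact this
  obtain ⟨l, hl⟩ : ∃ l : k, l ^ 2 = q.leadingCoeff := by
    refine ⟨(i r1).leadingCoeff, ?_⟩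
    rw [← hlead, ← hiq, HahnSeries.leadingCoeff_mul, sq]
  have hl0 : l ≠ 0 := by
    rintro rfl
    rw [zero_pow two_ne_zero] at hl
    exact leadingCoeff_ne_zero.2 hq0 hl.symm
  have hrr : ∀ g : E ≃ₐ[F] E, g (algebraMap k[X] E (C l⁻¹) * r1) =
      algebraMap k[X] E (C l⁻¹) * (algebraMap k[X] E b * g r0 / algebraMap k[X] E s) := by
    intro g
    rw [hr1eq]
    simp only [map_mul, map_div₀, gal_k]
  have hrf : algebraMap k[X] E (C l⁻¹) * r1 ≠ 0 := by
    rw [algE, hr1eq]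
    refine mul_ne_zero ?_ (div_ne_zero (mul_ne_zero hbE hr0) hsE)
    rw [Ne, map_eq_zero]; exact inv_ne_zero hl0
  have hg1 : ∀ g ∈ M, g (algebraMap k[X] E (C l⁻¹) * r1) = algebraMap k[X] E (C l⁻¹) * r1 := by
    intro g hg; rw [hrr, hr1 g hg, hr1eq]
  have hg2 : ∀ g ∉ M, g (algebraMap k[X] E (C l⁻¹) * r1) ≠ algebraMap k[X] E (C l⁻¹) * r1 := by
    intro g hg h
    rw [hrr, hr2 g hg] at h
    have : 2 * (algebraMap k[X] E (C l⁻¹) * r1) = 0 := by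
      have h' := h
      rw [hr1eq] at h' ⊢
      linear_combination -h'
    exact mul_ne_zero h2E hrf this
  have hsq' : (algebraMap k[X] E (C l⁻¹) * r1) ^ 2 = algebraMap k[X] E (C (l⁻¹ ^ 2) * q) := by
    rw [mul_pow, hr1sq, map_mul, C_pow, map_pow]
  have hu : IsUnit (C (l⁻¹ ^ 2) : k[X]) := by
    rw [isUnit_C]; exact (pow_ne_zero 2 (inv_ne_zero hl0)).isUnit
  refine ⟨_, C (l⁻¹ ^ 2) * q, ?_, ?_, ?_, hsq', hg1, hg2⟩
  · rw [Monic, leadingCoeff_mul, leadingCoeff_C, ← hl]; field_simp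
  · exact ((associated_unit_mul_left q _ hu).squarefree_iff).2 hq
  · by_contra h0
    have hm : (C (l⁻¹ ^ 2) * q).Monic := by rw [Monic, leadingCoeff_mul, leadingCoeff_C, ← hl]; field_simp
    have h1 := eq_one_of_monic_natDegree_zero hm (by omega)
    rw [h1, map_one] at hsq'
    rcases sq_eq_one_iff.1 hsq' with h3 | h3
    · apply hg2 g0 hg0; rw [h3, map_one]
    · apply hg2 g0 hg0; rw [h3, map_neg, map_one]

end Setup
end QLC

namespace QLC
universe u

theorem vge_aeval {K : Type u} [Field K] {Y : HahnSeries ℤ K} (hY : Vge 0 Y) (P : K[X]) : Vge 0 (aeval Y P) := by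
  rw [aeval_eq_sum_range]
  exact Vge.sum fun j _ => ((hY.pow j).mono (by simp)).smul _

theorem order_simple {K : Type u} [Field K] (P : K[X]) (a : K) (h0 : P.eval a = 0)
    (h1 : P.derivative.eval a ≠ 0) (S : HahnSeries ℤ K) (hS : Vge 1 S) :
    (aeval (algebraMap K (HahnSeries ℤ K) a + S) P).orderTop = S.orderTop := by
  obtain ⟨m, hm⟩ := dvd_iff_isRoot.2 h0
  have hma : m.eval a ≠ 0 := by
    intro h
    apply h1
    rw [hm]; simp [h]
  have hY0 : Vge 0 (algebraMap K (HahnSeries ℤ K) a + S) := (vge_algebraMap a).add (hS.mono (by norm_num))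
  obtain ⟨m', hm'⟩ := dvd_iff_isRoot.2 (show (m - C (m.eval a)).IsRoot a by simp)
  have e1 : aeval (algebraMap K (HahnSeries ℤ K) a + S) P = S * aeval (algebraMap K (HahnSeries ℤ K) a + S) m := by
    conv_lhs => rw [hm]
    simp
  have e2 : aeval (algebraMap K (HahnSeries ℤ K) a + S) m =
      algebraMap K _ (m.eval a) + S * aeval (algebraMap K (HahnSeries ℤ K) a + S) m' := by
    have := congrArg (aeval (algebraMap K (HahnSeries ℤ K) a + S)) hm'
    simp at this
    linear_combination this
  have e3 : (aeval (algebraMap K (HahnSeries ℤ K) a + S) m).orderTop = ((0 : ℤ) : WithTop ℤ) := by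
    refine le_antisymm (HahnSeries.orderTop_le_of_coeff_ne_zero ?_) (vge_aeval hY0 m)
    have h3 : Vge 1 (S * aeval (algebraMap K (HahnSeries ℤ K) a + S) m') := by
      simpa using hS.mul (vge_aeval hY0 m')
    rw [e2, HahnSeries.coeff_add, coeff_alg, if_pos rfl, (vge_iff.1 h3) 0 (by norm_num), add_zero]
    exact hma
  rw [e1, HahnSeries.orderTop_mul, e3]
  simp

section Setup
variable {k F E : Type u} [Field k] [Field F] [Field E] [Algebra k[X] F]
    [IsFractionRing k[X] F] [Algebra F E] [Algebra k[X] E] [IsScalarTower k[X] F E] [Algebra k E]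
    [IsScalarTower k k[X] E] {c : k} {n : ℕ}

theorem aeval_tower' {K L : Type u} [Field K] [Field L] [Algebra k K] [Algebra k L] [Algebra K L]
    [IsScalarTower k K L] (Y : L) (P : k[X]) : aeval Y P = aeval Y (P.map (algebraMap k K)) := by
  rw [aeval_map_algebraMap]

variable (F) in
/-- Elements fixing all preimages of `v`. -/
noncomputable def NN (c : k) (n : ℕ) (v : E) : Subgroup (E ≃ₐ[F] E) :=
  (IntermediateField.adjoin F {z : E | it (algebraMap k E c) n z = v}).fixingSubgroup

theorem mem_NN {v : E} {g : E ≃ₐ[F] E} : g ∈ NN F c n v ↔ ∀ z, it (algebraMap k E c) n z = v → g z = z := by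
  rw [NN, IntermediateField.mem_fixingSubgroup_iff]
  exact IntermediateField.forall_mem_adjoin_smul_eq_self_iff F g

theorem root_PC [IsSplittingField F E (PP F (fi c (n + 1)) (X ^ 2 + C c))] [FiniteDimensional F E] [IsGalois F E]
    (h2 : (2 : k) ≠ 0) {K : Type u} [Field K] [IsAlgClosed K] [Algebra k K]
    [Algebra k (HahnSeries ℤ K)]
    (hT : ∀ x : k, algebraMap k (HahnSeries ℤ K) x = algebraMap K (HahnSeries ℤ K) (algebraMap k K x))
    (V : k[X]) (hV : V = X ∨ V = -X)
    (r : E) (q : k[X]) (hr : r ^ 2 = algebraMap k[X] E q)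
    (hfix : ∀ g ∈ NN F c n (algebraMap k[X] E V), g r = r)
    (a : K) (ha : aeval a q = 0) (ha' : aeval a (derivative q) ≠ 0) :
    ∃ i, 1 ≤ i ∧ i ≤ n ∧ aeval a V = algebraMap k K (it c i 0) := by
  by_contra hcon
  push Not at hcon
  have tw := IsScalarTower.of_algebraMap_eq hT
  have h2K : (2 : K) ≠ 0 := by
    rw [← map_ofNat (algebraMap k K) 2, Ne, map_eq_zero]; exact h2
  let Ω := AlgebraicClosure (HahnSeries ℤ K)
  let Y : (HahnSeries ℤ K) := algebraMap K (HahnSeries ℤ K) a + HahnSeries.single 1 1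
  have hS : Vge 1 (HahnSeries.single (1 : ℤ) (1 : K)) := by
    unfold Vge; rw [HahnSeries.orderTop_single one_ne_zero]
  have hYv : Vge 0 Y := (vge_algebraMap a).add (hS.mono (by norm_num))
  have hY0 : Y.coeff 0 = a := by
    change (algebraMap K (HahnSeries ℤ K) a + _).coeff 0 = a
    rw [HahnSeries.coeff_add, coeff_alg, if_pos rfl, vge_iff.1 hS 0 (by norm_num), add_zero]
  have hY1 : Y.coeff 1 = 1 := by
    change (algebraMap K (HahnSeries ℤ K) a + _).coeff 1 = 1
    rw [HahnSeries.coeff_add, coeff_alg, if_neg (by norm_num), HahnSeries.coeff_single_same, zero_add]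
  have hYinj : Function.Injective (aeval Y : k[X] →ₐ[k] (HahnSeries ℤ K)) := by
    refine alg_const (K := K) Y fun b hb => ?_
    have := congrArg (fun x : HahnSeries ℤ K => x.coeff 1) hb
    simp only [hY1] at this
    erw [coeff_alg] at this
    simp at this
  have hcL : algebraMap k (HahnSeries ℤ K) c = algebraMap K (HahnSeries ℤ K) (algebraMap k K c) := IsScalarTower.algebraMap_apply k K (HahnSeries ℤ K) c
  have hspl : Spl (algebraMap k (HahnSeries ℤ K) c) n (aeval Y V) := by
    rw [hcL]
    refine spl_unr h2K _ n _ ?_ ?_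
    · rcases hV with rfl | rfl
      · simpa using hYv
      · simpa using hYv.neg
    · intro i h1 h3 h4
      apply hcon i h1 h3
      rw [it_map, map_zero, ← h4]
      rcases hV with rfl | rfl
      · simp [hY0]
      · rw [map_neg, map_neg, aeval_X, aeval_X, HahnSeries.coeff_neg, hY0]
  have hs := Spl.splits _ _ _ hspl
  obtain ⟨i, hi⟩ := exists_emb (F := F) (E := E) (Q := fi c (n + 1)) (w := X ^ 2 + C c) (L := Ω) (algebraMap (HahnSeries ℤ K) Ω Y) (by
      have : (aeval (algebraMap (HahnSeries ℤ K) Ω Y) : k[X] → Ω) = algebraMap (HahnSeries ℤ K) Ω ∘ (aeval Y : k[X] → (HahnSeries ℤ K)) := by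
        ext P
        rw [aeval_algebraMap_apply]; rfl
      change Function.Injective (aeval (algebraMap (HahnSeries ℤ K) Ω Y) : k[X] → Ω)
      rw [this]
      exact (algebraMap (HahnSeries ℤ K) Ω).injective.comp hYinj) (IsAlgClosed.splits _)
  have hiP : ∀ P : k[X], i (algebraMap k[X] E P) = algebraMap (HahnSeries ℤ K) Ω (aeval Y P) := by
    intro P
    rw [← aeval_X_eq, ← aeval_algHom_apply, hi, aeval_algebraMap_apply]
  have hmem : ∀ x ∈ IntermediateField.adjoin F {z : E | it (algebraMap k E c) n z = algebraMap k[X] E V},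
      i x ∈ (algebraMap (HahnSeries ℤ K) Ω).range := by
    intro x hx
    induction hx using IntermediateField.adjoin_induction with
    | mem z hz =>
      change it _ _ _ = _ at hz
      refine hs.mem_range_of_isRoot (half_monic _ _).ne_zero ?_
      rw [IsRoot.def, Polynomial.map_sub, fi_map, map_C, eval_sub, eval_C, fi_eval, ← hiP, ← hz,
        ← IsScalarTower.algebraMap_apply]
      have := it_map (algebraMap k E c) (i : E →+* Ω) n z
      simp only [RingHom.coe_coe, AlgHom.commutes] at this
      rw [this, sub_self]
    | algebraMap f =>
      obtain ⟨b, d, hd, rfl⟩ := IsFractionRing.div_surjective (A := k[X]) f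
      rw [map_div₀, map_div₀, ← IsScalarTower.algebraMap_apply, ← IsScalarTower.algebraMap_apply, hiP, hiP]
      exact ⟨aeval Y b / aeval Y d, map_div₀ _ _ _⟩
    | add x y _ _ hx hy => rw [map_add]; exact add_mem hx hy
    | inv x _ hx =>
      obtain ⟨u, hu⟩ := hx
      exact ⟨u⁻¹, by rw [map_inv₀, map_inv₀, hu]⟩
    | mul x y _ _ hx hy => rw [map_mul]; exact mul_mem hx hy
  have hrm : r ∈ IntermediateField.adjoin F {z : E | it (algebraMap k E c) n z = algebraMap k[X] E V} := by
    rw [← IsGalois.fixedField_fixingSubgroup (IntermediateField.adjoin F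
      {z : E | it (algebraMap k E c) n z = algebraMap k[X] E V})]
    rintro ⟨g, hg⟩
    exact hfix g hg
  obtain ⟨s, hs'⟩ := hmem r hrm
  have hs2 : s * s = aeval Y (q.map (algebraMap k K)) := by
    apply (algebraMap (HahnSeries ℤ K) Ω).injective
    rw [map_mul, hs', ← map_mul, ← sq, hr, hiP, aeval_map_algebraMap]
  have ho := order_simple (q.map (algebraMap k K)) a (by rw [eval_map_algebraMap, ha])
    (by rw [derivative_map, eval_map_algebraMap]; exact ha') (HahnSeries.single 1 1) hS
  have ho' : (s * s).orderTop = ((1 : ℤ) : WithTop ℤ) := by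
    rw [hs2]
    refine Eq.trans ho ?_
    rw [HahnSeries.orderTop_single one_ne_zero]
  have hs0 : s ≠ 0 := by
    rintro rfl
    rw [mul_zero, HahnSeries.orderTop_zero] at ho'
    exact WithTop.top_ne_coe ho'
  obtain ⟨t, ht⟩ := exists_orderTop hs0
  rw [HahnSeries.orderTop_mul, ht, ← WithTop.coe_add] at ho'
  have := WithTop.coe_injective ho'
  omega

theorem even_deg (h2 : (2 : k) ≠ 0) {ζ : kˣ} (hζ : (ζ : k) ^ 2 ^ n = -1) (i : E →ₐ[k] HahnSeries ℤ k)
    (hi : i (algebraMap k[X] E X) = HahnSeries.single (-(2 ^ n : ℕ) : ℤ) 1)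
    {α : E ≃ₐ[k] E} (hα : ∀ x, i (α x) = sig ζ (i x))
    {ρ : E ≃ₐ[F] E} (hρ : ∀ x, ρ x = α (α x)) (r : E) (q : k[X]) (hq : q ≠ 0) (hr : r ^ 2 = algebraMap k[X] E q)
    (hfix : ρ r = r) : Even q.natDegree := by
  have ho := orderTop_aeval (e := 2 ^ n) (by positivity)
    (HahnSeries.orderTop_single (Γ := ℤ) (a := (-(2 ^ n : ℕ) : ℤ)) (one_ne_zero (α := k))) hq
  rw [← hi, aeval_algHom_apply, aeval_X_eq, ← hr, sq, map_mul] at ho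
  have hs0 : i r ≠ 0 := by
    intro h
    rw [h, mul_zero, HahnSeries.orderTop_zero] at ho
    exact WithTop.top_ne_coe ho
  obtain ⟨t, ht⟩ := exists_orderTop hs0
  rw [HahnSeries.orderTop_mul, ht, ← WithTop.coe_add] at ho
  have ho := WithTop.coe_injective ho
  have h5 := rho_coeff i hα hρ 1 r t
  rw [pow_one, hfix] at h5
  have h6 := HahnSeries.coeff_orderTop_ne ht
  have h7 : ((ζ ^ (2 * (1 : ℕ) * t : ℤ) : kˣ) : k) = 1 := by
    refine mul_right_cancel₀ h6 ?_
    rw [one_mul]; exact h5.symm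
  rw [show (2 * ((1 : ℕ) : ℤ) * t) = -((2 ^ n * q.natDegree : ℕ) : ℤ) by rw [← ho]; push_cast; ring, zpow_neg,
    zpow_natCast, pow_mul, Units.val_inv_eq_inv_val, inv_eq_one, Units.val_pow_eq_pow_val, Units.val_pow_eq_pow_val,
    hζ] at h7
  by_contra hodd
  rw [Nat.not_even_iff_odd] at hodd
  rw [hodd.neg_one_pow] at h7
  apply h2
  linear_combination -h7

theorem exists_b [IsSplittingField F E (PP F (fi c (n + 1)) (X ^ 2 + C c))]
    (h2 : (2 : k) ≠ 0) {K : Type u} [Field K] [IsAlgClosed K] [Algebra k K]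
    [Algebra k (HahnSeries ℤ K)]
    (hT : ∀ x : k, algebraMap k (HahnSeries ℤ K) x = algebraMap K (HahnSeries ℤ K) (algebraMap k K x))
    (hn : ∀ i, 1 ≤ i → i ≤ n → it c i 0 ≠ 0) (κ : k) :
    ∃ b : E ≃ₐ[F] E, b * b = 1 ∧ ∀ (r : E) (q : k[X]), r ^ 2 = algebraMap k[X] E q → q.eval κ = 0 →
      (derivative q).eval κ ≠ 0 → b r ≠ r := by
  have tw := IsScalarTower.of_algebraMap_eq hT
  have h2K : (2 : K) ≠ 0 := by
    rw [← map_ofNat (algebraMap k K) 2, Ne, map_eq_zero]; exact h2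
  let Y : (HahnSeries ℤ K) := algebraMap K (HahnSeries ℤ K) (algebraMap k K κ) + HahnSeries.single 2 1
  have hS : Vge 1 (HahnSeries.single (2 : ℤ) (1 : K)) := by
    unfold Vge; rw [HahnSeries.orderTop_single one_ne_zero]; exact WithTop.coe_le_coe.2 (by norm_num)
  have hnK : ∀ i, 1 ≤ i → i ≤ n → it (algebraMap k K c) i 0 ≠ 0 := by
    intro i h1 h3 h4
    apply hn i h1 h3
    rw [← map_zero (algebraMap k K), ← it_map] at h4
    exact (algebraMap k K).injective h4
  have hY2 : Y.coeff 2 = 1 := by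
    change (algebraMap K (HahnSeries ℤ K) _ + _).coeff 2 = 1
    rw [HahnSeries.coeff_add, coeff_alg, if_neg (by norm_num), HahnSeries.coeff_single_same, zero_add]
  have hYinj : Function.Injective (aeval Y : k[X] →ₐ[k] (HahnSeries ℤ K)) := by
    refine alg_const (K := K) Y fun b hb => ?_
    have := congrArg (fun x : HahnSeries ℤ K => x.coeff 2) hb
    simp only [hY2] at this
    erw [coeff_alg] at this
    simp at this
  have hcL : algebraMap k (HahnSeries ℤ K) c = algebraMap K (HahnSeries ℤ K) (algebraMap k K c) := IsScalarTower.algebraMap_apply k K (HahnSeries ℤ K) c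
  have hone : (HahnSeries.single (2 : ℤ) (1 : K)).orderTop = ((2 : ℤ) : WithTop ℤ) :=
    HahnSeries.orderTop_single one_ne_zero
  obtain ⟨Φ, hΦ⟩ := emb_of_spl (F := F) (E := E) (c := c) (n := n) (L := HahnSeries ℤ K) Y hYinj
    (by
      rw [hcL]
      refine spl_ram h2K _ n hnK _ (algebraMap k K κ) ?_
      rw [← hone]; congr 1
      change algebraMap K (HahnSeries ℤ K) (algebraMap k K κ) + HahnSeries.single 2 1 - algebraMap K (HahnSeries ℤ K) (algebraMap k K κ) = _
      rw [add_sub_cancel_left])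
    (by
      rw [hcL]
      refine spl_ram h2K _ n hnK _ (-algebraMap k K κ) ?_
      rw [← hone, ← HahnSeries.orderTop_neg]; congr 1
      change -(-(algebraMap K (HahnSeries ℤ K) (algebraMap k K κ) + HahnSeries.single 2 1) - algebraMap K (HahnSeries ℤ K) (-algebraMap k K κ)) = _
      rw [map_neg]; ring)
  let σ : (HahnSeries ℤ K) →ₐ[k] (HahnSeries ℤ K) := (AlgEquiv.restrictScalars k (sig (-1 : Kˣ)) : (HahnSeries ℤ K) ≃ₐ[k] (HahnSeries ℤ K))
  have hσ : ∀ (x : (HahnSeries ℤ K)) j, (σ x).coeff j = (((-1 : Kˣ) ^ j : Kˣ) : K) * x.coeff j := fun x j => sig_coeff _ x j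
  have hσY : σ Y = Y := by
    have e1 : σ (algebraMap K (HahnSeries ℤ K) (algebraMap k K κ)) = algebraMap K (HahnSeries ℤ K) (algebraMap k K κ) :=
      (sig (-1 : Kˣ)).commutes _
    have e2 : σ (HahnSeries.single 2 1) = HahnSeries.single (2 : ℤ) (1 : K) := by
      change sig (-1 : Kˣ) _ = _
      rw [sig_single]; simp
    change σ (algebraMap K (HahnSeries ℤ K) (algebraMap k K κ) + HahnSeries.single 2 1) = _
    rw [map_add, e1, e2]
  have hσσ : ∀ x, σ (σ x) = x := by
    intro x
    ext j
    rw [hσ, hσ, ← mul_assoc, ← Units.val_mul, ← mul_zpow]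
    simp
  have hΦP : ∀ P : k[X], Φ (algebraMap k[X] E P) = aeval Y P := by
    intro P
    rw [← aeval_X_eq, ← aeval_algHom_apply, hΦ]
  have hσP : ∀ P : k[X], (σ.comp Φ) (algebraMap k[X] E P) = Φ (algebraMap k[X] E P) := by
    intro P
    rw [AlgHom.comp_apply, hΦP, ← aeval_algHom_apply, hσY]
  obtain ⟨β, hβ⟩ := exists_transfer (F := F) (Q := fi c (n + 1)) (w := X ^ 2 + C c) (fi_hQ c n).1 (fi_hQ c n).2
    Φ (σ.comp Φ) (hσP _).symm ⟨_, (hσP _).symm⟩ ⟨_, hσP _⟩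
  have inj : ∀ a b, Φ a = Φ b → a = b := fun a b h => Φ.injective h
  obtain ⟨b, hb⟩ := exists_gal (F := F) β (by apply inj _ _; rw [hβ, hσP])
  refine ⟨b, ?_, ?_⟩
  · ext x
    apply inj _ _
    rw [AlgEquiv.mul_apply, hb, hb, hβ, AlgHom.comp_apply, hβ, AlgHom.comp_apply, hσσ]
    rfl
  · intro r q hr hq0 hq1 hbr
    have hr2 : Φ r * Φ r = aeval Y (q.map (algebraMap k K)) := by
      rw [← map_mul, ← sq, hr, hΦP, aeval_map_algebraMap]
    have ho := order_simple (q.map (algebraMap k K)) (algebraMap k K κ)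
      (by rw [eval_map_algebraMap, aeval_algebraMap_apply, ← coe_aeval_eq_eval] at *; simp [hq0])
      (by rw [derivative_map, eval_map_algebraMap, aeval_algebraMap_apply]
          rw [coe_aeval_eq_eval, Ne, map_eq_zero]; exact hq1) (HahnSeries.single 2 1) hS
    have ho' : (Φ r * Φ r).orderTop = ((2 : ℤ) : WithTop ℤ) := by
      rw [hr2]; exact ho.trans hone
    have hs0 : Φ r ≠ 0 := by
      intro h
      rw [h, mul_zero, HahnSeries.orderTop_zero] at ho'
      exact WithTop.top_ne_coe ho'
    obtain ⟨t, ht⟩ := exists_orderTop hs0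
    rw [HahnSeries.orderTop_mul, ht, ← WithTop.coe_add] at ho'
    have ht1 : t = 1 := by have := WithTop.coe_injective ho'; omega
    subst ht1
    have h6 := HahnSeries.coeff_orderTop_ne ht
    have h7 := hσ (Φ r) 1
    rw [← AlgHom.comp_apply, ← hβ, ← hb, hbr] at h7
    simp at h7
    have : (2 : K) * (Φ r).coeff 1 = 0 := by linear_combination h7
    exact mul_ne_zero h2K h6 this

end Setup
end QLC

namespace QLC
universe u

/-- Membership in the truncated critical orbit. -/
def PCn {k : Type u} [Field k] (c : k) (n : ℕ) (x : k) : Prop := ∃ i, 1 ≤ i ∧ i ≤ n ∧ x = it c i 0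

theorem pc_comb {k : Type u} [Field k] (h2 : (2 : k) ≠ 0) (c : k) {i j : ℕ} (hi : 1 ≤ i) (hj : 1 ≤ j)
    (hij : it c i 0 = - it c j 0) (h0 : it c i 0 ≠ 0) :
    (∀ m, 1 ≤ m → it c m 0 ≠ 0) ∧ ∀ i' j', 1 ≤ i' → 1 ≤ j' → it c i' 0 = - it c j' 0 →
      it c i' 0 = it c i 0 ∨ it c i' 0 = - it c i 0 := by
  let f : k → k := fun x => x ^ 2 + c
  have hit : ∀ n x, it c n x = f^[n] x := it_eq_iterate c
  let P : k → Prop := fun x => ∃ p, 0 < p ∧ Function.IsPeriodicPt f p x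
  have hP : ∀ a b, a < b → it c a 0 = it c b 0 → ∀ m, a ≤ m → P (it c m 0) := by
    intro a b hab h m hm
    refine ⟨b - a, by omega, ?_⟩
    change f^[b - a] _ = _
    rw [← hit, ← it_add, show b - a + m = (m - a) + b by omega, it_add, ← h, ← it_add]
    congr 1; omega
  -- unique last nonperiodic index
  have key : ∀ a b, 1 ≤ a → a < b → it c a 0 = - it c b 0 → it c a 0 ≠ 0 → ¬ P (it c a 0) ∧ ∀ m, a + 1 ≤ m → P (it c m 0) := by
    intro a b _ hab h hne
    have h1 : it c (a + 1) 0 = it c (b + 1) 0 := by rw [it_succ, it_succ, h, neg_sq]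
    have h3 := hP (a + 1) (b + 1) (by omega) h1
    refine ⟨?_, h3⟩
    rintro ⟨p, hp, hpp⟩
    obtain ⟨p', hp', hpp'⟩ := h3 b (by omega)
    have := hpp.eq_of_apply_eq hpp' hp hp' h1
    apply hne
    rw [this] at h ⊢
    have : 2 * it c b 0 = 0 := by linear_combination h
    exact (mul_eq_zero.1 this).resolve_left h2
  have hne_idx : ∀ a b, it c a 0 = - it c b 0 → it c a 0 ≠ 0 → a ≠ b := by
    rintro a b h hne rfl
    apply hne
    have : 2 * it c a 0 = 0 := by linear_combination h
    exact (mul_eq_zero.1 this).resolve_left h2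
  -- normalize
  have norm : ∀ a b, 1 ≤ a → 1 ≤ b → it c a 0 = - it c b 0 → it c a 0 ≠ 0 → ∃ a', 1 ≤ a' ∧
      (it c a' 0 = it c a 0 ∨ it c a' 0 = - it c a 0) ∧ ¬ P (it c a' 0) ∧ ∀ m, a' + 1 ≤ m → P (it c m 0) := by
    intro a b ha hb h hne
    rcases lt_trichotomy a b with hab | hab | hab
    · exact ⟨a, ha, Or.inl rfl, key a b ha hab h hne⟩
    · exact absurd hab (hne_idx a b h hne)
    · have h' : it c b 0 = - it c a 0 := by rw [h, neg_neg]
      refine ⟨b, hb, Or.inr h', key b a hb hab h' ?_⟩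
      rw [h']; exact neg_ne_zero.2 hne
  obtain ⟨a, ha, hai, hnp, hper⟩ := norm i j hi hj hij h0
  have hz : ∀ m, 1 ≤ m → it c m 0 ≠ 0 := by
    intro m hm h
    apply hnp
    refine hP 1 (m + 1) (by omega) ?_ a ha
    rw [it_succ, it_succ, h, it_zero]
  refine ⟨hz, ?_⟩
  intro i' j' hi' hj' h
  obtain ⟨a', ha', hai', hnp', hper'⟩ := norm i' j' hi' hj' h (hz _ hi')
  have haa : a = a' := by
    rcases lt_trichotomy a a' with h3 | h3 | h3
    · exact absurd (hper a' h3) hnp'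
    · exact h3
    · exact absurd (hper' a h3) hnp
  subst haa
  rcases hai with h3 | h3 <;> rcases hai' with h4 | h4
  · left; rw [← h4, h3]
  · right; rw [← h3, h4, neg_neg]
  · right; rw [← h3, h4]
  · left; rw [h3] at h4; exact (neg_injective h4).symm

section Setup
variable {k F E : Type u} [Field k] [Field F] [Field E] [Algebra k[X] F]
    [IsFractionRing k[X] F] [Algebra F E] [Algebra k[X] E] [IsScalarTower k[X] F E] [Algebra k E]
    [IsScalarTower k k[X] E] {c : k} {n : ℕ}

theorem gal_it (g : E ≃ₐ[F] E) (j : ℕ) (z : E) :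
    g (it (algebraMap k E c) j z) = it (algebraMap k E c) j (g z) := by
  have := it_map (algebraMap k E c) (g : E →+* E) j z
  simp only [RingHom.coe_coe] at this
  rw [this, ← algE, gal_k]

instance NN_normal (V : k[X]) : (NN F c n (algebraMap k[X] E V)).Normal := by
  refine ⟨fun g hg h => ?_⟩
  rw [mem_NN] at hg ⊢
  intro z hz
  have := hg (h⁻¹ z) (by rw [← gal_it, hz, gal_k])
  rw [AlgEquiv.mul_apply, AlgEquiv.mul_apply, this, ← AlgEquiv.mul_apply, mul_inv_cancel, AlgEquiv.one_apply]

theorem sqrt_of_index [Finite k] [IsSplittingField F E (PP F (fi c (n + 1)) (X ^ 2 + C c))] [FiniteDimensional F E]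
    [IsGalois F E] (h2 : (2 : k) ≠ 0) (i : E →ₐ[k] HahnSeries ℤ k)
    {e : ℕ} (he : 0 < e) (hi : i (algebraMap k[X] E X) = HahnSeries.single (-e : ℤ) 1)
    (M : Subgroup (E ≃ₐ[F] E)) (hM : M.index = 2) (hN1 : NN F c n (algebraMap k[X] E X) ≤ M)
    (hN2 : NN F c n (algebraMap k[X] E (-X)) ≤ M) :
    ∃ (r : E) (q : k[X]), q.Monic ∧ 0 < q.natDegree ∧ r ^ 2 = algebraMap k[X] E q ∧
      (∀ g ∈ M, g r = r) ∧ (∀ g ∉ M, g r ≠ r) ∧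
      ∃ s : Finset k, s.card = q.natDegree ∧ ∀ a ∈ s, q.eval a = 0 ∧ (derivative q).eval a ≠ 0 ∧
        PCn c n a ∧ PCn c n (-a) := by
  obtain ⟨r, q, hq, hsq, hdeg, hr, hg1, hg2⟩ := index_two_sqrt h2 i he hi M hM
  refine ⟨r, q, hq, hdeg, hr, hg1, hg2, ?_⟩
  have hsep : q.Separable := PerfectField.separable_iff_squarefree.2 hsq
  let K := AlgebraicClosure k
  let := ((algebraMap K (HahnSeries ℤ K)).comp (algebraMap k K)).toAlgebra
  have hT : ∀ x : k, algebraMap k (HahnSeries ℤ K) x = algebraMap K (HahnSeries ℤ K) (algebraMap k K x) :=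
    fun x => rfl
  have hroot : ∀ a : K, aeval a q = 0 → ∃ b : k, a = algebraMap k K b ∧ PCn c n b ∧ PCn c n (-b) := by
    intro a ha
    have hd := hsep.aeval_derivative_ne_zero ha
    obtain ⟨j, hj1, hj2, hj3⟩ := root_PC (F := F) h2 hT X (Or.inl rfl) r q hr (fun g hg => hg1 g (hN1 hg)) a ha hd
    obtain ⟨l, hl1, hl2, hl3⟩ := root_PC (F := F) h2 hT (-X) (Or.inr rfl) r q hr (fun g hg => hg1 g (hN2 hg)) a ha hd
    rw [aeval_X] at hj3
    rw [map_neg, aeval_X, hj3, ← map_neg] at hl3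
    exact ⟨_, hj3, ⟨j, hj1, hj2, rfl⟩, l, hl1, hl2, (algebraMap k K).injective hl3⟩
  have hspl : q.Splits := by
    have h3 := IsAlgClosed.splits (q.map (algebraMap k K))
    refine Splits.of_splits_map_of_injective (i := algebraMap k K) (algebraMap k K).injective h3 ?_
    intro a ha
    rw [mem_roots (Polynomial.map_ne_zero hq.ne_zero), IsRoot.def, eval_map_algebraMap] at ha
    obtain ⟨b, hb, _⟩ := hroot a ha
    exact ⟨b, hb.symm⟩
  classical
  refine ⟨q.roots.toFinset, ?_, ?_⟩
  · rw [Multiset.toFinset_card_of_nodup (nodup_roots hsep), hspl.natDegree_eq_card_roots]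
  · intro a ha
    rw [Multiset.mem_toFinset, mem_roots hq.ne_zero, IsRoot.def] at ha
    refine ⟨ha, ?_, ?_⟩
    · have := hsep.aeval_derivative_ne_zero (x := a) (by rw [coe_aeval_eq_eval]; exact ha)
      rwa [coe_aeval_eq_eval] at this
    · obtain ⟨b, hb, h3⟩ := hroot (algebraMap k K a) (by
        rw [aeval_algebraMap_apply, coe_aeval_eq_eval, ha, map_zero])
      rwa [← (algebraMap k K).injective hb] at h3

theorem star [Finite k] [IsSplittingField F E (PP F (fi c (n + 1)) (X ^ 2 + C c))] [FiniteDimensional F E]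
    [IsGalois F E] (h2 : (2 : k) ≠ 0) {ζ : kˣ} (hζ : (ζ : k) ^ 2 ^ n = -1) (i : E →ₐ[k] HahnSeries ℤ k)
    (hi : i (algebraMap k[X] E X) = HahnSeries.single (-(2 ^ n : ℕ) : ℤ) 1)
    {α : E ≃ₐ[k] E} (hα : ∀ x, i (α x) = sig ζ (i x))
    {ρ : E ≃ₐ[F] E} (hρ : ∀ x, ρ x = α (α x)) :
    let H := (NN F c n (algebraMap k[X] E X) ⊔ NN F c n (algebraMap k[X] E (-X))) ⊔ Subgroup.zpowers ρ
    H = ⊤ ∨ ∃ κ : k, κ ≠ 0 ∧ PCn c n κ ∧ PCn c n (-κ) ∧ ∃ r : E, r ^ 2 = algebraMap k[X] E (X ^ 2 - C (κ ^ 2)) ∧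
      ∀ g, g ∈ H ↔ g r = r := by
  intro H
  by_cases hH : H = ⊤
  · exact Or.inl hH
  right
  have he : 0 < 2 ^ n := by positivity
  obtain ⟨M, hM, hHM⟩ := exists_index_two (pgroup (F := F) (c := c) (n := n)) H hH
  have hN1 : NN F c n (algebraMap k[X] E X) ≤ H := le_sup_left.trans le_sup_left
  have hN2 : NN F c n (algebraMap k[X] E (-X)) ≤ H := le_sup_right.trans le_sup_left
  have hρH : ρ ∈ H := (le_sup_right : _ ≤ H) (Subgroup.mem_zpowers ρ)
  have hev : ∀ (r : E) (q : k[X]), q.Monic → r ^ 2 = algebraMap k[X] E q → ρ r = r → Even q.natDegree :=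
    fun r q hq hr hf => even_deg h2 hζ i hi hα hρ r q hq.ne_zero hr hf
  obtain ⟨r, q, hq, hdeg, hr, hg1, hg2, s, hs, hsr⟩ := sqrt_of_index (F := F) (c := c) (n := n) h2 i he hi M hM
    (hN1.trans hHM) (hN2.trans hHM)
  have hq2 : 2 ≤ s.card := by
    rw [hs]
    obtain ⟨m, hm⟩ := hev r q hq hr (hg1 _ (hHM hρH))
    omega
  -- a nonzero root
  obtain ⟨κ, hκs, hκ0⟩ : ∃ κ ∈ s, κ ≠ 0 := by
    obtain ⟨a, ha, b, hb, hab⟩ := Finset.one_lt_card.1 (show 1 < s.card by omega)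
    by_cases h0 : a = 0
    · exact ⟨b, hb, fun h => hab (by rw [h0, h])⟩
    · exact ⟨a, ha, h0⟩
  obtain ⟨_, _, ⟨j, hj1, hj2, hj3⟩, l, hl1, hl2, hl3⟩ := hsr κ hκs
  have hcomb := pc_comb h2 c hj1 hl1 (by rw [← hj3, ← hl3, neg_neg]) (by rw [← hj3]; exact hκ0)
  rw [← hj3] at hcomb
  have hnk : κ ≠ -κ := by
    intro h
    have : 2 * κ = 0 := by linear_combination h
    exact mul_ne_zero h2 hκ0 this
  have hPC2 : ∀ a, PCn c n a → PCn c n (-a) → a = κ ∨ a = -κ := by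
    rintro a ⟨u, hu1, hu2, hu3⟩ ⟨v, hv1, hv2, hv3⟩
    rw [hu3]
    exact hcomb.2 u v hu1 hv1 (by rw [← hu3, ← hv3, neg_neg])
  classical
  have hsub : ∀ t : Finset k, (∀ a ∈ t, PCn c n a ∧ PCn c n (-a)) → t ⊆ {κ, -κ} := by
    intro t ht a ha
    rw [Finset.mem_insert, Finset.mem_singleton]
    exact hPC2 a (ht a ha).1 (ht a ha).2
  have hcard : ({κ, -κ} : Finset k).card = 2 := Finset.card_pair hnk
  have hfull : ∀ t : Finset k, (∀ a ∈ t, PCn c n a ∧ PCn c n (-a)) → 2 ≤ t.card → t = {κ, -κ} := by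
    intro t ht h3
    exact Finset.eq_of_subset_of_card_le (hsub t ht) (by rw [hcard]; exact h3)
  have hseq : s = {κ, -κ} := hfull s (fun a ha => (hsr a ha).2.2) hq2
  have hκs' : -κ ∈ s := by rw [hseq]; simp
  have hqd : q.natDegree = 2 := by rw [← hs, hseq, hcard]
  have hqeq : q = X ^ 2 - C (κ ^ 2) := by
    refine eq_of_degree_sub_lt_of_eval_finset_eq s ?_ ?_
    · have hm : (X ^ 2 - C (κ ^ 2) : k[X]).Monic := monic_X_pow_sub_C _ two_ne_zero
      have hd : (X ^ 2 - C (κ ^ 2) : k[X]).natDegree = 2 := natDegree_X_pow_sub_C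
      have h3 := degree_sub_lt (p := q) (q := X ^ 2 - C (κ ^ 2))
        (by rw [degree_eq_natDegree hq.ne_zero, degree_eq_natDegree hm.ne_zero, hd, hqd]) hq.ne_zero
        (by rw [hq.leadingCoeff, hm.leadingCoeff])
      rw [degree_eq_natDegree hq.ne_zero] at h3
      rw [hs]; exact h3
    · intro a ha
      rw [(hsr a ha).1]
      rw [hseq, Finset.mem_insert, Finset.mem_singleton] at ha
      rcases ha with rfl | rfl <;> simp
  have hMg : ∀ g, g ∈ M ↔ g r = r := fun g => ⟨hg1 g, fun h => by by_contra h'; exact hg2 g h' h⟩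
  refine ⟨κ, hκ0, ⟨j, hj1, hj2, hj3⟩, ⟨l, hl1, hl2, hl3⟩, r, by rw [hr, hqeq], ?_⟩
  let K := AlgebraicClosure k
  let := ((algebraMap K (HahnSeries ℤ K)).comp (algebraMap k K)).toAlgebra
  have hT : ∀ x : k, algebraMap k (HahnSeries ℤ K) x = algebraMap K (HahnSeries ℤ K) (algebraMap k K x) :=
    fun x => rfl
  obtain ⟨b, hb2, hb⟩ := exists_b (F := F) (E := E) (c := c) (n := n) h2 hT (fun m hm _ => hcomb.1 m hm) κ
  obtain ⟨b', hb2', hb'⟩ := exists_b (F := F) (E := E) (c := c) (n := n) h2 hT (fun m hm _ => hcomb.1 m hm) (-κ)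
  have hHeq : H = M := by
    refine group_one (pgroup (F := F) (c := c) (n := n)) _ M hM (le_sup_left.trans hHM) ρ b b' (hHM hρH) ?_ ?_ ?_ ?_ ?_ ?_
    · rw [hMg]; exact hb r q hr (hsr κ hκs).1 (hsr κ hκs).2.1
    · rw [hMg]; exact hb' r q hr (hsr _ hκs').1 (hsr _ hκs').2.1
    · rw [sq, hb2]; exact one_mem _
    · rw [sq, hb2']; exact one_mem _
    · intro L hL hNL hbL hbL'
      obtain ⟨r1, q1, hq1, hdeg1, hr1, hg11, hg12, s1, hs1, hsr1⟩ := sqrt_of_index (F := F) (c := c) (n := n)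
        h2 i he hi L hL (le_sup_left.trans hNL) (le_sup_right.trans hNL)
      obtain ⟨a, ha⟩ := Finset.card_pos.1 (by rw [hs1]; exact hdeg1 : 0 < s1.card)
      obtain ⟨h3, h4, h5, h6⟩ := hsr1 a ha
      rcases hPC2 a h5 h6 with rfl | rfl
      · exact hb r1 q1 hr1 h3 h4 (hg11 b hbL)
      · exact hb' r1 q1 hr1 h3 h4 (hg11 b' hbL')
    · intro L hL hNL hρL hbL
      obtain ⟨r1, q1, hq1, hdeg1, hr1, hg11, hg12, s1, hs1, hsr1⟩ := sqrt_of_index (F := F) (c := c) (n := n)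
        h2 i he hi L hL (le_sup_left.trans hNL) (le_sup_right.trans hNL)
      have h7 := hfull s1 (fun a ha => (hsr1 a ha).2.2) (by
        rw [hs1]
        obtain ⟨m, hm⟩ := hev r1 q1 hq1 hr1 (hg11 _ hρL)
        omega)
      have h8 : κ ∈ s1 := by rw [h7]; simp
      exact hb r1 q1 hr1 (hsr1 κ h8).1 (hsr1 κ h8).2.1 (hg11 b hbL)
  intro g
  rw [hHeq, hMg]

end Setup
end QLC

namespace QLC
universe u

/-- Elements fixed by the `q`-Frobenius lie in `k`. -/
theorem frob_range {k Ω : Type u} [Field k] [Finite k] [Field Ω] [Algebra k Ω] (x : Ω) (h : x ^ Nat.card k = x) :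
    ∃ a : k, algebraMap k Ω a = x := by
  classical
  have := Fintype.ofFinite k
  have hP : (X ^ Fintype.card k - X : k[X]) = ∏ a : k, (X - C a) := by
    have hm : (X ^ Fintype.card k - X : k[X]).Monic :=
      monic_X_pow_sub (by rw [degree_X]; exact_mod_cast Fintype.one_lt_card)
    have := prod_multiset_X_sub_C_of_monic_of_roots_card_eq hm
      (by rw [FiniteField.roots_X_pow_card_sub_X, FiniteField.X_pow_card_sub_X_natDegree_eq k Fintype.one_lt_card]; rfl)
    rw [FiniteField.roots_X_pow_card_sub_X] at this
    exact this.symm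
  have := congrArg (fun P : k[X] => aeval x P) hP
  simp only [map_sub, map_pow, aeval_X, map_prod, aeval_C] at this
  rw [← Nat.card_eq_fintype_card, h, sub_self] at this
  obtain ⟨a, _, ha⟩ := Finset.prod_eq_zero_iff.1 this.symm
  exact ⟨a, (sub_eq_zero.1 ha).symm⟩

section Setup
variable {k F E : Type u} [Field k] [Field F] [Field E] [Algebra k[X] F]
    [IsFractionRing k[X] F] [Algebra F E] [Algebra k[X] E] [IsScalarTower k[X] F E] [Algebra k E]
    [IsScalarTower k k[X] E] {c : k} {n : ℕ}

theorem RB_it {Z : Set E} (c : k) (n : ℕ) (z : RB k Z) :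
    ((it (algebraMap k (RB k Z) c) n z : RB k Z) : E) = it (algebraMap k E c) n z :=
  it_map (algebraMap k (RB k Z) c) (RB k Z).val.toRingHom n z

theorem pi_it {Z : Set E} {Ω : Type u} [Field Ω] [Algebra k Ω] (π : RB k Z →ₐ[k] Ω) (c : k) (n : ℕ) (z : RB k Z) :
    π (it (algebraMap k (RB k Z) c) n z) = it (algebraMap k Ω c) n (π z) := by
  have := it_map (algebraMap k (RB k Z) c) π.toRingHom n z
  rw [show π.toRingHom (algebraMap k (RB k Z) c) = algebraMap k Ω c from π.commutes c] at this
  exact this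

theorem pi_fib {Z : Set E} {Ω : Type u} [Field Ω] [Algebra k Ω] (π : RB k Z →ₐ[k] Ω) {t : k}
    (h1 : ∀ P, π (algebraMap k[X] (RB k Z) P) = algebraMap k Ω (P.eval t)) (z : RB k Z) (V : k[X])
    (h : it (algebraMap k E c) n z = algebraMap k[X] E V) :
    it (algebraMap k Ω c) n (π z) = algebraMap k Ω (V.eval t) := by
  rw [← h1, ← pi_it]
  congr 1
  apply Subtype.ext
  rw [RB_it, h]; rfl

theorem frob_fix [Finite k] {Z : Set E} {t : k} {g : E ≃ₐ[F] E} (hg : FrobE k Z t g) {z : E} (hz : z ∈ Z)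
    (hgz : g z = z) (V : k[X]) (h : it (algebraMap k E c) n z = algebraMap k[X] E V) :
    ∃ x : k, it c n x = V.eval t := by
  obtain ⟨Ω, _, _, π, h1, hF⟩ := hg
  let z' : RB k Z := ⟨z, Algebra.subset_adjoin hz⟩
  obtain ⟨x, hx⟩ := frob_range (π z') (hF z' z' hgz.symm).symm
  refine ⟨x, (algebraMap k Ω).injective ?_⟩
  rw [it_map, hx]
  exact pi_fib π h1 z' V h

theorem pi_inj {Z : Set E} {Ω : Type u} [Field Ω] [Algebra k Ω] (π : RB k Z →ₐ[k] Ω) {t : k} (h2 : (2 : k) ≠ 0)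
    (h1 : ∀ P, π (algebraMap k[X] (RB k Z) P) = algebraMap k Ω (P.eval t)) (z z' : RB k Z) (V : k[X])
    (h : it (algebraMap k E c) n z = algebraMap k[X] E V) (h' : it (algebraMap k E c) n z' = algebraMap k[X] E V)
    (hV : ∀ j < n, V.eval t ≠ it c (n - j) 0) (hπ : π z = π z') : z = z' := by
  have key : ∀ j ≤ n, it (algebraMap k E c) (n - j) z = it (algebraMap k E c) (n - j) z' := by
    intro j
    induction j with
    | zero => intro _; rw [Nat.sub_zero, h, h']
    | succ j ih =>
      intro hj
      have e := ih (by omega)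
      obtain ⟨m, hm⟩ : ∃ m, n - j = m + 1 := ⟨n - j - 1, by omega⟩
      rw [show n - (j + 1) = m by omega]
      rw [hm, it_succ, it_succ] at e
      rcases sq_eq_sq_iff_eq_or_eq_neg.1 (add_right_cancel e) with e | e
      · exact e
      · exfalso
        have e2 : it (algebraMap k (RB k Z) c) m z = - it (algebraMap k (RB k Z) c) m z' := by
          apply Subtype.ext
          rw [RB_it, e, ← RB_it]; rfl
        have e3 := congrArg π e2
        rw [map_neg, pi_it, pi_it, hπ] at e3
        have h2Ω : (2 : Ω) ≠ 0 := by
          have : algebraMap k Ω 2 = 2 := map_ofNat _ 2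
          rw [← this, Ne, map_eq_zero]; exact h2
        have e4 : it (algebraMap k Ω c) m (π z') = 0 := by
          have : 2 * it (algebraMap k Ω c) m (π z') = 0 := by linear_combination e3
          exact (mul_eq_zero.1 this).resolve_left h2Ω
        have e5 := pi_fib π h1 z' V h'
        rw [show n = (n - m) + m by omega, it_add, e4] at e5
        apply hV m (by omega)
        apply (algebraMap k Ω).injective
        rw [← e5, it_map, map_zero]
  have := key n le_rfl
  rw [Nat.sub_self] at this
  exact Subtype.ext this

theorem frob_img [IsSplittingField F E (PP F (fi c (n + 1)) (X ^ 2 + C c))]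
    [Finite k] {Z : Set E} {t : k} {g : E ≃ₐ[F] E} (hg : FrobE k Z t g) (h2 : (2 : k) ≠ 0)
    (hZ : RT E (fi c (n + 1)) (X ^ 2 + C c) ⊆ Z) (V : k[X]) (hVX : V = X ∨ V = -X)
    (hV : ∀ j < n, V.eval t ≠ it c (n - j) 0) {x : k} (hx : it c n x = V.eval t) :
    ∃ z : E, it (algebraMap k E c) n z = algebraMap k[X] E V ∧ g z = z := by
  obtain ⟨Ω, _, _, π, h1, hF⟩ := hg
  have hv : algebraMap k[X] E V = algebraMap k[X] E X ∨ algebraMap k[X] E V = - algebraMap k[X] E X := by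
    rcases hVX with rfl | rfl
    · left; rfl
    · right; rw [map_neg]
  have hmem : ∀ z : E, it (algebraMap k E c) n z = algebraMap k[X] E V → z ∈ RB k Z := by
    intro z hz
    refine Algebra.subset_adjoin (hZ ((mem_RT z).2 ?_))
    rw [hz]; exact hv
  have hs := split_half (F := F) (c := c) (n := n) (algebraMap k[X] E V) hv
  have hm := half_monic (n := n) (algebraMap k E c) (algebraMap k[X] E V)
  have hroot : ∀ z ∈ (fi (algebraMap k E c) n - C (algebraMap k[X] E V)).roots,
      it (algebraMap k E c) n z = algebraMap k[X] E V := by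
    intro z hz
    have := isRoot_of_mem_roots hz
    rw [IsRoot, eval_sub, fi_eval, eval_C] at this
    exact sub_eq_zero.1 this
  have hp := hs.eq_prod_roots_of_monic hm
  obtain ⟨z, hz, hzx⟩ : ∃ z : RB k Z, it (algebraMap k E c) n z = algebraMap k[X] E V ∧ π z = algebraMap k Ω x := by
    let R := (fi (algebraMap k E c) n - C (algebraMap k[X] E V)).roots
    let M : Multiset (RB k Z) := R.attach.map fun z => ⟨z.1, hmem z.1 (hroot z.1 z.2)⟩
    have hM : M.map (fun z : RB k Z => (z : E)) = R := by
      simp only [M, Multiset.map_map, Function.comp_def]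
      exact Multiset.attach_map_val R
    have e1 : (M.map fun z : RB k Z => algebraMap k (RB k Z) x - z).prod =
        it (algebraMap k (RB k Z) c) n (algebraMap k (RB k Z) x) - algebraMap k[X] (RB k Z) V := by
      apply Subtype.ext
      have e2 := congrArg (fun P : E[X] => P.eval (algebraMap k E x)) hp
      simp only [eval_sub, fi_eval, eval_C, eval_multiset_prod, Multiset.map_map, Function.comp_def, eval_X] at e2
      have e3 : (((M.map fun z : RB k Z => algebraMap k (RB k Z) x - z).prod : RB k Z) : E) =
          (M.map fun z : RB k Z => algebraMap k E x - (z : E)).prod := by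
        rw [← (RB k Z).coe_val, map_multiset_prod, Multiset.map_map]
        rfl
      rw [e3, show (M.map fun z : RB k Z => algebraMap k E x - (z : E)) = (R.map fun z => algebraMap k E x - z) by
        have := congrArg (Multiset.map fun z => algebraMap k E x - z) hM
        rw [Multiset.map_map] at this
        exact this]
      rw [← e2]
      have := RB_it (E := E) (Z := Z) c n (algebraMap k (RB k Z) x)
      change _ = ((it (algebraMap k (RB k Z) c) n (algebraMap k (RB k Z) x) : RB k Z) : E) - algebraMap k[X] E V
      rw [this]; rfl
    have e4 := congrArg π e1
    rw [map_sub, pi_it, h1, AlgHom.commutes, ← it_map, hx, sub_self, map_multiset_prod, Multiset.prod_eq_zero_iff,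
      Multiset.map_map, Multiset.mem_map] at e4
    obtain ⟨z, hz, hz0⟩ := e4
    rw [Function.comp_apply, map_sub, AlgHom.commutes] at hz0
    refine ⟨z, ?_, (sub_eq_zero.1 hz0).symm⟩
    apply hroot
    change (z : E) ∈ R
    rw [← hM]
    exact Multiset.mem_map_of_mem _ hz
  have hgz : it (algebraMap k E c) n (g z) = algebraMap k[X] E V := by
    rw [← gal_it, hz, gal_k]
  let z' : RB k Z := ⟨g z, hmem _ hgz⟩
  refine ⟨z, hz, ?_⟩
  have e : π z' = π z := by
    rw [hF z z' rfl, hzx, ← map_pow]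
    congr 1
    have := Fintype.ofFinite k
    rw [Nat.card_eq_fintype_card, FiniteField.pow_card]
  have := pi_inj π h2 h1 z' z V hgz hz hV e
  exact congrArg Subtype.val this

end Setup
end QLC

namespace QLC
universe u

/-- The polynomial whose roots are the bad parameters. -/
noncomputable def Dl {k : Type u} [Field k] (c : k) (n : ℕ) (κ : k) : k[X] :=
  (∏ j ∈ Finset.range n, (X ^ 2 - C (it c (n - j) 0 ^ 2))) * (X ^ 2 - C (κ ^ 2))

theorem Dl_monic {k : Type u} [Field k] (c : k) (n : ℕ) (κ : k) : (Dl c n κ).Monic :=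
  (monic_prod_of_monic _ _ fun _ _ => monic_X_pow_sub_C _ (by norm_num)).mul (monic_X_pow_sub_C _ (by norm_num))

theorem Dl_deg {k : Type u} [Field k] (c : k) (n : ℕ) (κ : k) : (Dl c n κ).natDegree = 2 * n + 2 := by
  rw [Dl, Monic.natDegree_mul (monic_prod_of_monic _ _ fun _ _ => monic_X_pow_sub_C _ (by norm_num))
    (monic_X_pow_sub_C _ (by norm_num)), natDegree_prod_of_monic _ _ fun _ _ => monic_X_pow_sub_C _ (by norm_num)]
  simp only [natDegree_X_pow_sub_C]
  simp; ring

theorem Dl_eval {k : Type u} [Field k] {c : k} {n : ℕ} {κ t : k} (h : (Dl c n κ).eval t ≠ 0) :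
    (∀ j < n, t ≠ it c (n - j) 0) ∧ (∀ j < n, -t ≠ it c (n - j) 0) := by
  rw [Dl, eval_mul, eval_prod] at h
  have h1 := Finset.prod_ne_zero_iff.1 (left_ne_zero_of_mul h)
  simp only [eval_sub, eval_pow, eval_X, eval_C, Finset.mem_range] at h1
  constructor
  · intro j hj e; apply h1 j hj; rw [← e]; ring
  · intro j hj e; apply h1 j hj; rw [← e]; ring

section Setup
variable {k F E : Type u} [Field k] [Field F] [Field E] [Algebra k[X] F]
    [IsFractionRing k[X] F] [Algebra F E] [Algebra k[X] E] [IsScalarTower k[X] F E] [Algebra k E]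
    [IsScalarTower k k[X] E] {c : k} {n : ℕ}

variable (E) in
/-- The generating set. -/
def ZZ (c : k) (n : ℕ) (κ : k) : Set E := RT E (fi c (n + 1)) (X ^ 2 + C c) ∪ RT E (X ^ 2) (X ^ 2 - C (κ ^ 2))

theorem ZZ_stab (κ : k) (g : E ≃ₐ[F] E) (z : E) (hz : z ∈ ZZ E c n κ) : g z ∈ ZZ E c n κ := by
  rcases hz with hz | hz
  · exact Or.inl (RT_stab g z hz)
  · exact Or.inr (RT_stab g z hz)

theorem exists_pre [IsSplittingField F E (PP F (fi c (n + 1)) (X ^ 2 + C c))] [FiniteDimensional F E]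
    [IsGalois F E] (hn : 1 ≤ n) (h2 : (2 : k) ≠ 0) {ζ : kˣ} (hζ : (ζ : k) ^ 2 ^ n = -1)
    (i : E →ₐ[k] HahnSeries ℤ k)
    (hi : i (algebraMap k[X] E X) = HahnSeries.single (-(2 ^ n : ℕ) : ℤ) 1)
    {α : E ≃ₐ[k] E} (hα : ∀ x, i (α x) = sig ζ (i x))
    {ρ : E ≃ₐ[F] E} (hρ : ∀ x, ρ x = α (α x)) (κ : k) :
    ∃ S : PreStep k F E (ZZ E c n κ) (2 ^ n) (2 ^ n * (2 * n + 2)), S.Del = Dl c n κ := by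
  have h2E : (2 : E) ≠ 0 := two_ne h2
  obtain ⟨reps, hr1, hr2⟩ := exists_reps i hα hρ (orderOf_rho (c := c) hn h2 hζ i hi hα hρ)
  have hX2 : (X ^ 2 : k[X]).Monic := monic_X_pow 2
  have hX2d : 1 ≤ (X ^ 2 : k[X]).natDegree := by rw [natDegree_X_pow]; norm_num
  refine exists_preStep (F := F) (Z := ZZ E c n κ)
    ((RT_finite F (fi_hQ c n).1 (fi_hQ c n).2).union (RT_finite F hX2 hX2d))
    (fun g z hz => ZZ_stab κ g z hz) ?_ i (by positivity) (by push_cast; exact pow_ne_zero _ h2) hi (Dl c n κ)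
    (Dl_deg c n κ).le ?_ reps hr1 hr2
  · refine top_le_iff.1 ?_
    rw [← RT_gen (F := F) (Q := fi c (n + 1)) (w := X ^ 2 + C c) (fi_hQ c n).1 (fi_hQ c n).2]
    exact Algebra.adjoin_mono Set.subset_union_left
  intro z hz
  have hzB : z ∈ RB k (ZZ E c n κ) := Algebra.subset_adjoin hz
  have halg : ∀ P : k[X], algebraMap k[X] E P ∈ RB k (ZZ E c n κ) := fun P => Subalgebra.algebraMap_mem _ _
  have hk : ∀ a : k, algebraMap k E a ∈ RB k (ZZ E c n κ) := fun a => by rw [← algE]; exact halg _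
  have hita : ∀ j, it (algebraMap k E c) j z ∈ RB k (ZZ E c n κ) := fun j => by
    have := (it (algebraMap k (RB k (ZZ E c n κ)) c) j ⟨z, hzB⟩).2
    rwa [RB_it] at this
  have haev : ∀ x ∈ RB k (ZZ E c n κ), ∀ P : k[X], aeval x P ∈ RB k (ZZ E c n κ) := by
    intro x hx P
    induction P using Polynomial.induction_on' with
    | add p q hp hq => rw [map_add]; exact add_mem hp hq
    | monomial m a => rw [aeval_monomial]; exact mul_mem (hk a) (pow_mem hx m)
  rcases hz with hz | hz
  · have hz' := hz
    rw [mem_RT] at hz'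
    set v := it (algebraMap k E c) n z with hvdef
    have hv2 : v ^ 2 = algebraMap k[X] E X ^ 2 := by rcases hz' with h | h <;> rw [h] <;> ring
    have hj : ∀ j ∈ Finset.range n, ∃ h ∈ RB k (ZZ E c n κ),
        algebraMap k[X] E (X ^ 2 - C (it c (n - j) 0 ^ 2)) = it (algebraMap k E c) j z * h := by
      intro j hj
      rw [Finset.mem_range] at hj
      obtain ⟨P, hP⟩ := it_dvd c (n - j)
      have := hP (it (algebraMap k E c) j z)
      rw [← it_add, Nat.sub_add_cancel hj.le] at this
      refine ⟨aeval (it (algebraMap k E c) j z) P * (v + algebraMap k E (it c (n - j) 0)),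
        mul_mem (haev _ (hita j) P) (add_mem (hita n) (hk _)), ?_⟩
      rw [map_sub, map_pow, ← hv2, algE, map_pow]
      linear_combination (v + algebraMap k E (it c (n - j) 0)) * this
    choose! h hh1 hh2 using hj
    obtain ⟨s, hs, hsv⟩ : ∃ s ∈ RB k (ZZ E c n κ), algebraMap k[X] E X = v * s := by
      rcases hz' with h | h
      · exact ⟨1, one_mem _, by rw [h, mul_one]⟩
      · exact ⟨-1, neg_mem (one_mem _), by rw [h]; ring⟩
    refine ⟨fi c (n + 1), X ^ 2 + C c, (fi_hQ c n).1, (fi_hQ c n).2, ?_, hz, der_ne_zero F h2 hz,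
      algebraMap k E (1 / 2 ^ n) * ((∏ j ∈ Finset.range n, h j) * s * algebraMap k[X] E (X ^ 2 - C (κ ^ 2))), ?_, ?_⟩
    · rw [natDegree_X_pow_add_C]; omega
    · exact mul_mem (hk _) (mul_mem (mul_mem (prod_mem hh1) hs) (halg _))
    · rw [fi_deriv_aeval, Finset.prod_range_succ, Dl, map_mul, map_mul, map_prod, Finset.prod_congr rfl hh2,
        Finset.prod_mul_distrib]
      have hd : derivative (X ^ 2 + C c : k[X]) = C 2 * X := by
        rw [derivative_add, derivative_X_pow, derivative_C]; simp
      rw [hd, map_mul, algE, hsv, map_ofNat, map_div₀, map_one, map_pow (algebraMap k E), map_ofNat, ← hvdef]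
      field_simp
      ring
  · have hr : z ^ 2 = algebraMap k[X] E (X ^ 2 - C (κ ^ 2)) := by simpa [RT] using hz
    have hder : aeval z (derivative (X ^ 2 : k[X])) = 2 * z := by
      rw [show derivative (X ^ 2 : k[X]) = C 2 * X by rw [derivative_X_pow]; simp]
      rw [map_mul, aeval_C, aeval_X, map_ofNat]
    have hz0 : z ≠ 0 := by
      rintro rfl
      have h0 : algebraMap k[X] E (X ^ 2 - C (κ ^ 2)) = algebraMap k[X] E 0 := by rw [← hr, map_zero]; ring
      exact (monic_X_pow_sub_C (κ ^ 2) (two_ne_zero)).ne_zero (algX_inj F _ _ h0)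
    refine ⟨X ^ 2, X ^ 2 - C (κ ^ 2), hX2, hX2d, ?_, hz, ?_, 
      algebraMap k[X] E (∏ j ∈ Finset.range n, (X ^ 2 - C (it c (n - j) 0 ^ 2))) * z * algebraMap k[X] E X, ?_, ?_⟩
    · rw [natDegree_X_pow_sub_C]; omega
    · rw [hder]; exact mul_ne_zero h2E hz0
    · exact mul_mem (mul_mem (halg _) hzB) (halg _)
    · rw [hder, Dl, map_mul, map_mul, ← hr]
      have hd : derivative (X ^ 2 - C (κ ^ 2) : k[X]) = C 2 * X := by
        rw [derivative_sub, derivative_X_pow, derivative_C]; simp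
      rw [hd, map_mul, algE, map_ofNat]
      ring

theorem gal_abs [Fintype k] [DecidableEq k] [IsSplittingField F E (PP F (fi c (n + 1)) (X ^ 2 + C c))]
    [FiniteDimensional F E] [IsGalois F E] (h2 : (2 : k) ≠ 0) (κ : k) (η : ℝ) (hη : 0 < η)
    (S : PreStep k F E (ZZ E c n κ) (2 ^ n) (2 ^ n * (2 * n + 2))) (hS : S.Del = Dl c n κ)
    (hcheb : ∀ (U : Set (E ≃ₐ[F] E)), (∀ g ∈ U, ∀ s, s * g * s⁻¹ ∈ U) → ∀ T : Finset k,
      (∀ t ∈ T, S.Del.eval t ≠ 0 ∧ ∃ g ∈ U, FrobE k (ZZ E c n κ) t g) →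
      (T.card : ℝ) * Nat.card (E ≃ₐ[F] E) ≤ (1 + η) * Nat.card k * U.ncard)
    {α : E ≃ₐ[k] E} (hαy : α (algebraMap k[X] E X) = - algebraMap k[X] E X)
    {ρ : E ≃ₐ[F] E} (hρ : ∀ x, ρ x = α (α x)) (H : Subgroup (E ≃ₐ[F] E))
    (hH : H = (NN F c n (algebraMap k[X] E X) ⊔ NN F c n (algebraMap k[X] E (-X))) ⊔ Subgroup.zpowers ρ)
    (hHn : ∀ g ∈ H, ∀ s, s * g * s⁻¹ ∈ H) (T : Finset k) (hT : ∀ t ∈ T, ∃ x, it c n x = t)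
    (hTH : ∀ t ∈ T, (Dl c n κ).eval t ≠ 0 → ∀ g, FrobE k (ZZ E c n κ) t g → g ∈ H)
    (W : Finset k) (hW : ∀ t, (∃ x, it c n x = t) → (∃ x, it c n x = -t) → t ∈ W) :
    (T.card : ℝ) ≤ √ ((1 + η) * Fintype.card k * (W.card + η * Fintype.card k + (2 * n + 2))) + (2 * n + 2) := by
  classical
  set y := algebraMap k[X] E X with hy
  have hny : algebraMap k[X] E (-X) = - y := by rw [map_neg]
  let U : Set (E ≃ₐ[F] E) := {g | ∃ z, it (algebraMap k E c) n z = y ∧ g z = z}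
  let U' : Set (E ≃ₐ[F] E) := {g | ∃ z, it (algebraMap k E c) n z = -y ∧ g z = z}
  have gy : ∀ g : E ≃ₐ[F] E, g y = y := fun g => gal_k g X
  have hUc : ∀ g ∈ U, ∀ s, s * g * s⁻¹ ∈ U := by
    rintro g ⟨z, hz, hgz⟩ s
    refine ⟨s z, by rw [← gal_it, hz, gy], ?_⟩
    simp [AlgEquiv.mul_apply, hgz]
  have hUc' : ∀ g ∈ U', ∀ s, s * g * s⁻¹ ∈ U' := by
    rintro g ⟨z, hz, hgz⟩ s
    refine ⟨s z, by rw [← gal_it, hz, map_neg, gy], ?_⟩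
    simp [AlgEquiv.mul_apply, hgz]
  obtain ⟨θ, hθ⟩ := exists_theta (F := F) α hαy
  have αit : ∀ z, α (it (algebraMap k E c) n z) = it (algebraMap k E c) n (α z) := by
    intro z
    have := it_map (algebraMap k E c) (α : E →+* E) n z
    rw [show (α : E →+* E) (algebraMap k E c) = algebraMap k E c from α.commutes c] at this
    exact this
  have fixα : ∀ g z, g z = z ↔ θ g (α z) = α z := by
    intro g z
    rw [hθ]
    exact α.injective.eq_iff.symm
  have fib1 : ∀ z, it (algebraMap k E c) n z = -y ↔ it (algebraMap k E c) n (α z) = y := by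
    intro z
    rw [← αit]
    constructor
    · intro h; rw [h, map_neg, hαy, neg_neg]
    · intro h; apply α.injective; rw [h, map_neg, hαy, neg_neg]
  have fib2 : ∀ z, it (algebraMap k E c) n z = y ↔ it (algebraMap k E c) n (α z) = -y := by
    intro z
    rw [← αit]
    constructor
    · intro h; rw [h, hαy]
    · intro h; apply α.injective; rw [h, hαy]
  have hgrp := group_two (NN F c n (algebraMap k[X] E X)) (NN F c n (algebraMap k[X] E (-X))) H ρ θ
    (by
      apply AlgEquiv.ext
      intro x
      obtain ⟨x, rfl⟩ := α.surjective x
      rw [hθ, hρ, hρ])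
    (by
      intro g
      rw [mem_NN, mem_NN, hny]
      constructor
      · intro h z hz
        obtain ⟨z, rfl⟩ := α.surjective z
        exact (fixα g z).1 (h z ((fib1 z).2 hz))
      · intro h z hz
        exact (fixα g z).2 (h (α z) ((fib1 z).1 hz)))
    U U'
    (by
      intro g
      constructor
      · rintro ⟨z, hz, hgz⟩
        exact ⟨α z, (fib2 z).1 hz, (fixα g z).1 hgz⟩
      · rintro ⟨z, hz, hgz⟩
        obtain ⟨z, rfl⟩ := α.surjective z
        exact ⟨z, (fib2 z).2 hz, (fixα g z).2 hgz⟩)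
    (by
      rintro g ⟨z, hz, hgz⟩ m hm
      refine ⟨z, hz, ?_⟩
      rw [AlgEquiv.mul_apply, mem_NN.1 hm z hz, hgz])
    (by
      rintro g ⟨z, hz, hgz⟩ m hm
      refine ⟨z, hz, ?_⟩
      rw [hny] at hm
      rw [AlgEquiv.mul_apply, mem_NN.1 hm z hz, hgz])
    (by rw [hH]; exact le_sup_left.trans le_sup_left)
    (by rw [hH]; exact le_sup_right.trans le_sup_left)
    (by
      intro h hh
      rw [hH, sup_comm, Subgroup.mem_sup_of_normal_right] at hh
      obtain ⟨r, hr, m, hm, rfl⟩ := hh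
      obtain ⟨j, rfl⟩ := hr
      rw [Subgroup.mem_sup_of_normal_right] at hm
      obtain ⟨a, ha, b, hb, rfl⟩ := hm
      exact ⟨j, a, ha, b, hb, by rw [mul_assoc]⟩)
  -- translation
  have hZ : RT E (fi c (n + 1)) (X ^ 2 + C c) ⊆ ZZ E c n κ := Set.subset_union_left
  have tr1 : ∀ t g, (Dl c n κ).eval t ≠ 0 → FrobE k (ZZ E c n κ) t g → ((∃ x, it c n x = t) ↔ g ∈ U) := by
    intro t g ht hg
    constructor
    · rintro ⟨x, hx⟩
      exact frob_img hg h2 hZ X (Or.inl rfl) (by rw [eval_X]; exact (Dl_eval ht).1) (by rw [eval_X]; exact hx)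
    · rintro ⟨z, hz, hgz⟩
      obtain ⟨x, hx⟩ := frob_fix (c := c) (n := n) hg (hZ ((mem_RT z).2 (Or.inl hz))) hgz X hz
      rw [eval_X] at hx
      exact ⟨x, hx⟩
  have tr2 : ∀ t g, (Dl c n κ).eval t ≠ 0 → FrobE k (ZZ E c n κ) t g → g ∈ U' → (∃ x, it c n x = -t) := by
    intro t g ht hg ⟨z, hz, hgz⟩
    obtain ⟨x, hx⟩ := frob_fix (c := c) (n := n) hg (hZ ((mem_RT z).2 (Or.inr hz))) hgz (-X) (by rw [hny]; exact hz)
    rw [eval_neg, eval_X] at hx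
    exact ⟨x, hx⟩
  let Bad : Finset k := Finset.univ.filter fun t => (Dl c n κ).eval t = 0
  have hBad : Bad.card ≤ 2 * n + 2 := by
    rw [← Dl_deg c n κ]
    refine le_trans (Finset.card_le_card ?_) ((Multiset.toFinset_card_le _).trans (card_roots' (Dl c n κ)))
    intro t ht
    rw [Multiset.mem_toFinset, mem_roots (Dl_monic c n κ).ne_zero]
    exact (Finset.mem_filter.1 ht).2
  have hmB : ∀ t, t ∉ Bad → (Dl c n κ).eval t ≠ 0 := by
    intro t ht h; exact ht (Finset.mem_filter.2 ⟨Finset.mem_univ _, h⟩)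
  have c1 := hcheb (U ∩ H) (by
      rintro g ⟨h1, h2⟩ s
      exact ⟨hUc g h1 s, hHn g h2 s⟩) (T \ Bad) (by
      intro t ht
      rw [Finset.mem_sdiff] at ht
      have hD := hmB t ht.2
      obtain ⟨g, hg⟩ := exists_frobE S t
      exact ⟨by rw [hS]; exact hD, g, ⟨(tr1 t g hD hg).1 (hT t ht.1), hTH t ht.1 hD g hg⟩, hg⟩)
  have c2 := hcheb (U ∩ U')ᶜ (by
      intro g hg s hs
      apply hg
      have a1 := hUc _ hs.1 s⁻¹
      have a2 := hUc' _ hs.2 s⁻¹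
      have e : s⁻¹ * (s * g * s⁻¹) * s⁻¹⁻¹ = g := by group
      rw [e] at a1 a2
      exact ⟨a1, a2⟩) ((Finset.univ \ Bad) \ W) (by
      intro t ht
      rw [Finset.mem_sdiff, Finset.mem_sdiff] at ht
      have hD := hmB t ht.1.2
      obtain ⟨g, hg⟩ := exists_frobE S t
      refine ⟨by rw [hS]; exact hD, g, ?_, hg⟩
      intro hh
      exact ht.2 (hW t ((tr1 t g hD hg).2 hh.1) (tr2 t g hD hg hh.2)))
  -- counting
  have k1 : (T.card : ℝ) - (2 * n + 2) ≤ (T \ Bad).card := by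
    have := Finset.le_card_sdiff Bad T
    have : T.card ≤ (T \ Bad).card + (2 * n + 2) := by omega
    have : (T.card : ℝ) ≤ (T \ Bad).card + (2 * n + 2) := by exact_mod_cast this
    linarith
  have k2 : (Fintype.card k : ℝ) - (2 * n + 2) - W.card ≤ ((Finset.univ \ Bad) \ W).card := by
    have h1 := Finset.le_card_sdiff Bad (Finset.univ : Finset k)
    have h2 := Finset.le_card_sdiff W (Finset.univ \ Bad : Finset k)
    rw [Finset.card_univ] at h1
    have : Fintype.card k ≤ ((Finset.univ \ Bad) \ W).card + (2 * n + 2) + W.card := by omega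
    have : (Fintype.card k : ℝ) ≤ ((Finset.univ \ Bad) \ W).card + (2 * n + 2) + W.card := by exact_mod_cast this
    linarith
  have k3 : ((U ∩ U')ᶜ.ncard : ℝ) = Nat.card (E ≃ₐ[F] E) - (U ∩ U').ncard := by
    rw [Set.ncard_compl, Nat.cast_sub]
    rw [← Set.ncard_univ]
    exact Set.ncard_le_ncard (Set.subset_univ _)
  have k4 : (Nat.card H : ℝ) ≤ Nat.card (E ≃ₐ[F] E) := by
    exact_mod_cast Subgroup.card_le_card_group H
  have k5 : ((U ∩ U' ∩ H).ncard : ℝ) ≤ (U ∩ U').ncard := by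
    exact_mod_cast Set.ncard_le_ncard Set.inter_subset_left
  have k6 : (0 : ℝ) < Nat.card (E ≃ₐ[F] E) := by exact_mod_cast Nat.card_pos
  rw [k3] at c2
  rw [Nat.card_eq_fintype_card (α := k)] at c1 c2
  set q : ℝ := (Fintype.card k : ℝ)
  set G : ℝ := (Nat.card (E ≃ₐ[F] E) : ℝ)
  set u : ℝ := ((U ∩ H).ncard : ℝ)
  set w : ℝ := ((U ∩ U').ncard : ℝ)
  have hq : 0 ≤ q := Nat.cast_nonneg _
  have hu : 0 ≤ u := Nat.cast_nonneg _
  have hw : 0 ≤ w := Nat.cast_nonneg _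
  have hgrp' : u ^ 2 ≤ G * w := by
    refine hgrp.trans ?_
    exact mul_le_mul k4 k5 (Nat.cast_nonneg _) k6.le
  rw [← sub_le_iff_le_add]
  rcases le_total ((T.card : ℝ) - (2 * n + 2)) 0 with hneg | hpos
  · exact hneg.trans (Real.sqrt_nonneg _)
  apply Real.le_sqrt_of_sq_le
  set a : ℝ := (T.card : ℝ) - (2 * n + 2)
  have m1 : a * G ≤ (1 + η) * q * u := (mul_le_mul_of_nonneg_right k1 k6.le).trans c1
  have m2 : (q - (2 * n + 2) - W.card) * G ≤ (1 + η) * q * (G - w) := (mul_le_mul_of_nonneg_right k2 k6.le).trans c2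
  have m3 : (1 + η) * q * w ≤ G * (W.card + η * q + (2 * n + 2)) := by nlinarith
  have m4 : (a * G) ^ 2 ≤ ((1 + η) * q * u) ^ 2 := pow_le_pow_left₀ (by positivity) m1 2
  have m5 : ((1 + η) * q) * (((1 + η) * q) * (G * w)) ≤ (1 + η) * q * (G * (G * (W.card + η * q + (2 * n + 2)))) := by
    refine mul_le_mul_of_nonneg_left ?_ (by positivity)
    calc (1 + η) * q * (G * w) = G * ((1 + η) * q * w) := by ring
      _ ≤ _ := mul_le_mul_of_nonneg_left m3 k6.le
  have m6 : ((1 + η) * q * u) ^ 2 ≤ ((1 + η) * q) * (((1 + η) * q) * (G * w)) := by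
    calc ((1 + η) * q * u) ^ 2 = ((1 + η) * q) ^ 2 * u ^ 2 := by ring
      _ ≤ ((1 + η) * q) ^ 2 * (G * w) := mul_le_mul_of_nonneg_left hgrp' (by positivity)
      _ = _ := by ring
  have m7 : G ^ 2 * a ^ 2 ≤ G ^ 2 * ((1 + η) * q * (W.card + η * q + (2 * n + 2))) := by
    calc G ^ 2 * a ^ 2 = (a * G) ^ 2 := by ring
      _ ≤ _ := m4.trans (m6.trans m5)
      _ = _ := by ring
  exact le_of_mul_le_mul_left m7 (by positivity)

end Setup
end QLC

namespace QLC
universe u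

/-- The image of the `n`-th iterate. -/
def im {k : Type u} [Field k] [Fintype k] [DecidableEq k] (c : k) (n : ℕ) : Finset k := Finset.univ.image (it c n)

theorem mem_im {k : Type u} [Field k] [Fintype k] [DecidableEq k] {c : k} {n : ℕ} {t : k} :
    t ∈ im c n ↔ ∃ x, it c n x = t := by simp [im]

theorem exists_zeta {k : Type u} [Field k] [Fintype k] (h2 : (2 : k) ≠ 0) (n : ℕ)
    (h : 2 ^ (n + 1) ∣ Fintype.card k - 1) : ∃ ζ : kˣ, (ζ : k) ^ 2 ^ n = -1 := by
  classical
  obtain ⟨g, hg⟩ := IsCyclic.exists_generator (α := kˣ)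
  have ho : orderOf g = Fintype.card k - 1 := by
    rw [orderOf_eq_card_of_forall_mem_zpowers hg, Nat.card_eq_fintype_card, Fintype.card_units]
  obtain ⟨m, hm⟩ := h
  have hq : 1 < Fintype.card k := Fintype.one_lt_card
  have hm0 : m ≠ 0 := by rintro rfl; omega
  refine ⟨g ^ m, ?_⟩
  have h1 : ((g ^ m : kˣ) : k) ^ 2 ^ n * ((g ^ m : kˣ) : k) ^ 2 ^ n = 1 := by
    rw [← Units.val_pow_eq_pow_val, ← Units.val_mul, ← Units.val_one]
    congr 1
    rw [← pow_mul, ← pow_add]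
    have : m * 2 ^ n + m * 2 ^ n = orderOf g := by rw [ho, hm]; ring
    rw [this, pow_orderOf_eq_one]
  rcases mul_self_eq_one_iff.1 h1 with h | h
  · exfalso
    rw [← Units.val_pow_eq_pow_val, Units.val_eq_one, ← pow_mul] at h
    have := orderOf_dvd_of_pow_eq_one h
    rw [ho, hm] at this
    have h3 := Nat.le_of_dvd (by positivity) this
    have : 0 < m * 2 ^ n := by positivity
    rw [pow_succ] at h3
    nlinarith
  · exact h

theorem GAL (n : ℕ) (hn : 1 ≤ n) (η : ℝ) (hη : 0 < η) : ∃ p0 : ℕ, ∀ (k : Type u) [Field k] [Fintype k] [DecidableEq k],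
    p0 ≤ ringChar k → ∀ c : k, 2 ^ (n + 1) ∣ Fintype.card k - 1 →
    ∀ W : Finset k, (∀ t, t ∈ im c n → -t ∈ im c n → t ∈ W) →
    ∃ B : ℝ, B = √ ((1 + η) * Fintype.card k * (W.card + η * Fintype.card k + (2 * n + 2))) + (2 * n + 2) ∧
    (((im c n).card : ℝ) ≤ B ∨ ∃ κ : k, κ ≠ 0 ∧ PCn c n κ ∧ PCn c n (-κ) ∧
      ∀ T ⊆ im c n, (∀ t ∈ T, ∃ a, a ≠ 0 ∧ t ^ 2 - κ ^ 2 = a ^ 2) → (T.card : ℝ) ≤ B) := by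
  obtain ⟨p0, hp0⟩ := cheb2.{u} ((2 ^ (n + 1)) ^ (2 ^ (n + 1))) (2 ^ n) (2 ^ n * (2 * n + 2)) η hη
  refine ⟨max p0 3, ?_⟩
  intro k _ _ _ hp c hdvd W hW
  have h2 : (2 : k) ≠ 0 := by
    intro h
    have : ringChar k ∣ 2 := (ringChar.spec k 2).1 (by exact_mod_cast h)
    have := Nat.le_of_dvd (by norm_num) this
    omega
  refine ⟨_, rfl, ?_⟩
  obtain ⟨ζ, hζ⟩ := exists_zeta h2 n hdvd
  let F := FractionRing k[X]
  let E := (PP F (fi c (n + 1)) (X ^ 2 + C c)).SplittingField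
  have hgal : IsGalois F E := fgalois (F := F) (E := E) (c := c) (n := n) h2
  obtain ⟨i, hi⟩ := exists_inf (F := F) (E := E) (c := c) (n := n) h2 hζ
  obtain ⟨α, hαy, hα⟩ := exists_alpha (F := F) (E := E) (c := c) (n := n) hζ i hi
  obtain ⟨ρ, hρ⟩ := exists_rho (F := F) α hαy
  have hcard : Nat.card (E ≃ₐ[F] E) ≤ (2 ^ (n + 1)) ^ (2 ^ (n + 1)) := by
    have := gal_card_le (F := F) (E := E) (w := X ^ 2 + C c) (fi_hQ c n).1 (fi_hQ c n).2
    rwa [(fi_monic_deg c (n + 1)).2] at this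
  rcases star (F := F) (E := E) (c := c) (n := n) h2 hζ i hi hα hρ with hH | ⟨κ, hκ, hp1, hp2, r, hr, hH⟩
  · left
    obtain ⟨S, hS⟩ := exists_pre (F := F) (E := E) (c := c) hn h2 hζ i hi hα hρ 0
    exact gal_abs h2 0 η hη S hS (fun U hU T hT => hp0 k F E _ S hcard (by omega) U hU T hT) hαy hρ _ rfl
      (by intro g _ s; rw [hH]; trivial) (im c n) (fun t ht => mem_im.1 ht) (by intro t _ _ g _; rw [hH]; trivial)
      W (fun t h1 h2 => hW t (mem_im.2 h1) (mem_im.2 h2))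
  · right
    refine ⟨κ, hκ, hp1, hp2, ?_⟩
    intro T hT hTs
    obtain ⟨S, hS⟩ := exists_pre (F := F) (E := E) (c := c) hn h2 hζ i hi hα hρ κ
    have hrZ : r ∈ ZZ E c n κ := Or.inr (by simpa [RT] using hr)
    refine gal_abs h2 κ η hη S hS (fun U hU T hT => hp0 k F E _ S hcard (by omega) U hU T hT) hαy hρ _ rfl
      ?_ T (fun t ht => mem_im.1 (hT ht)) ?_
      W (fun t h1 h2 => hW t (mem_im.2 h1) (mem_im.2 h2))
    · intro g hg s
      rw [hH] at hg ⊢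
      have h1 : (s⁻¹ r) ^ 2 = r ^ 2 := by rw [← map_pow, hr]; exact gal_k _ _
      rw [AlgEquiv.mul_apply, AlgEquiv.mul_apply]
      have hss : s (s⁻¹ r) = r := by rw [← AlgEquiv.mul_apply, mul_inv_cancel]; rfl
      rcases sq_eq_sq_iff_eq_or_eq_neg.1 h1 with h | h
      · rw [h, hg, ← h, hss, h]
      · rw [h, map_neg, hg, ← h, hss]
    · intro t ht hD g hg
      rw [hH]
      obtain ⟨a, ha, hta⟩ := hTs t ht
      exact frob_sqrt hg h2 hrZ (ZZ_stab κ g r hrZ) hr ha (by simpa using hta)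

end QLC

namespace QLC
universe u

theorem exists_w {k : Type u} [Field k] (h2 : (2 : k) ≠ 0) (c : k) (hc : c ≠ -2) {κ : k} {i j : ℕ} (hκ : κ ≠ 0)
    (hi : 1 ≤ i) (hj : 1 ≤ j) (h1 : κ = it c i 0) (h3 : -κ = it c j 0) :
    ∃ w : k, w ≠ 0 ∧ (∀ m, 1 ≤ m → w ≠ it c m 0) ∧ w ^ 2 + c ≠ 0 ∧ w ^ 2 + c ≠ κ ^ 2 + c ∧
      (w ^ 2 + c) ^ 2 + c = κ ^ 2 + c := by
  obtain ⟨p1, p2⟩ := pc_comb h2 c hi hj (by rw [← h1, ← h3, neg_neg]) (by rwa [← h1])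
  have hne : κ ≠ -κ := by
    intro h
    have : 2 * κ = 0 := by linear_combination h
    exact (mul_ne_zero h2 hκ) this
  have hbad : ¬ (κ ^ 2 + c = -c ∧ κ ^ 2 = c ^ 2) := by
    rintro ⟨e1, e2⟩
    have : c * (c + 2) = 0 := by linear_combination e1 - e2
    rcases mul_eq_zero.1 this with h | h
    · rw [h] at e2; apply hκ; apply pow_eq_zero_iff (two_ne_zero) |>.1; rw [e2]; ring
    · exact hc (by linear_combination h)
  obtain ⟨l, lam, hl, hlam, hlam2, hlc, hlb⟩ : ∃ (l : ℕ) (lam : k), 1 ≤ l ∧ lam = it c l 0 ∧ lam ^ 2 = κ ^ 2 ∧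
      lam ≠ c ∧ lam ≠ κ ^ 2 + c := by
    by_contra hcon
    push Not at hcon
    have a1 := hcon i κ hi h1 rfl
    have a2 := hcon j (-κ) hj h3 (by ring)
    by_cases b1 : κ = c
    · have := a2 (by rw [← b1]; exact hne.symm)
      exact hbad ⟨by rw [← this, b1], by rw [b1]⟩
    · have e1 := a1 b1
      by_cases b2 : -κ = c
      · exact hbad ⟨by rw [← e1, ← b2, neg_neg], by rw [← b2]; ring⟩
      · have e2 := a2 b2
        exact hne (e1.trans e2.symm)
  obtain ⟨m, rfl⟩ : ∃ m, l = m + 2 := by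
    refine ⟨l - 2, ?_⟩
    have : l ≠ 1 := by
      rintro rfl
      apply hlc; rw [hlam, it_succ, it_zero]; ring
    omega
  rw [it_succ] at hlam
  have hfw : (-it c (m + 1) 0) ^ 2 + c = lam := by rw [hlam]; ring
  refine ⟨- it c (m + 1) 0, neg_ne_zero.2 (p1 _ (by omega)), ?_, ?_, ?_, ?_⟩
  · intro n hn e
    have := p2 (m + 1) n (by omega) hn (by rw [← e, neg_neg])
    rw [← h1] at this
    apply hlb
    rw [hlam]
    rcases this with h | h <;> rw [h] 
    ring
  · rw [hfw]
    rintro rfl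
    apply hκ; apply pow_eq_zero_iff (two_ne_zero) |>.1; rw [← hlam2]; ring
  · rw [hfw]; exact hlb
  · rw [hfw, hlam2]

theorem nonsq {k : Type u} [Field k] (h2 : (2 : k) ≠ 0) (c : k) (hc : c ≠ -2) {κ : k} {a b : ℕ} (hκ : κ ≠ 0)
    (ha : 1 ≤ a) (hb : 1 ≤ b) (h1 : κ = it c a 0) (h3 : -κ = it c b 0) {i j : ℕ} (hij : i < j) (hj : 2 ≤ j) :
    ¬ IsSquare ((fi c i - C (κ ^ 2 + c)) * (fi c j - C (κ ^ 2 + c))) := by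
  obtain ⟨w, w0, wP, fw0, fwb, ffw⟩ := exists_w h2 c hc hκ ha hb h1 h3
  rintro ⟨P, hP⟩
  let L := AlgebraicClosure k
  have inj : ∀ a b : k, algebraMap k L a = algebraMap k L b → a = b := fun a b h => (algebraMap k L).injective h
  set cL := algebraMap k L c with hcL
  obtain ⟨x, hx⟩ : ∃ x : L, it cL (j - 2) x = algebraMap k L w := by
    obtain ⟨x, hx⟩ := IsAlgClosed.exists_root (fi cL (j - 2) - C (algebraMap k L w)) (by
      have : (fi cL (j - 2) - C (algebraMap k L w)).natDegree = 2 ^ (j - 2) := by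
        rw [natDegree_sub_C, (fi_monic_deg cL (j - 2)).2]
      have h4 : 0 < (fi cL (j - 2) - C (algebraMap k L w)).natDegree := by rw [this]; positivity
      exact (natDegree_pos_iff_degree_pos.1 h4).ne')
    rw [IsRoot, eval_sub, fi_eval, eval_C] at hx
    exact ⟨x, sub_eq_zero.1 hx⟩
  have e1 : it cL (j - 1) x = algebraMap k L (w ^ 2 + c) := by
    rw [show j - 1 = (j - 2) + 1 by omega, it_succ, hx, map_add, map_pow]
  have e2 : it cL j x = algebraMap k L (κ ^ 2 + c) := by
    rw [show j = (j - 1) + 1 by omega, it_succ, e1, ← ffw, map_add _ ((w ^ 2 + c) ^ 2), map_pow]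
  have e3 : it cL i x ≠ algebraMap k L (κ ^ 2 + c) := by
    intro h
    by_cases hi : i = j - 1
    · rw [hi, e1] at h
      exact fwb (inj _ _ h)
    · have : it cL (j - 2) x = it cL (j - 2 - i) (it cL i x) := by rw [← it_add]; congr 1; omega
      rw [h, hx, hcL, ← it_map] at this
      have := inj _ _ this
      rw [h1, ← it_succ, ← it_add] at this
      exact wP _ (by omega) this
  have e4 : ∏ l ∈ Finset.range j, it cL l x ≠ 0 := by
    rw [Finset.prod_ne_zero_iff]
    intro l hl h
    rw [Finset.mem_range] at hl
    rcases lt_trichotomy l (j - 2) with h' | h' | h'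
    · have : it cL (j - 2) x = it cL (j - 2 - l) (it cL l x) := by rw [← it_add]; congr 1; omega
      rw [h, hx, ← map_zero (algebraMap k L), hcL, ← it_map] at this
      exact wP _ (by omega) (inj _ _ this)
    · rw [h', hx, ← map_zero (algebraMap k L)] at h
      exact w0 (inj _ _ h)
    · rw [show l = j - 1 by omega, e1, ← map_zero (algebraMap k L)] at h
      exact fw0 (inj _ _ h)
  have h2L : (2 : L) ≠ 0 := by
    have : algebraMap k L 2 = 2 := map_ofNat _ 2
    rw [← this, Ne, map_eq_zero]; exact h2
  have e5 : aeval x (fi c j - C (κ ^ 2 + c)) = 0 := by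
    rw [map_sub, fi_aeval, aeval_C, e2, sub_self]
  have e6 : aeval x P = 0 := by
    have := congrArg (aeval x) hP
    rw [map_mul, map_mul, e5, mul_zero] at this
    exact mul_self_eq_zero.1 this.symm
  have e7 := congrArg (fun R : k[X] => aeval x (derivative R)) hP
  simp only [derivative_mul, map_add, map_mul, e5, e6, mul_zero, zero_mul, add_zero, zero_add, derivative_sub,
    derivative_C, sub_zero, fi_deriv_aeval, map_sub, fi_aeval, aeval_C] at e7
  rw [← map_add, show it (algebraMap k L c) j x = _ from e2, sub_self, mul_zero, zero_add] at e7
  rcases mul_eq_zero.1 e7 with h | h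
  · exact e3 (sub_eq_zero.1 h)
  · rcases mul_eq_zero.1 h with h | h
    · exact pow_ne_zero _ h2L h
    · exact e4 h

end QLC

namespace QLC
universe u

theorem charsum (D : ℕ) (η : ℝ) (hη : 0 < η) : ∃ p0 : ℕ, ∀ (k : Type u) [Field k] [Fintype k] [DecidableEq k],
    p0 ≤ ringChar k → ∀ G : k[X], G.Monic → G.natDegree ≤ D → Even G.natDegree → ¬ IsSquare G →
    ∑ x : k, (quadraticChar k (G.eval x) : ℝ) ≤ η * Fintype.card k + D := by
  obtain ⟨p0, hp0⟩ := hyper.{u} D η hη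
  refine ⟨p0, ?_⟩
  intro k _ _ _ hp G hG hGD hGe hGs
  let T : Finset k := Finset.univ.filter fun x => quadraticChar k (G.eval x) = 1
  let Z : Finset k := Finset.univ.filter fun x => G.eval x = 0
  have hT := hp0 k hp G hG hGD hGe hGs T (by
    intro t ht
    have ht := (Finset.mem_filter.1 ht).2
    have h0 : G.eval t ≠ 0 := by
      intro h; rw [h, MulChar.map_zero] at ht; exact zero_ne_one ht
    obtain ⟨a, ha⟩ := (quadraticChar_one_iff_isSquare h0).1 ht
    refine ⟨a, ?_, by rw [ha]; ring⟩
    rintro rfl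
    apply h0; rw [ha]; ring)
  have hZ : Z.card ≤ D := by
    refine le_trans ?_ hGD
    refine le_trans (Finset.card_le_card ?_) ((Multiset.toFinset_card_le _).trans (card_roots' G))
    intro t ht
    rw [Multiset.mem_toFinset, mem_roots hG.ne_zero]
    exact (Finset.mem_filter.1 ht).2
  have key : ∀ x : k, (quadraticChar k (G.eval x) : ℝ) ≤
      2 * (if quadraticChar k (G.eval x) = 1 then 1 else 0) - 1 + (if G.eval x = 0 then 1 else 0) := by
    intro x
    by_cases h0 : G.eval x = 0
    · simp [h0]
    · rcases quadraticChar_dichotomy h0 with h | h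
      · simp [h, h0]; norm_num
      · simp [h, h0]
  refine (Finset.sum_le_sum fun x _ => key x).trans ?_
  rw [Finset.sum_add_distrib, Finset.sum_sub_distrib, ← Finset.mul_sum, Finset.sum_boole, Finset.sum_boole]
  rw [Nat.card_eq_fintype_card] at hT
  have hZ' : (Z.card : ℝ) ≤ D := by exact_mod_cast hZ
  simp only [Finset.sum_const, Finset.card_univ, nsmul_eq_mul, mul_one]
  change 2 * (T.card : ℝ) - _ + (Z.card : ℝ) ≤ _
  linarith

section Fin
variable {k : Type u} [Field k] [Fintype k] [DecidableEq k] {c : k}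

theorem im_succ (c : k) (n : ℕ) : im c (n + 1) = (im c n).image fun x => x ^ 2 + c := by
  ext t
  simp only [mem_im, Finset.mem_image]
  constructor
  · rintro ⟨x, hx⟩; exact ⟨_, ⟨x, rfl⟩, hx⟩
  · rintro ⟨_, ⟨x, rfl⟩, h⟩; exact ⟨x, h⟩

theorem W_card (h2 : (2 : k) ≠ 0) (c : k) (n : ℕ) :
    ((im c n).filter fun t => -t ∈ im c n).card + 2 * (im c (n + 1)).card ≤ 2 * (im c n).card + 1 := by
  set A := im c n
  let f : k → k := fun x => x ^ 2 + c
  let W := A.filter fun t => -t ∈ A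
  have hWA : W ⊆ A := Finset.filter_subset _ _
  let W0 := W.erase 0
  have h1 : 2 * (W0.image f).card ≤ W0.card := by
    rw [Finset.card_eq_sum_card_image f W0, mul_comm, ← smul_eq_mul]
    refine Finset.card_nsmul_le_sum _ _ 2 ?_
    intro v hv
    obtain ⟨t, ht, rfl⟩ := Finset.mem_image.1 hv
    have ht0 : t ≠ 0 := (Finset.mem_erase.1 ht).1
    have htW := Finset.mem_filter.1 (Finset.mem_erase.1 ht).2
    have hne : t ≠ -t := by
      intro h
      exact (mul_ne_zero h2 ht0) (by linear_combination h)
    rw [← Finset.card_pair hne]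
    apply Finset.card_le_card
    intro s hs
    rw [Finset.mem_insert, Finset.mem_singleton] at hs
    rw [Finset.mem_filter]
    rcases hs with rfl | rfl
    · exact ⟨ht, rfl⟩
    · refine ⟨Finset.mem_erase.2 ⟨neg_ne_zero.2 ht0, Finset.mem_filter.2 ⟨htW.2, by rw [neg_neg]; exact htW.1⟩⟩, ?_⟩
      simp only [f]; ring
  have h3 : im c (n + 1) ⊆ (A \ W).image f ∪ (W0.image f ∪ (W \ W0).image f) := by
    rw [im_succ, ← Finset.image_union, ← Finset.image_union]
    apply Finset.image_subset_image
    intro x hx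
    simp only [Finset.mem_union, Finset.mem_sdiff]
    tauto
  have h4 := (Finset.card_le_card h3).trans ((Finset.card_union_le _ _).trans
    (Nat.add_le_add_left (Finset.card_union_le _ _) _))
  have h5 : ((A \ W).image f).card ≤ (A \ W).card := Finset.card_image_le
  have h6 : ((W \ W0).image f).card ≤ (W \ W0).card := Finset.card_image_le
  have h7 := Finset.card_sdiff_add_card_eq_card hWA
  have h8 := Finset.card_sdiff_add_card_eq_card (Finset.erase_subset 0 W)
  have h9 : W.card ≤ W0.card + 1 := by
    have := Finset.pred_card_le_card_erase (s := W) (a := (0 : k))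
    have e : W0.card = (W.erase 0).card := rfl
    omega
  change W.card + _ ≤ _
  have h8' : (W \ W0).card + W0.card = W.card := h8
  omega

theorem exists_n (N0 : ℕ) (hN : 1 ≤ N0) (c : k) :
    ∃ n, 1 ≤ n ∧ n ≤ N0 ∧ ((im c n).card : ℝ) - (im c (n + 1)).card ≤ Fintype.card k / N0 := by
  have hs := Finset.sum_range_sub' (fun j => ((im c (j + 1)).card : ℝ)) N0
  obtain ⟨j, hj, hle⟩ := Finset.exists_le_of_sum_le (s := Finset.range N0)
    (f := fun j => ((im c (j + 1)).card : ℝ) - (im c (j + 1 + 1)).card) (g := fun _ => (Fintype.card k : ℝ) / N0)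
    ⟨0, Finset.mem_range.2 hN⟩ (by
      rw [hs, Finset.sum_const, Finset.card_range, nsmul_eq_mul]
      have : (N0 : ℝ) ≠ 0 := by positivity
      rw [mul_div_cancel₀ _ this]
      have h1 : ((im c (0 + 1)).card : ℝ) ≤ Fintype.card k := by exact_mod_cast Finset.card_le_univ _
      have h2 : (0 : ℝ) ≤ (im c (N0 + 1)).card := Nat.cast_nonneg _
      linarith)
  exact ⟨j + 1, by omega, by have := Finset.mem_range.1 hj; omega, hle⟩

/-- The second moment bound. -/
theorem moment (c κ : k) (J : ℕ) (hJ : 1 ≤ J) (M B : ℝ)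
    (hchar : ∀ i j, 2 ≤ i → i < j → j ≤ J + 1 →
      ∑ x : k, (quadraticChar k (((fi c i - C (κ ^ 2 + c)) * (fi c j - C (κ ^ 2 + c))).eval x) : ℝ) ≤ M)
    (hM : 0 ≤ M) (S : Finset k) (hS : S.image (fun x => x ^ 2 + c) = S)
    (hB : ∀ T ⊆ S, (∀ t ∈ T, ∃ a, a ≠ 0 ∧ t ^ 2 - κ ^ 2 = a ^ 2) → (T.card : ℝ) ≤ B) :
    (S.card : ℝ) ≤ Fintype.card k / J + M + J * (B + 2) := by
  let φ : ℕ → k → ℝ := fun j x => (quadraticChar k (it c j x - (κ ^ 2 + c)) : ℝ)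
  have hJ0 : (0 : ℝ) < J := by exact_mod_cast hJ
  have hinj1 : Set.InjOn (fun x => x ^ 2 + c) (S : Set k) := by
    rw [← Finset.card_image_iff, hS]
  have hmap1 : ∀ x ∈ S, x ^ 2 + c ∈ S := fun x hx => by
    rw [← hS]; exact Finset.mem_image_of_mem _ hx
  have hmap : ∀ j, ∀ x ∈ S, it c j x ∈ S := by
    intro j
    induction j with
    | zero => exact fun x hx => hx
    | succ j ih => intro x hx; exact hmap1 _ (ih x hx)
  have hinj : ∀ j, Set.InjOn (it c j) (S : Set k) := by
    intro j
    induction j with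
    | zero => intro x _ y _ h; exact h
    | succ j ih => intro x hx y hy h; exact ih hx hy (hinj1 (hmap j x hx) (hmap j y hy) h)
  let T := S.filter fun t => ∃ a, a ≠ 0 ∧ t ^ 2 - κ ^ 2 = a ^ 2
  let T' := T ∪ {κ, -κ}
  have hT : (T.card : ℝ) ≤ B := hB T (Finset.filter_subset _ _) fun t ht => (Finset.mem_filter.1 ht).2
  have hT' : (T'.card : ℝ) ≤ B + 2 := by
    have h1 : T'.card ≤ T.card + 2 := (Finset.card_union_le _ _).trans (Nat.add_le_add_left Finset.card_le_two _)
    have : (T'.card : ℝ) ≤ T.card + 2 := by exact_mod_cast h1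
    linarith
  have hφ : ∀ s ∈ S, s ∉ T' → quadraticChar k (s ^ 2 - κ ^ 2) = -1 := by
    intro s hs hsT
    have h0 : s ^ 2 - κ ^ 2 ≠ 0 := by
      intro h
      apply hsT
      rcases sq_eq_sq_iff_eq_or_eq_neg.1 (sub_eq_zero.1 h) with rfl | rfl <;> simp [T']
    rcases quadraticChar_dichotomy h0 with h | h
    · exfalso
      apply hsT
      obtain ⟨a, ha⟩ := (quadraticChar_one_iff_isSquare h0).1 h
      refine Finset.mem_union_left _ (Finset.mem_filter.2 ⟨hs, a, ?_, by rw [ha]; ring⟩)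
      rintro rfl
      apply h0; rw [ha]; ring
    · exact h
  let I := Finset.Icc 2 (J + 1)
  have hI : I.card = J := by simp [I]
  let Bd : ℕ → Finset k := fun j => S.filter fun s => it c (j - 1) s ∈ T'
  let S0 := S \ I.biUnion Bd
  have hBd : ∀ j, (Bd j).card ≤ T'.card := by
    intro j
    refine Finset.card_le_card_of_injOn (it c (j - 1)) (fun s hs => (Finset.mem_filter.1 hs).2) ?_
    exact (hinj (j - 1)).mono (by intro x hx; exact (Finset.mem_filter.1 hx).1)
  have hcard : S.card ≤ S0.card + J * T'.card := by
    have h1 : S.card ≤ S0.card + (I.biUnion Bd).card := by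
      have := Finset.le_card_sdiff (I.biUnion Bd) S
      have e : S0.card = (S \ I.biUnion Bd).card := rfl
      omega
    have h2 : (I.biUnion Bd).card ≤ I.card * T'.card := Finset.card_biUnion_le_card_mul _ _ _ fun j _ => hBd j
    rw [hI] at h2
    omega
  have hS0 : ∀ s ∈ S0, ∑ j ∈ I, φ j s = - J := by
    intro s hs
    rw [Finset.mem_sdiff] at hs
    have : ∀ j ∈ I, φ j s = -1 := by
      intro j hj
      have hj2 := (Finset.mem_Icc.1 hj).1
      have h1 : it c (j - 1) s ∉ T' := by
        intro h
        exact hs.2 (Finset.mem_biUnion.2 ⟨j, hj, Finset.mem_filter.2 ⟨hs.1, h⟩⟩)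
      have h3 := hφ _ (hmap (j - 1) s hs.1) h1
      simp only [φ]
      have e : it c j s - (κ ^ 2 + c) = it c (j - 1) s ^ 2 - κ ^ 2 := by
        obtain ⟨m, rfl⟩ : ∃ m, j = m + 1 := ⟨j - 1, by omega⟩
        rw [it_succ, Nat.add_sub_cancel]; ring
      rw [e, h3]; simp
    rw [Finset.sum_congr rfl this, Finset.sum_const, hI]; simp
  have low : (J : ℝ) ^ 2 * S0.card ≤ ∑ x : k, (∑ j ∈ I, φ j x) ^ 2 := by
    calc (J : ℝ) ^ 2 * S0.card = ∑ x ∈ S0, (∑ j ∈ I, φ j x) ^ 2 := by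
          rw [Finset.sum_congr rfl fun x hx => by rw [hS0 x hx], Finset.sum_const, nsmul_eq_mul]; ring
      _ ≤ _ := Finset.sum_le_sum_of_subset_of_nonneg (Finset.subset_univ _) fun _ _ _ => sq_nonneg _
  have hmul : ∀ i j x, φ i x * φ j x =
      (quadraticChar k (((fi c i - C (κ ^ 2 + c)) * (fi c j - C (κ ^ 2 + c))).eval x) : ℝ) := by
    intro i j x
    simp only [φ]
    rw [eval_mul, eval_sub, eval_sub, fi_eval, fi_eval, eval_C, map_mul]
    push_cast; rfl
  have hdiag : ∀ i, ∑ x : k, φ i x * φ i x ≤ Fintype.card k := by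
    intro i
    rw [← Finset.card_univ, ← nsmul_one]
    refine Finset.sum_le_card_nsmul _ _ 1 ?_
    intro x _
    simp only [φ]
    by_cases h0 : it c i x - (κ ^ 2 + c) = 0
    · rw [h0]; simp
    · rcases quadraticChar_dichotomy h0 with h | h <;> rw [h] <;> simp
  have hoff : ∀ i ∈ I, ∀ j ∈ I, i ≠ j → ∑ x : k, φ i x * φ j x ≤ M := by
    intro i hi j hj hij
    rw [Finset.mem_Icc] at hi hj
    rcases lt_or_gt_of_ne hij with h | h
    · simp only [hmul]; exact hchar i j hi.1 h hj.2
    · rw [Finset.sum_congr rfl fun x _ => mul_comm (φ i x) (φ j x)]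
      simp only [hmul]; exact hchar j i hj.1 h hi.2
  have up : ∑ x : k, (∑ j ∈ I, φ j x) ^ 2 ≤ J * Fintype.card k + J ^ 2 * M := by
    have e : ∑ x : k, (∑ j ∈ I, φ j x) ^ 2 = ∑ i ∈ I, ∑ j ∈ I, ∑ x : k, φ i x * φ j x := by
      simp only [sq, Finset.sum_mul_sum]
      rw [Finset.sum_comm]
      refine Finset.sum_congr rfl fun i _ => ?_
      rw [Finset.sum_comm]
    rw [e]
    have h1 : ∀ i ∈ I, ∑ j ∈ I, ∑ x : k, φ i x * φ j x ≤ Fintype.card k + J * M := by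
      intro i hi
      have : ∀ j ∈ I, ∑ x : k, φ i x * φ j x ≤ (if i = j then (Fintype.card k : ℝ) else 0) + M := by
        intro j hj
        by_cases hij : i = j
        · subst hij; rw [if_pos rfl]; linarith [hdiag i]
        · rw [if_neg hij, zero_add]; exact hoff i hi j hj hij
      refine (Finset.sum_le_sum this).trans ?_
      rw [Finset.sum_add_distrib, Finset.sum_ite_eq, if_pos hi, Finset.sum_const, hI, nsmul_eq_mul]
    refine (Finset.sum_le_sum h1).trans ?_
    rw [Finset.sum_const, hI, nsmul_eq_mul]
    apply le_of_eq; ring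
  have h10 : (S0.card : ℝ) ≤ Fintype.card k / J + M := by
    have h11 : (J : ℝ) ^ 2 * S0.card ≤ (J : ℝ) ^ 2 * (Fintype.card k / J + M) := by
      refine (low.trans up).trans (le_of_eq ?_)
      field_simp
    exact le_of_mul_le_mul_left h11 (by positivity)
  have h12 : (S.card : ℝ) ≤ S0.card + J * T'.card := by exact_mod_cast hcard
  have h13 : (J : ℝ) * T'.card ≤ J * (B + 2) := mul_le_mul_of_nonneg_left hT' hJ0.le
  linarith

end Fin
end QLC

namespace QLC
universe u

theorem FF (ε : ℝ) (hε : 0 < ε) : ∃ m p0 : ℕ, ∀ (k : Type u) [Field k] [Fintype k] [DecidableEq k],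
    p0 ≤ ringChar k → 2 ^ m ∣ Fintype.card k - 1 → ∀ c : k, c ≠ -2 →
    ∀ S : Finset k, S.image (fun x => x ^ 2 + c) = S → (S.card : ℝ) ≤ ε * Fintype.card k := by
  obtain ⟨J, hJ⟩ := exists_nat_gt (4 / ε + ε + 1)
  have hε4 : 0 < 4 / ε := by positivity
  have hJ1 : (1 : ℝ) ≤ J := by linarith
  have hJ0 : (0 : ℝ) < J := by linarith
  have hJε : ε ≤ J := by linarith
  have hJ4 : 4 ≤ ε * J := by
    have : 4 / ε ≤ J := by linarith
    rw [div_le_iff₀ hε] at this; linarith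
  obtain ⟨s, hs⟩ : ∃ s : ℝ, s = ε / (16 * J) := ⟨_, rfl⟩
  have hs0 : 0 < s := by rw [hs]; positivity
  have hs1 : s ≤ 1 / 16 := by
    rw [hs, div_le_div_iff₀ (by positivity) (by norm_num)]; linarith
  have hsJ : J * s = ε / 16 := by rw [hs]; field_simp
  have hsε : s ≤ ε / 16 := by rw [← hsJ]; nlinarith
  obtain ⟨δ, hδ⟩ : ∃ δ : ℝ, δ = s ^ 2 / 6 := ⟨_, rfl⟩
  have hδ0 : 0 < δ := by rw [hδ]; positivity
  have hδs : δ ≤ s / 96 := by rw [hδ]; nlinarith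
  obtain ⟨N0, hN0⟩ := exists_nat_gt (2 / δ)
  have hN0' : 0 < N0 := by
    have : (0 : ℝ) < N0 := lt_trans (by positivity) hN0
    exact_mod_cast this
  have hN2 : 2 / (N0 : ℝ) ≤ δ := by
    have hN : (0 : ℝ) < N0 := by exact_mod_cast hN0'
    rw [div_lt_iff₀ hδ0] at hN0
    rw [div_le_iff₀ hN]; linarith
  have hG : ∀ n, 1 ≤ n → _ := fun n hn => GAL.{u} n hn δ hδ0
  choose! pG hpG using hG
  obtain ⟨pC, hpC⟩ := charsum.{u} (2 ^ (J + 2)) δ hδ0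
  obtain ⟨Q0, hQ0⟩ := exists_nat_gt (((2 : ℝ) ^ (J + 2) + 2 * N0 + 3) / δ)
  refine ⟨N0 + 1, 3 + pC + Q0 + ∑ n ∈ Finset.range (N0 + 1), pG n, ?_⟩
  intro k _ _ _ hp hdvd c hc S hS
  have h2 : (2 : k) ≠ 0 := by
    intro h
    have : ringChar k ∣ 2 := (ringChar.spec k 2).1 (by exact_mod_cast h)
    have := Nat.le_of_dvd (by norm_num) this
    omega
  have hpq : ringChar k ≤ Fintype.card k := by
    have : ringChar k ∣ Fintype.card k := (ringChar.spec k _).1 (by simp)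
    exact Nat.le_of_dvd Fintype.card_pos this
  have hq : ((2 : ℝ) ^ (J + 2) + 2 * N0 + 3) ≤ δ * Fintype.card k := by
    have h1 : (Q0 : ℝ) ≤ Fintype.card k := by
      have : Q0 ≤ Fintype.card k := by omega
      exact_mod_cast this
    have h3 : ((2 : ℝ) ^ (J + 2) + 2 * N0 + 3) / δ ≤ Fintype.card k := hQ0.le.trans h1
    rw [div_le_iff₀ hδ0] at h3; linarith
  obtain ⟨n, hn1, hnN, hn⟩ := exists_n (k := k) N0 hN0' c
  have hpn : pG n ≤ ringChar k := by
    have : pG n ≤ ∑ n ∈ Finset.range (N0 + 1), pG n :=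
      Finset.single_le_sum (fun _ _ => Nat.zero_le _) (Finset.mem_range.2 (by omega))
    omega
  obtain ⟨B, hB, hcase⟩ := hpG n hn1 k hpn c ((pow_dvd_pow 2 (by omega)).trans hdvd)
    ((im c n).filter fun t => -t ∈ im c n) (fun t h1 h2 => Finset.mem_filter.2 ⟨h1, h2⟩)
  have hW := W_card h2 c n
  set q : ℝ := (Fintype.card k : ℝ) with hqdef
  have hq0 : 0 < q := by rw [hqdef]; exact_mod_cast Fintype.card_pos
  have hp2 : (0 : ℝ) < 2 ^ (J + 2) := by positivity
  have hnN' : (n : ℝ) ≤ N0 := by exact_mod_cast hnN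
  have hn0 : (0 : ℝ) ≤ n := Nat.cast_nonneg _
  have hBq : B ≤ 2 * s * q := by
    have hW' : ((((im c n).filter fun t => -t ∈ im c n).card : ℕ) : ℝ) + 2 * (im c (n + 1)).card ≤
        2 * (im c n).card + 1 := by exact_mod_cast hW
    set w : ℝ := ((((im c n).filter fun t => -t ∈ im c n).card : ℕ) : ℝ)
    have e1 : q / N0 * 2 = q * (2 / N0) := by ring
    have e2 : q * (2 / N0) ≤ q * δ := mul_le_mul_of_nonneg_left hN2 hq0.le
    have hw : w ≤ δ * q + 1 := by linarith
    have hw0 : 0 ≤ w := Nat.cast_nonneg _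
    have e3 : w + δ * q + (2 * n + 2) ≤ 3 * (δ * q) := by linarith
    have e4 : (1 + δ) * q * (w + δ * q + (2 * n + 2)) ≤ (s * q) ^ 2 := by
      calc (1 + δ) * q * (w + δ * q + (2 * n + 2)) ≤ (1 + δ) * q * (3 * (δ * q)) :=
            mul_le_mul_of_nonneg_left e3 (by positivity)
        _ ≤ (2 * q) * (3 * (δ * q)) := by
            refine mul_le_mul_of_nonneg_right ?_ (by positivity)
            refine mul_le_mul_of_nonneg_right ?_ hq0.le
            linarith
        _ = (s * q) ^ 2 := by rw [hδ]; ring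
    have e5 : √ ((1 + δ) * q * (w + δ * q + (2 * n + 2))) ≤ s * q := by
      rw [Real.sqrt_le_left (by positivity)]; exact e4
    have e6 : δ * q ≤ s * q := mul_le_mul_of_nonneg_right (by linarith) hq0.le
    rw [hB]; linarith
  have hSim : ∀ m, S ⊆ im c m := by
    intro m
    induction m with
    | zero => intro x _; exact mem_im.2 ⟨x, rfl⟩
    | succ m ih =>
      rw [im_succ]; intro x hx
      rw [← hS] at hx
      exact Finset.image_subset_image ih hx
  have hsq : s * q ≤ ε / 16 * q := mul_le_mul_of_nonneg_right hsε hq0.le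
  have hεq : 0 < ε * q := by positivity
  rcases hcase with h | ⟨κ, hκ, ⟨a, ha1, _, ha⟩, ⟨b, hb1, _, hb⟩, hT⟩
  · have : (S.card : ℝ) ≤ (im c n).card := by exact_mod_cast Finset.card_le_card (hSim n)
    linarith
  · have hmom := moment c κ J (by exact_mod_cast hJ1) (δ * q + (2 : ℝ) ^ (J + 2)) B (by
      intro i j hi hij hj
      have m1 : (fi c i - C (κ ^ 2 + c)).Monic := half_monic (E := k) (n := i) c (κ ^ 2 + c)
      have m2 : (fi c j - C (κ ^ 2 + c)).Monic := half_monic (E := k) (n := j) c (κ ^ 2 + c)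
      have hdeg : ((fi c i - C (κ ^ 2 + c)) * (fi c j - C (κ ^ 2 + c))).natDegree = 2 ^ i + 2 ^ j := by
        rw [m1.natDegree_mul m2, natDegree_sub_C, natDegree_sub_C, (fi_monic_deg c i).2, (fi_monic_deg c j).2]
      have := hpC k (by omega) _ (m1.mul m2) (by
        rw [hdeg]
        have t1 : 2 ^ i ≤ 2 ^ (J + 1) := Nat.pow_le_pow_right (by norm_num) (by omega)
        have t2 : 2 ^ j ≤ 2 ^ (J + 1) := Nat.pow_le_pow_right (by norm_num) (by omega)
        rw [pow_succ 2 (J + 1)]; omega) (by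
        rw [hdeg]
        exact (Even.pow_of_ne_zero even_two (by omega)).add (Even.pow_of_ne_zero even_two (by omega)))
        (nonsq h2 c hc hκ ha1 hb1 ha hb hij (by omega))
      refine this.trans (le_of_eq ?_)
      push_cast; rfl) (by positivity) S hS (fun T hTS hTs => hT T (hTS.trans (hSim n)) hTs)
    have f1 : q / J ≤ ε / 4 * q := by
      rw [div_le_iff₀ hJ0]
      nlinarith
    have f2 : J * (B + 2) ≤ J * (3 * (s * q)) := by
      refine mul_le_mul_of_nonneg_left ?_ hJ0.le
      have : δ * q ≤ s * q := mul_le_mul_of_nonneg_right (by linarith) hq0.le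
      have : (0 : ℝ) ≤ N0 := Nat.cast_nonneg _
      linarith
    have f3 : J * (3 * (s * q)) = 3 * (ε / 16) * q := by rw [← hsJ]; ring
    have f4 : δ * q ≤ s * q := mul_le_mul_of_nonneg_right (by linarith) hq0.le
    have : (0 : ℝ) ≤ N0 := Nat.cast_nonneg _
    linarith

end QLC

namespace QLC
universe u

theorem FFpoly (ε : ℝ) (hε : 0 < ε) : ∃ m p0 : ℕ, ∀ (k : Type u) [Field k] [Finite k],
    p0 ≤ ringChar k → 2 ^ m ∣ Nat.card k - 1 → ∀ A B D : k, 2 * A * (4 * A * D - B ^ 2 + 2 * B + 8) ≠ 0 →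
    (Set.ncard {z : k | ∃ m, 0 < m ∧ (fun w => A * w ^ 2 + B * w + D)^[m] z = z} : ℝ) ≤ ε * Nat.card k := by
  obtain ⟨m, p0, h⟩ := FF.{u} ε hε
  refine ⟨m, p0, ?_⟩
  intro k _ _ hp hd A B D hABD
  classical
  have := Fintype.ofFinite k
  rw [Nat.card_eq_fintype_card] at hd ⊢
  have h2 : (2 : k) ≠ 0 := left_ne_zero_of_mul (left_ne_zero_of_mul hABD)
  have hA : A ≠ 0 := right_ne_zero_of_mul (left_ne_zero_of_mul hABD)
  have hE := right_ne_zero_of_mul hABD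
  set g : k → k := fun w => A * w ^ 2 + B * w + D with hg
  set P : Set k := {z : k | ∃ m, 0 < m ∧ g^[m] z = z} with hP
  let u : k → k := fun z => A * z + B / 2
  have hu : Function.Injective u := by
    intro x y hxy
    exact mul_left_cancel₀ hA (add_right_cancel hxy)
  let c : k := A * D + B / 2 - (B / 2) ^ 2
  have hconj : ∀ z, u (g z) = u z ^ 2 + c := by
    intro z
    have hB : B = 2 * (B / 2) := by field_simp
    simp only [u, hg, c]
    generalize B / 2 = b at *
    subst hB
    ring
  have hc : c ≠ -2 := by
    intro hc
    apply hE
    have hB : B = 2 * (B / 2) := by field_simp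
    simp only [c] at hc
    generalize B / 2 = b at *
    subst hB
    linear_combination 4 * hc
  let S : Finset k := P.toFinset.image u
  have hS : S.image (fun x => x ^ 2 + c) = S := by
    ext t
    simp only [S, Finset.mem_image, Set.mem_toFinset]
    constructor
    · rintro ⟨_, ⟨z, ⟨r, hr, hz⟩, rfl⟩, rfl⟩
      refine ⟨g z, ⟨r, hr, ?_⟩, hconj z⟩
      rw [← Function.iterate_succ_apply, Function.iterate_succ_apply', hz]
    · rintro ⟨z, ⟨r, hr, hz⟩, rfl⟩
      obtain ⟨r, rfl⟩ : ∃ r', r = r' + 1 := ⟨r - 1, by omega⟩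
      have hz' : g (g^[r] z) = z := by rw [← Function.iterate_succ_apply' g, hz]
      refine ⟨u (g^[r] z), ⟨g^[r] z, ⟨r + 1, hr, ?_⟩, rfl⟩, by rw [← hconj, hz']⟩
      rw [Function.iterate_succ_apply, hz']
  have hcard : S.card = P.ncard := by
    rw [Set.ncard_eq_toFinset_card', Finset.card_image_of_injective _ hu]
  have := h k hp hd c hc S hS
  rwa [hcard] at this

end QLC

namespace QLC
universe u

theorem poly_two {R : Type u} [CommRing R] (f : R[X]) (h : f.natDegree = 2) :
    f = C (f.coeff 2) * X ^ 2 + C (f.coeff 1) * X + C (f.coeff 0) := by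
  conv_lhs => rw [f.as_sum_range_C_mul_X_pow, h]
  simp [Finset.sum_range_succ]
  ring

theorem at_prime {K : Type u} [Field K] [NumberField K] (f : (𝓞 K)[X]) (hdeg : f.natDegree = 2) (ε : ℝ) (m p0 : ℕ)
    (hFF : ∀ (k : Type u) [Field k] [Finite k],
    p0 ≤ ringChar k → 2 ^ m ∣ Nat.card k - 1 → ∀ A B D : k, 2 * A * (4 * A * D - B ^ 2 + 2 * B + 8) ≠ 0 →
    (Set.ncard {z : k | ∃ m, 0 < m ∧ (fun w => A * w ^ 2 + B * w + D)^[m] z = z} : ℝ) ≤ ε * Nat.card k)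
    (p : ℕ) (hp : p.Prime) (hpp : p0 ≤ p) (hpm : p ≡ 1 [MOD 2 ^ m]) (𝔭 : Ideal (𝓞 K)) [h𝔭 : 𝔭.IsMaximal]
    (h0 : 𝔭 ≠ ⊥) (hmem : (p : 𝓞 K) ∈ 𝔭)
    (hD : 2 * f.coeff 2 * (4 * f.coeff 2 * f.coeff 0 - f.coeff 1 ^ 2 + 2 * f.coeff 1 + 8) ∉ 𝔭) :
    (perCount f 𝔭 : ℝ) ≤ ε * Ideal.absNorm 𝔭 ∧ p ≤ Ideal.absNorm 𝔭 := by
  let k := 𝓞 K ⧸ 𝔭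
  let _ : Field k := Ideal.Quotient.field 𝔭
  have hfin : Finite k := Ideal.finiteQuotientOfFreeOfNeBot 𝔭 h0
  have hN : Ideal.absNorm 𝔭 = Nat.card k := by rw [Ideal.absNorm_apply, Submodule.cardQuot_apply]
  have hchar : ringChar k = p := by
    have h1 : ((p : ℕ) : k) = 0 := by
      have := Ideal.Quotient.eq_zero_iff_mem.2 hmem
      rwa [map_natCast] at this
    have h2 : ringChar k ∣ p := (ringChar.spec k p).1 h1
    exact (hp.eq_one_or_self_of_dvd _ h2).resolve_left (CharP.ringChar_ne_one)
  have : Fintype k := Fintype.ofFinite k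
  have hcp : CharP k p := by rw [← hchar]; exact ringChar.charP k
  obtain ⟨r, _, hr⟩ := FiniteField.card k p
  rw [← Nat.card_eq_fintype_card] at hr
  have hm : 2 ^ m ∣ Nat.card k - 1 := by
    rw [hr]
    have := hpm.pow r
    rw [one_pow] at this
    exact (Nat.modEq_iff_dvd' (Nat.one_le_pow _ _ hp.pos)).1 this.symm
  have := hFF k (by rw [hchar]; exact hpp) hm (Ideal.Quotient.mk 𝔭 (f.coeff 2)) (Ideal.Quotient.mk 𝔭 (f.coeff 1))
    (Ideal.Quotient.mk 𝔭 (f.coeff 0)) (by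
      intro h
      apply hD
      rw [← Ideal.Quotient.eq_zero_iff_mem, ← h]
      simp only [map_mul, map_add, map_sub, map_pow, map_ofNat])
  constructor
  · rw [hN]
    refine le_trans (le_of_eq ?_) this
    rw [perCount]
    congr 2
    have e : (fun w : k => (f.map (Ideal.Quotient.mk 𝔭)).eval w) = fun w : k =>
        Ideal.Quotient.mk 𝔭 (f.coeff 2) * w ^ 2 + Ideal.Quotient.mk 𝔭 (f.coeff 1) * w +
          Ideal.Quotient.mk 𝔭 (f.coeff 0) := by
      funext w
      conv_lhs => rw [poly_two f hdeg]
      simp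
    ext z
    have e' := congrArg (fun g : k → k => ∃ m : ℕ, 0 < m ∧ g^[m] z = z) e
    exact Iff.of_eq e'
  · rw [hN, hr]
    exact Nat.le_self_pow r.pos.ne' p

end QLC

/-- Let `f ∈ 𝓞_K[x]` be quadratic.  If there is no linear polynomial
`σ(x) = a x + b` over `K` (with `a ≠ 0`) such that `f(σ(x)) = a·(x² − 2) + b`
(i.e. `σ⁻¹ ∘ f ∘ σ` is not the Chebyshev polynomial `x² − 2`), then for every `ε > 0`
there are infinitely many nonzero primes `𝔭` of `𝓞_K`, avoiding the leading coefficient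
of `f`, with `#Per(f_𝔭) ≤ ε·(N(𝔭) + 1)`. -/
theorem quadratic_liminf_zero_unless_chebyshev {K : Type*} [Field K] [NumberField K]
    (f : Polynomial (𝓞 K)) (hdeg : f.natDegree = 2)
    (hnc : ¬ ∃ a b : K, a ≠ 0 ∧
      (f.map (algebraMap (𝓞 K) K)).comp (C a * X + C b) =
        C a * (X ^ 2 - C 2) + C b) :
    ∀ ε : ℝ, 0 < ε →
      {𝔭 : Ideal (𝓞 K) | 𝔭.IsPrime ∧ 𝔭 ≠ ⊥ ∧ f.leadingCoeff ∉ 𝔭 ∧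
        (perCount f 𝔭 : ℝ) ≤ ε * ((Ideal.absNorm 𝔭 : ℝ) + 1)}.Infinite := by
  intro ε hε
  obtain ⟨m, p0, hFF⟩ := QLC.FFpoly ε hε
  set A := f.coeff 2 with hA
  set B := f.coeff 1 with hB
  set D := f.coeff 0 with hDd
  have hlead : f.leadingCoeff = A := by rw [leadingCoeff, hdeg]
  have hA0 : A ≠ 0 := by
    rw [← hlead, Ne, leadingCoeff_eq_zero]
    rintro rfl
    simp at hdeg
  have hE : 4 * A * D - B ^ 2 + 2 * B + 8 ≠ 0 := by
    intro h
    apply hnc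
    have hAK : algebraMap (𝓞 K) K A ≠ 0 := by
      rw [Ne, map_eq_zero_iff _ (RingOfIntegers.coe_injective)]; exact hA0
    have hK := congrArg (algebraMap (𝓞 K) K) h
    simp only [map_mul, map_add, map_sub, map_pow, map_ofNat, map_zero] at hK
    refine ⟨(algebraMap (𝓞 K) K A)⁻¹, -(algebraMap (𝓞 K) K B / 2) * (algebraMap (𝓞 K) K A)⁻¹,
      inv_ne_zero hAK, ?_⟩
    rw [QLC.poly_two f hdeg, ← hA, ← hB, ← hDd]
    simp only [Polynomial.map_add, Polynomial.map_mul, Polynomial.map_pow, map_C, map_X, add_comp, mul_comp,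
      pow_comp, C_comp, X_comp]
    generalize algebraMap (𝓞 K) K A = a at *
    generalize algebraMap (𝓞 K) K B = b at *
    generalize algebraMap (𝓞 K) K D = d at *
    have h1 : C a * C a⁻¹ = 1 := by rw [← C_mul, mul_inv_cancel₀ hAK, C_1]
    have hd : d = (b ^ 2 - 2 * b - 8) / 4 * a⁻¹ := by
      field_simp
      linear_combination hK
    have hb : b = 2 * (b / 2) := by field_simp
    generalize b / 2 = e at *
    subst hb
    have hd' : d = (e ^ 2 - e - 2) * a⁻¹ := by rw [hd]; ring
    rw [hd']
    simp only [C_mul, C_sub, C_neg, C_pow]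
    have h2 : (C 2 : K[X]) = 2 := C_ofNat 2
    rw [h2]
    linear_combination (C a⁻¹ * X ^ 2 - 2 * C e * C a⁻¹ * X + C e ^ 2 * C a⁻¹) * h1
  have hbad : 2 * A * (4 * A * D - B ^ 2 + 2 * B + 8) ≠ 0 := mul_ne_zero (mul_ne_zero two_ne_zero hA0) hE
  set β := 2 * A * (4 * A * D - B ^ 2 + 2 * B + 8) with hβ
  intro hfin
  obtain ⟨b, hb⟩ := (hfin.image Ideal.absNorm).bddAbove
  obtain ⟨p, hp, hpgt, hpm⟩ := Nat.exists_prime_gt_modEq_one (k := 2 ^ m)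
    (b + p0 + Ideal.absNorm (Ideal.span {β})) (by positivity)
  -- a prime above `p`
  have hne : Ideal.span {(p : 𝓞 K)} ≠ ⊤ := by
    intro h
    have h1 : Ideal.absNorm (Ideal.span {(p : 𝓞 K)}) = 1 := by rw [h]; exact Ideal.absNorm_top
    rw [Ideal.absNorm_span_singleton, show (p : 𝓞 K) = algebraMap ℤ (𝓞 K) (p : ℤ) by simp,
      Algebra.norm_algebraMap, Int.natAbs_pow, Int.natAbs_natCast] at h1
    have h3 : Module.finrank ℤ (𝓞 K) ≠ 0 := by
      rw [RingOfIntegers.rank]; exact Module.finrank_pos.ne'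
    exact hp.one_lt.ne' ((Nat.pow_eq_one.1 h1).resolve_right h3)
  obtain ⟨𝔭, h𝔭, hle⟩ := Ideal.exists_le_maximal _ hne
  have hmem : (p : 𝓞 K) ∈ 𝔭 := hle (Ideal.mem_span_singleton_self _)
  have h0 : 𝔭 ≠ ⊥ := by
    rintro rfl
    rw [Ideal.mem_bot, Nat.cast_eq_zero] at hmem
    exact hp.ne_zero hmem
  have hpN : p ≤ Ideal.absNorm 𝔭 := by
    have h1 : Ideal.absNorm 𝔭 ∣ Ideal.absNorm (Ideal.span {(p : 𝓞 K)}) := Ideal.absNorm_dvd_absNorm_of_le hle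
    rw [Ideal.absNorm_span_singleton, show (p : 𝓞 K) = algebraMap ℤ (𝓞 K) (p : ℤ) by simp,
      Algebra.norm_algebraMap, Int.natAbs_pow, Int.natAbs_natCast] at h1
    obtain ⟨r, _, hr⟩ := (Nat.dvd_prime_pow hp).1 h1
    have hr0 : r ≠ 0 := by
      rintro rfl
      rw [pow_zero, Ideal.absNorm_eq_one_iff] at hr
      exact h𝔭.ne_top hr
    rw [hr]; exact Nat.le_self_pow hr0 p
  have hβ𝔭 : β ∉ 𝔭 := by
    intro h
    have h1 : Ideal.absNorm 𝔭 ∣ Ideal.absNorm (Ideal.span {β}) :=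
      Ideal.absNorm_dvd_absNorm_of_le ((Ideal.span_singleton_le_iff_mem _).2 h)
    have h2 := Nat.le_of_dvd (Nat.pos_of_ne_zero (by
      rw [Ne, Ideal.absNorm_eq_zero_iff, Ideal.span_singleton_eq_bot]; exact hbad)) h1
    omega
  obtain ⟨hle', _⟩ := QLC.at_prime f hdeg ε m p0 hFF p hp (by omega) hpm 𝔭 h0 hmem hβ𝔭
  have : 𝔭 ∈ {𝔭 : Ideal (𝓞 K) | 𝔭.IsPrime ∧ 𝔭 ≠ ⊥ ∧ f.leadingCoeff ∉ 𝔭 ∧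
        (perCount f 𝔭 : ℝ) ≤ ε * ((Ideal.absNorm 𝔭 : ℝ) + 1)} := by
    refine ⟨h𝔭.isPrime, h0, ?_, ?_⟩
    · rw [hlead]
      intro h
      apply hβ𝔭
      rw [hβ]
      exact Ideal.mul_mem_right _ _ (Ideal.mul_mem_left _ _ h)
    · refine hle'.trans ?_
      refine mul_le_mul_of_nonneg_left ?_ hε.le
      linarith
  have := hb (Set.mem_image_of_mem _ this)
  omega
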